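/- (Kaczorowski) There exist a constant c₃ > 0 and a real number T₀ such that for every T ≥ T₀ the function π(x) − Li(x) has at least ⌊c₃·log T⌋ sign changes on the interval (2, T): there exist points x₀ < x₁ < ⋯ < x_N in (2, T) with N = ⌊c₃·log T⌋ and (π(x_i) − Li(x_i))·(π(x_{i+1}) − Li(x_{i+1})) < 0 for all 0 ≤ i < N. -/

import Mathlib

open Real Filter Set

/-- `Li(x) = ∫₂ˣ dt/log t`. -/
noncomputable def Li (x : ℝ) : ℝ := ∫ t in (2:ℝ)..x, 1 / Real.log t

/-- `π(x)`: the number of primes `p ≤ x`. -/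
noncomputable def primePi (x : ℝ) : ℕ := Nat.card {p : ℕ | p.Prime ∧ (p : ℝ) ≤ x}

namespace Kacz

/-- `f` has `N` strict sign alternations on `(a,b)`. -/
def Alt (f : ℝ → ℝ) (a b : ℝ) (N : ℕ) : Prop :=
  ∃ x : ℕ → ℝ, (∀ i ≤ N, a < x i ∧ x i < b) ∧ (∀ i < N, x i < x (i + 1)) ∧
    ∀ i < N, f (x i) * f (x (i + 1)) < 0

/-- a real sequence has `N` strict sign alternations. -/
def SAlt (A : ℕ → ℝ) (N : ℕ) : Prop :=
  ∃ k : ℕ → ℕ, (∀ i < N, k i < k (i + 1)) ∧ ∀ i < N, A (k i) * A (k (i + 1)) < 0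

lemma exists_step_pos (d : ℕ → ℝ) : ∀ (n m : ℕ), m < n → d m < 0 → 0 < d n →
    ∃ l, m ≤ l ∧ l < n ∧ 0 < d (l + 1) - d l := by
  intro n m hmn h1 h2
  by_contra! hcon
  have : ∀ j, m ≤ j → j ≤ n → d j ≤ d m := by
    intro j hj
    induction j, hj using Nat.le_induction with
    | base => intro _; exact le_rfl
    | succ j hj ih =>
      intro hjn
      have := hcon j hj (by omega)
      have := ih (by omega)
      linarith
  have := this n hmn.le le_rfl
  linarith

lemma rolle_seq (A : ℕ → ℝ) (v : ℝ) (hv : 0 < v) (N : ℕ) (h : SAlt A (N + 1)) :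
    SAlt (fun k => A (k + 1) - v * A k) N := by
  obtain ⟨k, hk, hA⟩ := h
  have key : ∀ i, ∃ l, i < N + 1 → (k i ≤ l ∧ l < k (i + 1) ∧
      0 < (A (l + 1) - v * A l) * A (k (i + 1))) := by
    intro i
    by_cases hi : i < N + 1
    swap
    · exact ⟨0, fun h => absurd h hi⟩
    have hp := hA i hi
    have hd : ∀ l, A (l + 1) - v * A l = v ^ (l + 1) * (A (l + 1) / v ^ (l + 1) - A l / v ^ l) := by
      intro l
      field_simp
      ring
    rcases mul_neg_iff.1 hp with ⟨h1, h2⟩ | ⟨h1, h2⟩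
    · obtain ⟨l, hl1, hl2, hl3⟩ := exists_step_pos (fun j => - (A j / v ^ j)) (k (i + 1)) (k i)
        (hk i hi) (by have := div_pos h1 (pow_pos hv (k i)); linarith)
        (by have := div_neg_of_neg_of_pos h2 (pow_pos hv (k (i+1))); linarith)
      refine ⟨l, fun _ => ⟨hl1, hl2, ?_⟩⟩
      rw [hd]
      have := pow_pos hv (l + 1)
      apply mul_pos_of_neg_of_neg _ h2
      apply mul_neg_of_pos_of_neg this
      linarith
    · obtain ⟨l, hl1, hl2, hl3⟩ := exists_step_pos (fun j => (A j / v ^ j)) (k (i + 1)) (k i)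
        (hk i hi) (by have := div_neg_of_neg_of_pos h1 (pow_pos hv (k i)); linarith)
        (by have := div_pos h2 (pow_pos hv (k (i+1))); linarith)
      refine ⟨l, fun _ => ⟨hl1, hl2, ?_⟩⟩
      rw [hd]
      have := pow_pos hv (l + 1)
      positivity
  choose l hl using key
  refine ⟨l, fun i hi => ?_, fun i hi => ?_⟩
  · have h1 := hl i (by omega)
    have h2 := hl (i + 1) (by omega)
    omega
  · have h1 := (hl i (by omega)).2.2
    have h2 := (hl (i + 1) (by omega)).2.2
    have h3 := hA (i + 1) (by omega)
    simp only
    set X := A (l i + 1) - v * A (l i)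
    set Y := A (l (i+1) + 1) - v * A (l (i+1))
    set P := A (k (i + 1))
    set Q := A (k (i + 1 + 1))
    by_contra! hc
    have : 0 ≤ (X * Y) * (P * Q) := by nlinarith [mul_pos h1 h2]
    have h4 : X * Y * (P * Q) = (X * P) * (Y * Q) := by ring
    have h5 := mul_pos h1 h2
    rcases hc.lt_or_eq with h6 | h6
    · nlinarith
    · rw [← h6] at h4; linarith

lemma alt_neg {f : ℝ → ℝ} {a b : ℝ} {N : ℕ} (h : Alt (fun u => - f u) a b N) : Alt f a b N := by
  obtain ⟨x, h1, h2, h3⟩ := h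
  exact ⟨x, h1, h2, fun i hi => by simpa using h3 i hi⟩

/-- the insertion step. -/
lemma alt_insert (f : ℝ → ℝ) (a b v : ℝ) (N : ℕ) (hN : 1 ≤ N)
    (hpos : ∀ u, a < u → u < v → u < b → 0 ≤ f u)
    (hP : ∀ y, v < y → ∃ w, a < w ∧ w < b ∧ w < y ∧ 0 < f w)
    (hM : ∀ y, v < y → ∃ w, a < w ∧ w < b ∧ v ≤ w ∧ w < y ∧ f w < 0)
    (h : Alt (fun u => (u - v) * f u) a b N) : Alt f a b (N + 1) := by
  obtain ⟨u, hu, hlt, halt⟩ := h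
  have hne : ∀ i ≤ N, (u i - v) * f (u i) ≠ 0 := by
    intro i hi h0
    rcases Nat.lt_or_ge i N with h1 | h1
    · have := halt i h1
      simp only [h0, zero_mul, lt_irrefl] at this
    · obtain ⟨j, rfl⟩ : ∃ j, i = j + 1 := ⟨i - 1, by omega⟩
      have := halt j (by omega)
      simp only [h0, mul_zero, lt_irrefl] at this
  have hmono : ∀ i, 1 ≤ i → i ≤ N → u 1 ≤ u i := by
    intro i hi
    induction i, hi using Nat.le_induction with
    | base => intro _; exact le_rfl
    | succ j hj ih => intro h; exact (ih (by omega)).trans (hlt j (by omega)).le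
  have halt' : ∀ i, i < N → v < u i → v < u (i+1) → f (u i) * f (u (i+1)) < 0 := by
    intro i hi h1 h2
    have := halt i hi
    simp only at this
    have e : (u i - v) * f (u i) * ((u (i+1) - v) * f (u (i+1))) =
      ((u i - v) * (u (i+1) - v)) * (f (u i) * f (u (i+1))) := by ring
    rw [e] at this
    have hp : 0 < (u i - v) * (u (i+1) - v) := mul_pos (by linarith) (by linarith)
    by_contra! hc
    have := mul_nonneg hp.le hc
    linarith
  have hv0 : u 0 ≠ v := by
    intro h0
    apply hne 0 (by omega)
    rw [h0]; simp
  rcases lt_or_gt_of_ne hv0 with h0 | h0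
  · have hf0 : 0 < f (u 0) := by
      have h1 := hpos (u 0) (hu 0 (by omega)).1 h0 (hu 0 (by omega)).2
      rcases h1.lt_or_eq with h2 | h2
      · exact h2
      · exfalso; apply hne 0 (by omega); rw [← h2]; simp
    have hg1 : 0 < (u 1 - v) * f (u 1) := by
      have := halt 0 (by omega)
      simp only [zero_add] at this
      have h3 : (u 0 - v) * f (u 0) < 0 := mul_neg_of_neg_of_pos (by linarith) hf0
      by_contra! hc
      have := mul_nonneg_of_nonpos_of_nonpos h3.le hc
      linarith
    have hv1 : v < u 1 := by
      by_contra! hc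
      rcases hc.lt_or_eq with h4 | h4
      · have h5 := hpos (u 1) (hu 1 (by omega)).1 h4 (hu 1 (by omega)).2
        have := mul_nonpos_of_nonpos_of_nonneg (by linarith : u 1 - v ≤ 0) h5
        linarith
      · rw [h4] at hg1; simp at hg1
    have hf1 : 0 < f (u 1) := by
      by_contra! hc
      have := mul_nonpos_of_nonneg_of_nonpos (by linarith : 0 ≤ u 1 - v) hc
      linarith
    obtain ⟨w, hw1, hw2, hw3, hw4, hw5⟩ := hM (u 1) hv1
    refine ⟨fun i => match i with | 0 => u 0 | 1 => w | (n+2) => u (n+1), ?_, ?_, ?_⟩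
    · intro i hi
      match i with
      | 0 => exact hu 0 (by omega)
      | 1 => exact ⟨hw1, hw2⟩
      | (n+2) => exact hu (n+1) (by omega)
    · intro i hi
      match i with
      | 0 => exact lt_of_lt_of_le h0 hw3
      | 1 => exact hw4
      | (n+2) => exact hlt (n+1) (by omega)
    · intro i hi
      match i with
      | 0 => exact mul_neg_of_pos_of_neg hf0 hw5
      | 1 => exact mul_neg_of_neg_of_pos hw5 hf1
      | (n+2) => exact halt' (n+1) (by omega) (hv1.trans_le (hmono _ (by omega) (by omega)))
                  (hv1.trans_le (hmono _ (by omega) (by omega)))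
  · have hall : ∀ i ≤ N, v < u i := by
      intro i hi
      rcases Nat.eq_zero_or_pos i with h1 | h1
      · rw [h1]; exact h0
      · have h2 := hlt 0 (by omega)
        exact h0.trans (h2.trans_le (hmono i h1 hi))
    have : ∃ w, a < w ∧ w < b ∧ w < u 0 ∧ f w * f (u 0) < 0 := by
      have hf0 : f (u 0) ≠ 0 := fun h => hne 0 (by omega) (by rw [h]; simp)
      rcases lt_or_gt_of_ne hf0 with h1 | h1
      · obtain ⟨w, a1, a2, a3, a4⟩ := hP _ h0
        exact ⟨w, a1, a2, a3, mul_neg_of_pos_of_neg a4 h1⟩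
      · obtain ⟨w, a1, a2, _, a3, a4⟩ := hM _ h0
        exact ⟨w, a1, a2, a3, mul_neg_of_neg_of_pos a4 h1⟩
    obtain ⟨w, hw1, hw2, hw3, hw4⟩ := this
    refine ⟨fun i => match i with | 0 => w | (n+1) => u n, ?_, ?_, ?_⟩
    · intro i hi
      match i with
      | 0 => exact ⟨hw1, hw2⟩
      | (n+1) => exact hu n (by omega)
    · intro i hi
      match i with
      | 0 => exact hw3
      | (n+1) => exact hlt n (by omega)
    · intro i hi
      match i with
      | 0 => exact hw4
      | (n+1) => exact halt' n (by omega) (hall n (by omega)) (hall (n+1) (by omega))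

lemma mom_sub (f : ℝ → ℝ) (a b v : ℝ) (hf : IntervalIntegrable f MeasureTheory.volume a b) (k : ℕ) :
    (∫ u in a..b, ((u - v) * f u) * u ^ k) =
      (∫ u in a..b, f u * u ^ (k+1)) - v * ∫ u in a..b, f u * u ^ k := by
  have h : ∀ k : ℕ, IntervalIntegrable (fun u => f u * u ^ k) MeasureTheory.volume a b :=
    fun k => hf.mul_continuousOn (by fun_prop)
  rw [← intervalIntegral.integral_const_mul, ← intervalIntegral.integral_sub (h _) ((h k).const_mul v)]
  congr 1
  ext u
  ring

lemma exists_pos_neg (f : ℝ → ℝ) (a b : ℝ) (ha : 0 < a) (hab : a < b) (N : ℕ)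
    (h : SAlt (fun k => ∫ u in a..b, f u * u ^ k) (N + 1)) : ∃ q, a < q ∧ q < b ∧ f q < 0 := by
  by_contra! hc
  obtain ⟨k, -, hk⟩ := h
  have hm : ∀ j : ℕ, 0 ≤ ∫ u in a..b, f u * u ^ j := by
    intro j
    rw [intervalIntegral.integral_of_le hab.le, MeasureTheory.integral_Ioc_eq_integral_Ioo]
    apply MeasureTheory.setIntegral_nonneg measurableSet_Ioo
    intro x hx
    have : 0 ≤ x := ha.le.trans hx.1.le
    have := hc x hx.1 hx.2
    positivity
  have := hk 0 (by omega)
  have h1 := mul_nonneg (hm (k 0)) (hm (k (0+1)))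
  simp only at this
  linarith

/-- Variation diminishing: sign alternations of moments give sign alternations of the function. -/
theorem variation (a b : ℝ) (ha : 0 < a) (hab : a < b) (N : ℕ) :
    ∀ f : ℝ → ℝ, IntervalIntegrable f MeasureTheory.volume a b →
    SAlt (fun k => ∫ u in a..b, f u * u ^ k) N → Alt f a b N := by
  induction N with
  | zero =>
    intro f _ _
    exact ⟨fun _ => (a + b) / 2, fun i _ => ⟨by linarith, by linarith⟩, fun i hi => by omega,
      fun i hi => by omega⟩
  | succ N ih =>
    -- one-sided version
    have main : ∀ f : ℝ → ℝ, IntervalIntegrable f MeasureTheory.volume a b →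
        SAlt (fun k => ∫ u in a..b, f u * u ^ k) (N + 1) →
        sInf {u | a < u ∧ u < b ∧ 0 < f u} ≤ sInf {u | a < u ∧ u < b ∧ f u < 0} →
        (∃ p, a < p ∧ p < b ∧ 0 < f p) → (∃ q, a < q ∧ q < b ∧ f q < 0) → Alt f a b (N + 1) := by
      intro f hf hS hle hp hq
      set v := sInf {u | a < u ∧ u < b ∧ f u < 0} with hv
      have hbd : ∀ P : ℝ → Prop, BddBelow {u | a < u ∧ u < b ∧ P u} := fun P => ⟨a, fun u hu => hu.1.le⟩
      rcases Nat.eq_zero_or_pos N with h0 | h0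
      · subst h0
        obtain ⟨p, p1, p2, p3⟩ := hp
        obtain ⟨q, q1, q2, q3⟩ := hq
        have hpq : p ≠ q := by rintro rfl; linarith
        rcases lt_or_gt_of_ne hpq with h | h
        · refine ⟨fun i => match i with | 0 => p | _ => q, ?_, ?_, ?_⟩
          · intro i hi
            match i with
            | 0 => exact ⟨p1, p2⟩
            | (n+1) => exact ⟨q1, q2⟩
          · intro i hi
            match i with
            | 0 => exact h
          · intro i hi
            match i with
            | 0 => exact mul_neg_of_pos_of_neg p3 q3
        · refine ⟨fun i => match i with | 0 => q | _ => p, ?_, ?_, ?_⟩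
          · intro i hi
            match i with
            | 0 => exact ⟨q1, q2⟩
            | (n+1) => exact ⟨p1, p2⟩
          · intro i hi
            match i with
            | 0 => exact h
          · intro i hi
            match i with
            | 0 => exact mul_neg_of_neg_of_pos q3 p3
      have hav : a ≤ v := by
        obtain ⟨q, hq⟩ := hq
        exact le_csInf ⟨q, hq⟩ (fun u hu => hu.1.le)
      apply alt_insert f a b v N h0
      · intro u h1 h2 h3
        by_contra! hc
        have : v ≤ u := csInf_le (hbd _) ⟨h1, h3, hc⟩
        linarith
      · intro y hy
        obtain ⟨w, ⟨w1, w2, w3⟩, w4⟩ := exists_lt_of_csInf_lt (s := {u | a < u ∧ u < b ∧ 0 < f u})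
          (by obtain ⟨p, hp⟩ := hp; exact ⟨p, hp⟩) (hle.trans_lt hy)
        exact ⟨w, w1, w2, w4, w3⟩
      · intro y hy
        obtain ⟨w, ⟨w1, w2, w3⟩, w4⟩ := exists_lt_of_csInf_lt (s := {u | a < u ∧ u < b ∧ f u < 0})
          (by obtain ⟨p, hp⟩ := hq; exact ⟨p, hp⟩) hy
        exact ⟨w, w1, w2, csInf_le (hbd _) ⟨w1, w2, w3⟩, w4, w3⟩
      · apply ih
        · exact hf.continuousOn_mul (by fun_prop)
        · have := rolle_seq _ v (ha.trans_le hav) N hS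
          convert this using 2 with k
          exact mom_sub f a b v hf k
    intro f hf hS
    have hS' : SAlt (fun k => ∫ u in a..b, (-f u) * u ^ k) (N + 1) := by
      obtain ⟨k, h1, h2⟩ := hS
      refine ⟨k, h1, fun i hi => ?_⟩
      have := h2 i hi
      simpa using this
    have hq := exists_pos_neg f a b ha hab N hS
    have hp := exists_pos_neg (fun u => - f u) a b ha hab N hS'
    have hp' : ∃ p, a < p ∧ p < b ∧ 0 < f p := by
      obtain ⟨p, h1, h2, h3⟩ := hp; exact ⟨p, h1, h2, by linarith⟩
    rcases le_total (sInf {u | a < u ∧ u < b ∧ 0 < f u}) (sInf {u | a < u ∧ u < b ∧ f u < 0}) with h | h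
    · exact main f hf hS h hp' hq
    · apply alt_neg
      apply main _ hf.neg hS' _ _ hp
      · simpa using h
      · obtain ⟨p, h1, h2, h3⟩ := hq; exact ⟨p, h1, h2, by show 0 < - f p; linarith⟩

/-- `π(e^u) - Li(e^u)`. -/
noncomputable def B (u : ℝ) : ℝ := (primePi (exp u) : ℝ) - Li (exp u)

/-- Final assembly. -/
theorem final_of_alt (h : ∃ C₁ C₂ : ℝ, 0 < C₁ ∧ ∀ N : ℕ, Alt B (log 2) (C₁ * N + C₂) N) :
    ∃ c₃ : ℝ, 0 < c₃ ∧ ∃ T₀ : ℝ, ∀ T : ℝ, T₀ ≤ T →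
      ∃ x : ℕ → ℝ,
        (∀ i ≤ ⌊c₃ * Real.log T⌋₊, 2 < x i ∧ x i < T) ∧
        (∀ i < ⌊c₃ * Real.log T⌋₊, x i < x (i + 1)) ∧
        (∀ i < ⌊c₃ * Real.log T⌋₊,
          ((primePi (x i) : ℝ) - Li (x i)) * ((primePi (x (i + 1)) : ℝ) - Li (x (i + 1))) < 0) := by
  obtain ⟨C₁, C₂, hC, h⟩ := h
  refine ⟨1 / (2 * C₁), by positivity, exp (max 0 (2 * C₂)), fun T hT => ?_⟩
  have hT0 : 0 < T := (exp_pos _).trans_le hT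
  have hlog : max 0 (2 * C₂) ≤ log T := (le_log_iff_exp_le hT0).2 hT
  have h0 : 0 ≤ log T := (le_max_left _ _).trans hlog
  have h2 : 2 * C₂ ≤ log T := (le_max_right _ _).trans hlog
  set N := ⌊1 / (2 * C₁) * Real.log T⌋₊ with hN
  have hNle : (N : ℝ) ≤ 1 / (2 * C₁) * log T := Nat.floor_le (by positivity)
  have hb : C₁ * N + C₂ ≤ log T := by
    have : C₁ * N ≤ C₁ * (1 / (2 * C₁) * log T) := by gcongr
    have e : C₁ * (1 / (2 * C₁) * log T) = log T / 2 := by field_simp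
    linarith
  obtain ⟨x, hx1, hx2, hx3⟩ := h N
  refine ⟨fun i => exp (x i), fun i hi => ⟨?_, ?_⟩, fun i hi => exp_lt_exp.2 (hx2 i hi), fun i hi => hx3 i hi⟩
  · exact (log_lt_iff_lt_exp (by norm_num)).1 (hx1 i hi).1
  · exact (lt_log_iff_exp_lt hT0).1 ((hx1 i hi).2.trans_le hb)

end Kacz

namespace Kacz

/-- Factor one zero out of an entire function. -/
lemma factor_one (f : ℂ → ℂ) (hf : Differentiable ℂ f) (a : ℂ) (h : analyticOrderAt f a ≠ ⊤) :
    ∃ G : ℂ → ℂ, Differentiable ℂ G ∧ G a ≠ 0 ∧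
      ∀ z, f z = (z - a) ^ (analyticOrderNatAt f a) * G z := by
  have hfa : AnalyticAt ℂ f a := hf.analyticAt a
  obtain ⟨g, hg, hga, hfg⟩ := (hfa.analyticOrderAt_ne_top).1 h
  set n := analyticOrderNatAt f a
  refine ⟨Function.update (fun z => f z / (z - a) ^ n) a (g a), ?_, by simpa using hga, ?_⟩
  · intro z
    by_cases hz : z = a
    · subst hz
      refine hg.differentiableAt.congr_of_eventuallyEq ?_
      filter_upwards [hfg] with w hw
      by_cases hwz : w = z
      · subst hwz; simp
      · rw [Function.update_of_ne hwz, hw]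
        have : w - z ≠ 0 := sub_ne_zero.2 hwz
        simp only [smul_eq_mul]
        field_simp
    · have : DifferentiableAt ℂ (fun z => f z / (z - a) ^ n) z :=
        (hf z).div (by fun_prop) (pow_ne_zero _ (sub_ne_zero.2 hz))
      refine this.congr_of_eventuallyEq ?_
      filter_upwards [isOpen_ne.mem_nhds hz] with w hw
      rw [Function.update_of_ne hw]
  · intro z
    by_cases hz : z = a
    · subst hz
      have := hfg.self_of_nhds
      simpa using this
    · rw [Function.update_of_ne hz]
      have : z - a ≠ 0 := sub_ne_zero.2 hz
      field_simp

lemma order_ne_top (f : ℂ → ℂ) (hf : Differentiable ℂ f) (z₀ : ℂ) (h0 : f z₀ ≠ 0) (a : ℂ) :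
    analyticOrderAt f a ≠ ⊤ := by
  intro h
  rw [analyticOrderAt_eq_top] at h
  have hA : AnalyticOnNhd ℂ f univ := fun z _ => hf.analyticAt z
  have := hA.eqOn_zero_of_preconnected_of_eventuallyEq_zero isPreconnected_univ (mem_univ a) h
  exact h0 (this (mem_univ z₀))

/-- Factor finitely many zeros out of an entire function. -/
lemma factor_finset (f : ℂ → ℂ) (hf : Differentiable ℂ f) (z₀ : ℂ) (h0 : f z₀ ≠ 0) (S : Finset ℂ) :
    ∃ G : ℂ → ℂ, Differentiable ℂ G ∧ (∀ a ∈ S, G a ≠ 0) ∧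
      ∀ z, f z = (∏ a ∈ S, (z - a) ^ (analyticOrderNatAt f a)) * G z := by
  classical
  suffices H : ∃ G : ℂ → ℂ, Differentiable ℂ G ∧ (∀ a ∈ S, G a ≠ 0) ∧
      (∀ z, f z = (∏ a ∈ S, (z - a) ^ (analyticOrderNatAt f a)) * G z) ∧
      ∀ b ∉ S, analyticOrderAt G b = analyticOrderAt f b by
    obtain ⟨G, h1, h2, h3, -⟩ := H
    exact ⟨G, h1, h2, h3⟩
  induction S using Finset.induction_on with
  | empty => exact ⟨f, hf, by simp, by simp, by simp⟩
  | insert a S ha ih =>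
    obtain ⟨G, h1, h2, h3, h4⟩ := ih
    have hord := h4 a ha
    have hnat : analyticOrderNatAt G a = analyticOrderNatAt f a := by
      simp [analyticOrderNatAt, hord]
    obtain ⟨H, H1, H2, H3⟩ := factor_one G h1 a (by rw [hord]; exact order_ne_top f hf z₀ h0 a)
    rw [hnat] at H3
    refine ⟨H, H1, ?_, ?_, ?_⟩
    · intro b hb
      rcases Finset.mem_insert.1 hb with rfl | hb
      · exact H2
      · intro hb0
        apply h2 b hb
        rw [H3, hb0, mul_zero]
    · intro z
      rw [Finset.prod_insert ha, h3 z, H3 z]; ring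
    · intro b hb
      rw [Finset.mem_insert, not_or] at hb
      rw [← h4 b hb.2]
      have e : G = (fun z => (z - a) ^ (analyticOrderNatAt f a)) * H := funext H3
      have hA : AnalyticAt ℂ (fun z => (z - a) ^ (analyticOrderNatAt f a)) b := by fun_prop
      have hz : analyticOrderAt (fun z => (z - a) ^ (analyticOrderNatAt f a)) b = 0 := by
        rw [hA.analyticOrderAt_eq_zero]
        exact pow_ne_zero _ (sub_ne_zero.2 hb.1)
      conv_rhs => rw [e, analyticOrderAt_mul hA (H1.analyticAt b), hz, zero_add]

lemma order_pos (f : ℂ → ℂ) (hf : Differentiable ℂ f) (z₀ : ℂ) (h0 : f z₀ ≠ 0) (a : ℂ) (ha : f a = 0) :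
    0 < analyticOrderNatAt f a := by
  by_contra h
  obtain ⟨G, h1, h2, h3⟩ := factor_one f hf a (order_ne_top f hf z₀ h0 a)
  have : analyticOrderNatAt f a = 0 := by omega
  have e := h3 a
  rw [this, ha] at e
  simp at e
  exact h2 e.symm

lemma order_eq_zero (f : ℂ → ℂ) (hf : Differentiable ℂ f) (a : ℂ) (ha : f a ≠ 0) :
    analyticOrderNatAt f a = 0 := by
  have := (hf.analyticAt a).analyticOrderAt_eq_zero.2 ha
  simp [analyticOrderNatAt, this]

/-- log-derivative of the factorization -/
lemma logDeriv_factor (f G : ℂ → ℂ) (hG : Differentiable ℂ G) (S : Finset ℂ) (n : ℂ → ℕ)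
    (h : ∀ z, f z = (∏ a ∈ S, (z - a) ^ (n a)) * G z) (z : ℂ) (hz : f z ≠ 0) :
    deriv f z / f z = ∑ a ∈ S, (n a : ℂ) / (z - a) + deriv G z / G z := by
  have e : f = fun z => (∏ a ∈ S, (z - a) ^ (n a)) * G z := funext h
  have hz' := hz
  rw [h] at hz'
  have hG0 := right_ne_zero_of_mul hz'
  have hP := left_ne_zero_of_mul hz'
  have hP' := Finset.prod_ne_zero_iff.1 hP
  change logDeriv f z = _ + logDeriv G z
  rw [e, logDeriv_mul z hP hG0 (by fun_prop) (hG z)]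
  congr 1
  rw [logDeriv_prod]
  · refine Finset.sum_congr rfl fun a ha => ?_
    rw [logDeriv_fun_pow (by fun_prop)]
    simp [logDeriv_apply, div_eq_mul_inv]
  · exact hP'
  · intro a ha; fun_prop

end Kacz

namespace Kacz

open MeasureTheory Asymptotics

noncomputable def FF (t : ℝ) : ℂ := if 1 < t then ((Int.fract t : ℝ) : ℂ) else 0

lemma FF_meas : Measurable FF := by
  unfold FF
  refine Measurable.ite measurableSet_Ioi ?_ measurable_const
  exact Complex.measurable_ofReal.comp measurable_fract

lemma FF_norm_le (t : ℝ) : ‖FF t‖ ≤ 1 := by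
  unfold FF
  split_ifs
  · rw [Complex.norm_real, Real.norm_eq_abs, abs_of_nonneg (Int.fract_nonneg t)]
    exact (Int.fract_lt_one t).le
  · simp

lemma FF_mellin_diff (s : ℂ) (hs : s.re < 0) : DifferentiableAt ℂ (mellin FF) s := by
  apply mellin_differentiableAt_of_isBigO_rpow (a := 0) (b := s.re - 1)
  · apply LocallyIntegrable.locallyIntegrableOn
    refine (locallyIntegrable_const (1:ℝ)).mono FF_meas.aestronglyMeasurable ?_
    filter_upwards with t
    simpa using FF_norm_le t
  · simp only [neg_zero, rpow_zero]
    exact IsBigO.of_bound 1 (by filter_upwards with t; simpa using FF_norm_le t)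
  · exact hs
  · apply IsBigO.of_bound 1
    have : Iio (1:ℝ) ∈ nhdsWithin (0:ℝ) (Ioi 0) := mem_nhdsWithin_of_mem_nhds (Iio_mem_nhds (by norm_num))
    filter_upwards [this] with t ht
    have : ¬ (1 < t) := not_lt.2 (le_of_lt ht)
    simp [FF, this]
  · linarith

lemma zeta1_formula_aux (s : ℂ) (hs : 1 < s.re) :
    riemannZeta₁ s = s - s * (s - 1) * mellin FF (-s) := by
  have hs1 : s ≠ 1 := by rintro rfl; simp at hs
  have hs1' : s - 1 ≠ 0 := sub_ne_zero.2 hs1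
  have h1 := riemannZeta_eq_inv_sub_mul hs1
  have h2 := LSeries_one_eq_riemannZeta hs
  have h3 := LSeries_eq_mul_integral' 1 (r := 1) zero_le_one hs (by
    apply IsBigO.of_bound 1
    filter_upwards with n; simp)
  have hI : IntegrableOn (fun t : ℝ => (t:ℂ) ^ (-s)) (Ioi 1) := by
    rw [integrableOn_Ioi_cpow_iff zero_lt_one]; simpa using hs
  have hI2 : MellinConvergent FF (-s) := by
    apply mellinConvergent_of_isBigO_rpow (a := 0) (b := (-s).re - 1)
    · apply LocallyIntegrable.locallyIntegrableOn
      refine (locallyIntegrable_const (1:ℝ)).mono FF_meas.aestronglyMeasurable ?_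
      filter_upwards with t
      simpa using FF_norm_le t
    · simp only [neg_zero, rpow_zero]
      exact IsBigO.of_bound 1 (by filter_upwards with t; simpa using FF_norm_le t)
    · simp; linarith
    · apply IsBigO.of_bound 1
      have : Iio (1:ℝ) ∈ nhdsWithin (0:ℝ) (Ioi 0) := mem_nhdsWithin_of_mem_nhds (Iio_mem_nhds (by norm_num))
      filter_upwards [this] with t ht
      have : ¬ (1 < t) := not_lt.2 (le_of_lt ht)
      simp [FF, this]
    · linarith
  have hM : mellin FF (-s) = ∫ t in Ioi (1:ℝ), (t:ℂ) ^ (-s - 1) * FF t := by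
    rw [mellin]
    simp only [smul_eq_mul]
    rw [← setIntegral_eq_of_subset_of_forall_sdiff_eq_zero (s := Ioi (1:ℝ)) measurableSet_Ioi
      (Ioi_subset_Ioi zero_le_one)]
    intro t ht
    have : ¬ (1 < t) := ht.2
    simp [FF, this]
  have hI3 : IntegrableOn (fun t : ℝ => (t:ℂ) ^ (-s - 1) * FF t) (Ioi 1) :=
    IntegrableOn.mono_set hI2 (Ioi_subset_Ioi zero_le_one)
  have h4 : ∫ t in Ioi (1:ℝ), (∑ k ∈ Finset.Icc 1 ⌊t⌋₊, (1 : ℕ → ℂ) k) * (t:ℂ) ^ (-(s + 1)) =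
      (s - 1)⁻¹ - mellin FF (-s) := by
    have e : ∫ t in Ioi (1:ℝ), (t:ℂ) ^ (-s) = (s - 1)⁻¹ := by
      rw [integral_Ioi_cpow_of_lt (by simpa using hs) zero_lt_one]
      simp only [Complex.ofReal_one, Complex.one_cpow]
      rw [← neg_inj, neg_div', ← inv_neg, neg_neg, one_div]
      congr 1; ring
    rw [hM, ← e, ← integral_sub hI hI3]
    apply setIntegral_congr_fun measurableSet_Ioi
    intro t ht
    have ht' : 1 < t := ht
    have ht0 : (t:ℂ) ≠ 0 := by exact_mod_cast (by linarith : t ≠ 0)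
    simp only [Pi.one_apply, Finset.sum_const, Nat.card_Icc, add_tsub_cancel_right, nsmul_eq_mul, mul_one]
    have e1 : (t:ℂ) ^ (-s) = t * (t:ℂ) ^ (-s - 1) := by
      rw [Complex.cpow_sub _ _ ht0, Complex.cpow_one]; field_simp
    rw [e1, show -(s+1) = -s - 1 by ring]
    simp only [FF, if_pos ht']
    have e2 : ((⌊t⌋₊ : ℕ) : ℂ) = t - ((Int.fract t : ℝ) : ℂ) := by
      have : ((⌊t⌋₊ : ℕ) : ℝ) = t - Int.fract t := by
        rw [Int.self_sub_fract]; exact natCast_floor_eq_intCast_floor (by linarith)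
      exact_mod_cast congrArg Complex.ofReal this
    rw [e2]; ring
  rw [h4, h2, h1] at h3
  field_simp at h3
  rw [h3]; ring

lemma zeta1_formula (s : ℂ) (hs : 0 < s.re) :
    riemannZeta₁ s = s - s * (s - 1) * mellin FF (-s) := by
  set U : Set ℂ := {s | 0 < s.re}
  have hU : IsOpen U := isOpen_lt continuous_const Complex.continuous_re
  have hUc : IsPreconnected U := (convex_halfSpace_re_gt 0).isPreconnected
  have h1 : AnalyticOnNhd ℂ riemannZeta₁ U := fun z _ => differentiable_riemannZeta₁.analyticAt z
  have h2 : AnalyticOnNhd ℂ (fun s => s - s * (s - 1) * mellin FF (-s)) U := by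
    apply DifferentiableOn.analyticOnNhd _ hU
    intro z hz
    apply DifferentiableAt.differentiableWithinAt
    have : DifferentiableAt ℂ (fun s => mellin FF (-s)) z :=
      DifferentiableAt.comp z (f := fun s => -s) (g := mellin FF)
        (FF_mellin_diff (-z) (by have h : 0 < z.re := hz; simpa using h)) differentiableAt_id.neg
    fun_prop
  have h3 : (2:ℂ) ∈ U := by simp [U]
  refine h1.eqOn_of_preconnected_of_eventuallyEq h2 hUc h3 ?_ hs
  have : {s : ℂ | 1 < s.re} ∈ nhds (2:ℂ) :=
    (isOpen_lt continuous_const Complex.continuous_re).mem_nhds (by simp)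
  filter_upwards [this] with z hz
  exact zeta1_formula_aux z hz

lemma zeta1_ne_zero_real (σ : ℝ) (hσ : 0 < σ) : riemannZeta₁ (σ : ℂ) ≠ 0 := by
  rcases lt_or_ge 1 σ with h | h
  · intro h0
    have h1 : (σ:ℂ) ≠ 1 := by exact_mod_cast h.ne'
    have := riemannZeta_ne_zero_of_one_lt_re (s := σ) (by simpa using h)
    rw [riemannZeta_eq_inv_sub_mul h1, h0] at this
    simp at this
  · rw [zeta1_formula _ (by simpa using hσ)]
    have e : mellin FF (-(σ:ℂ)) = ((∫ t in Ioi (0:ℝ), t ^ (-σ - 1) * (if 1 < t then Int.fract t else 0) : ℝ) : ℂ) := by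
      rw [mellin, ← integral_complex_ofReal]
      apply setIntegral_congr_fun measurableSet_Ioi
      intro t ht
      have ht : 0 < t := ht
      simp only [smul_eq_mul, FF]
      split_ifs
      · push_cast
        rw [Complex.ofReal_cpow ht.le]; simp
      · simp
    rw [e]
    set I := ∫ t in Ioi (0:ℝ), t ^ (-σ - 1) * (if 1 < t then Int.fract t else 0)
    have hI : 0 ≤ I := by
      apply setIntegral_nonneg measurableSet_Ioi
      intro t ht
      have ht : 0 < t := ht
      apply mul_nonneg (by positivity)
      split_ifs
      · exact Int.fract_nonneg t
      · exact le_rfl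
    intro h0
    have : σ - σ * (σ - 1) * I = 0 := by exact_mod_cast h0
    nlinarith [mul_nonneg (mul_nonneg hσ.le (sub_nonneg.2 h)) hI]

end Kacz

namespace Kacz

open MeasureTheory Asymptotics

lemma pow_le_exp (k : ℕ) (l u : ℝ) (hl : 0 < l) (hu : 0 ≤ u) :
    u ^ k ≤ k.factorial / l ^ k * exp (l * u) := by
  have h := Real.pow_div_factorial_le_exp (l * u) (by positivity) k
  rw [div_le_iff₀ (by positivity), mul_pow] at h
  rw [div_mul_eq_mul_div, le_div_iff₀ (by positivity)]
  nlinarith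

/-- integrability from an exponential bound -/
lemma integrableOn_of_exp_bound (f : ℝ → ℝ) (a c C : ℝ) (hc : 0 < c)
    (hm : AEStronglyMeasurable f (volume.restrict (Ioi a)))
    (h : ∀ u, a < u → |f u| ≤ C * exp (-c * u)) : IntegrableOn f (Ioi a) := by
  have h1 : IntegrableOn (fun u => C * exp (-c * u)) (Ioi a) :=
    (integrableOn_exp_mul_Ioi (by linarith) a).const_mul C
  refine Integrable.mono' h1 hm ?_
  filter_upwards [ae_restrict_mem measurableSet_Ioi] with u hu
  exact h u hu

lemma integral_exp_Ioi (c a : ℝ) (hc : 0 < c) : ∫ u in Ioi a, exp (-c * u) = exp (-c * a) / c := by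
  rw [integral_exp_mul_Ioi (by linarith) a]
  rw [neg_div, div_neg, neg_neg]

/-- Laplace-type transform of summatory functions -/
lemma laplace_sum (a : ℕ → ℝ) (c C : ℝ) (hc : 0 < c)
    (hs : Summable (fun n : ℕ => |a n| * (n : ℝ) ^ (-c))) (g : ℝ → ℝ) (hg : Measurable g)
    (hb : ∀ u, 0 < u → |g u| ≤ C * exp (-c * u)) :
    HasSum (fun n : ℕ => (if n = 0 then 0 else a n * ∫ u in Ioi (log n), g u))
      (∫ u in Ioi (0:ℝ), (∑ n ∈ Finset.Icc 1 ⌊exp u⌋₊, a n) * g u) := by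
  set F : ℕ → ℝ → ℝ := fun n u => if n = 0 then 0 else a n * (Ioi (log n)).indicator g u with hF
  have hg0 : IntegrableOn g (Ioi 0) :=
    integrableOn_of_exp_bound g 0 c C hc hg.aestronglyMeasurable hb
  have hsub : ∀ n : ℕ, Ioi (log n) ⊆ Ioi 0 := fun n => Ioi_subset_Ioi (log_natCast_nonneg n)
  have hFint : ∀ n, Integrable (F n) (volume.restrict (Ioi 0)) := by
    intro n
    simp only [hF]
    split_ifs with h
    · exact integrable_zero _ _ _
    · exact ((hg0.indicator measurableSet_Ioi)).const_mul _
  have hIF : ∀ n (φ : ℝ → ℝ), ∫ u in Ioi (0:ℝ), (Ioi (log (n:ℕ))).indicator φ u = ∫ u in Ioi (log n), φ u := by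
    intro n φ
    rw [setIntegral_indicator measurableSet_Ioi, inter_eq_self_of_subset_right (hsub n)]
  have hC : 0 ≤ C := by
    have := (abs_nonneg _).trans (hb 1 one_pos)
    exact nonneg_of_mul_nonneg_left this (exp_pos _)
  have hsum : Summable fun n => ∫ u in Ioi (0:ℝ), ‖F n u‖ := by
    refine Summable.of_nonneg_of_le (fun n => by positivity) ?_ (hs.mul_left (C / c))
    intro n
    by_cases h : n = 0
    · simp only [hF, h, if_true, norm_zero, integral_zero]; positivity
    · simp only [hF, h, if_false, norm_mul, norm_indicator_eq_indicator_norm, Real.norm_eq_abs]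
      rw [integral_const_mul, hIF n (fun u => |g u|)]
      have h1 : ∫ u in Ioi (log n), |g u| ≤ ∫ u in Ioi (log n), C * exp (-c * u) := by
        apply setIntegral_mono_on
        · exact (hg0.mono_set (hsub n)).abs
        · exact (integrableOn_exp_mul_Ioi (by linarith) _).const_mul C
        · exact measurableSet_Ioi
        · exact fun u hu => hb u (hsub n hu)
      rw [integral_const_mul, integral_exp_Ioi _ _ hc] at h1
      have h2 : exp (-c * log n) = (n:ℝ) ^ (-c) := by
        rw [rpow_def_of_pos (by positivity)]; ring_nf
      rw [h2] at h1
      calc |a n| * ∫ u in Ioi (log n), |g u| ≤ |a n| * (C * ((n:ℝ) ^ (-c) / c)) := by gcongr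
        _ = _ := by ring
  have key := hasSum_integral_of_summable_integral_norm hFint hsum
  have e1 : (fun n : ℕ => (if n = 0 then 0 else a n * ∫ u in Ioi (log n), g u)) =
      fun n => ∫ u in Ioi (0:ℝ), F n u := by
    funext n
    simp only [hF]
    split_ifs with h
    · simp
    · rw [integral_const_mul, hIF]
  have e2 : (∫ u in Ioi (0:ℝ), (∑ n ∈ Finset.Icc 1 ⌊exp u⌋₊, a n) * g u) =
      ∫ u in Ioi (0:ℝ), ∑' n, F n u := by
    apply setIntegral_congr_ae measurableSet_Ioi
    have hnull : ∀ᵐ u : ℝ, ∀ n : ℕ, u ≠ log n := by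
      rw [ae_all_iff]; intro n; exact Measure.ae_ne volume (log n)
    filter_upwards [hnull] with u hun hu
    have hu : 0 < u := hu
    rw [tsum_eq_sum (s := Finset.Icc 1 ⌊exp u⌋₊)]
    · rw [Finset.sum_mul]
      refine Finset.sum_congr rfl fun n hn => ?_
      rw [Finset.mem_Icc] at hn
      have h0 : n ≠ 0 := by omega
      have h1 : (n:ℝ) ≤ exp u := (Nat.le_floor_iff (exp_pos u).le).1 hn.2
      have h2 : log n < u := lt_of_le_of_ne ((log_le_iff_le_exp (by positivity)).2 h1) (hun n).symm
      simp [hF, h0, indicator, h2]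
    · intro n hn
      by_cases h0 : n = 0
      · simp [hF, h0]
      have h1 : ¬ (n:ℝ) ≤ exp u := by
        intro h; apply hn; rw [Finset.mem_Icc]
        exact ⟨by omega, (Nat.le_floor_iff (exp_pos u).le).2 h⟩
      have h2 : ¬ log n < u := by
        intro h; exact h1 ((log_le_iff_le_exp (by positivity)).1 h.le)
      simp [hF, h0, indicator, h2]
  rw [e1, e2]
  exact key

lemma primePi_eq (x : ℝ) (hx : 0 ≤ x) :
    (primePi x : ℝ) = ∑ n ∈ Finset.Icc 1 ⌊x⌋₊, (if n.Prime then (1:ℝ) else 0) := by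
  unfold primePi
  rw [Finset.sum_boole]
  congr 1
  have : {p : ℕ | p.Prime ∧ (p:ℝ) ≤ x} = ((Finset.Icc 1 ⌊x⌋₊).filter Nat.Prime : Finset ℕ) := by
    ext p
    simp only [mem_ofPred_eq, Finset.coe_filter, Finset.mem_Icc, Nat.le_floor_iff hx]
    constructor
    · rintro ⟨h1, h2⟩; exact ⟨⟨h1.one_lt.le, h2⟩, h1⟩
    · rintro ⟨⟨_, h1⟩, h2⟩; exact ⟨h2, h1⟩
  rw [this]
  exact Set.ncard_coe_finset _

lemma primePi_le (x : ℝ) (hx : 0 ≤ x) : (primePi x : ℝ) ≤ x := by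
  rw [primePi_eq x hx]
  calc _ ≤ ∑ n ∈ Finset.Icc 1 ⌊x⌋₊, (1:ℝ) := by
        apply Finset.sum_le_sum; intro i _; split_ifs <;> norm_num
    _ = ⌊x⌋₊ := by simp
    _ ≤ x := Nat.floor_le hx

lemma primePi_mono : Monotone (fun x => (primePi x : ℝ)) := by
  intro x y hxy
  simp only [Nat.cast_le]
  unfold primePi
  apply Nat.card_mono
  · apply Set.Finite.subset (Finset.finite_toSet (Finset.range (⌊y⌋₊ + 1)))
    rintro p ⟨hp, h⟩
    simp only [Finset.coe_range, mem_Iio]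
    have := Nat.le_floor h
    omega
  · rintro p ⟨hp, h⟩; exact ⟨hp, h.trans hxy⟩

lemma Li_hasDerivAt (x : ℝ) (hx : 1 < x) : HasDerivAt Li (1 / log x) x := by
  have hc : ∀ y, 1 < y → ContinuousAt (fun t => 1 / log t) y := fun y hy =>
    continuousAt_const.div (continuousAt_log (by linarith)) (log_pos hy).ne'
  have hco : ContinuousOn (fun t => 1 / log t) (uIcc 2 x) := by
    intro y hy
    have : 1 < y := lt_of_lt_of_le (lt_min (by norm_num) hx) hy.1
    exact (hc y this).continuousWithinAt
  apply intervalIntegral.integral_hasDerivAt_right hco.intervalIntegrable _ (hc x hx)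
  exact ContinuousOn.stronglyMeasurableAtFilter (s := Ioi 1) isOpen_Ioi
    (fun y hy => (hc y hy).continuousWithinAt) x hx

lemma Li_bounds (x : ℝ) (hx : 2 ≤ x) : 0 ≤ Li x ∧ Li x ≤ 2 * x := by
  have hl : ∀ t, 2 ≤ t → 0 ≤ 1 / log t ∧ 1 / log t ≤ 2 := by
    intro t ht
    have h1 : 0.5 ≤ log 2 := by linarith [Real.log_two_gt_d9]
    have h2 : log 2 ≤ log t := log_le_log (by norm_num) ht
    constructor
    · apply div_nonneg one_pos.le; linarith
    · rw [div_le_iff₀ (by linarith)]; linarith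
  have hco : ContinuousOn (fun t => 1 / log t) (uIcc 2 x) := by
    intro y hy
    rw [uIcc_of_le hx] at hy
    exact (continuousAt_const.div (continuousAt_log (by linarith [hy.1])) (log_pos (by linarith [hy.1])).ne').continuousWithinAt
  constructor
  · apply intervalIntegral.integral_nonneg hx
    intro t ht; exact (hl t ht.1).1
  · have : Li x ≤ ∫ t in (2:ℝ)..x, (2:ℝ) := by
      apply intervalIntegral.integral_mono_on hx hco.intervalIntegrable (by simp)
      intro t ht; exact (hl t ht.1).2
    simp at this
    linarith

lemma log2_pos : 0 < log 2 := log_pos (by norm_num)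

lemma two_le_exp (u : ℝ) (hu : log 2 ≤ u) : 2 ≤ exp u := (log_le_iff_le_exp (by norm_num)).1 hu

lemma B_bound (u : ℝ) (hu : log 2 ≤ u) : |B u| ≤ 2 * exp u := by
  have h1 := primePi_le (exp u) (exp_pos u).le
  have h2 := Li_bounds (exp u) (two_le_exp u hu)
  have h3 : (0:ℝ) ≤ primePi (exp u) := by positivity
  have := exp_pos u
  unfold B
  rw [abs_le]; constructor <;> linarith [h2.1, h2.2]

lemma LiE_contOn : ContinuousOn (fun u => Li (exp u)) (Ici (log 2)) := by
  intro u hu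
  have h : 1 < exp u := by linarith [two_le_exp u hu]
  exact ((Li_hasDerivAt _ h).continuousAt.comp continuous_exp.continuousAt).continuousWithinAt

lemma B_meas : AEStronglyMeasurable B (volume.restrict (Ioi (log 2))) := by
  apply AEStronglyMeasurable.sub
  · apply Measurable.aestronglyMeasurable
    exact (primePi_mono.comp exp_monotone).measurable
  · exact (LiE_contOn.mono Ioi_subset_Ici_self).aestronglyMeasurable measurableSet_Ioi

end Kacz

namespace Kacz

open MeasureTheory Asymptotics

noncomputable def Amom (σ : ℝ) (k : ℕ) : ℝ := ∫ u in Ioi (log 2), B u * (u ^ k * exp (-σ * u))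

lemma pow_exp_bound (σ : ℝ) (hσ : 1 < σ) (k : ℕ) (u : ℝ) (hu : 0 ≤ u) :
    |u ^ k * exp (-σ * u)| ≤ k.factorial / ((σ - 1) / 2) ^ k * exp (-((σ + 1) / 2) * u) := by
  rw [abs_of_nonneg (by positivity)]
  calc u ^ k * exp (-σ * u) ≤ (k.factorial / ((σ - 1) / 2) ^ k * exp ((σ - 1) / 2 * u)) * exp (-σ * u) := by
        gcongr; exact pow_le_exp k _ u (by linarith) hu
    _ = _ := by rw [mul_assoc, ← exp_add]; ring_nf

lemma moment_bound (σ : ℝ) (hσ : 1 < σ) (k : ℕ) (u : ℝ) (hu : log 2 ≤ u) :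
    |B u * (u ^ k * exp (-σ * u))| ≤
      2 * (k.factorial / ((σ - 1) / 2) ^ k) * exp (-((σ - 1) / 2) * u) := by
  have h0 : 0 < (σ - 1) / 2 := by linarith
  rw [abs_mul]
  calc |B u| * |u ^ k * exp (-σ * u)| ≤ (2 * exp u) *
        (k.factorial / ((σ - 1) / 2) ^ k * exp (-((σ + 1) / 2) * u)) :=
        mul_le_mul (B_bound u hu) (pow_exp_bound σ hσ k u (log2_pos.le.trans hu)) (abs_nonneg _)
          (by positivity)
    _ = 2 * (k.factorial / ((σ - 1) / 2) ^ k) * (exp u * exp (-((σ + 1) / 2) * u)) := by ring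
    _ = _ := by rw [← exp_add]; ring_nf

lemma moment_integrable (σ : ℝ) (hσ : 1 < σ) (k : ℕ) :
    IntegrableOn (fun u => B u * (u ^ k * exp (-σ * u))) (Ioi (log 2)) := by
  apply integrableOn_of_exp_bound _ _ ((σ - 1) / 2) _ (by linarith) _
    (fun u hu => moment_bound σ hσ k u (le_of_lt hu))
  exact B_meas.mul (by fun_prop)

lemma pow_exp_integrable (c : ℝ) (hc : 0 < c) (k : ℕ) (a : ℝ) (ha : 0 ≤ a) :
    IntegrableOn (fun u => u ^ k * exp (-c * u)) (Ioi a) := by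
  apply integrableOn_of_exp_bound _ _ (c / 2) (k.factorial / (c / 2) ^ k) (by linarith) (by fun_prop)
  intro u hu
  have hu : 0 ≤ u := ha.trans (le_of_lt hu)
  rw [abs_of_nonneg (by positivity)]
  calc u ^ k * exp (-c * u) ≤ (k.factorial / (c / 2) ^ k * exp (c / 2 * u)) * exp (-c * u) := by
        gcongr; exact pow_le_exp k _ u (by linarith) hu
    _ = _ := by rw [mul_assoc, ← exp_add]; ring_nf

lemma pow_exp_tendsto (c : ℝ) (hc : 0 < c) (k : ℕ) :
    Tendsto (fun u : ℝ => u ^ k * exp (-c * u)) atTop (nhds 0) := by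
  have h := (tendsto_pow_mul_exp_neg_atTop_nhds_zero k).comp (tendsto_id.const_mul_atTop hc)
  have := h.const_mul (1 / c ^ k)
  rw [mul_zero] at this
  refine this.congr fun u => ?_
  simp only [Function.comp, id]
  rw [mul_pow]; field_simp

/-- the kernel in the recurrence -/
noncomputable def gker (σ : ℝ) (k : ℕ) (u : ℝ) : ℝ :=
  σ * (u ^ (k + 1) * exp (-σ * u)) - (k + 1) * (u ^ k * exp (-σ * u))

lemma gker_hasDerivAt (σ : ℝ) (k : ℕ) (u : ℝ) :
    HasDerivAt (fun u => - (u ^ (k + 1) * exp (-σ * u))) (gker σ k u) u := by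
  have h1 := hasDerivAt_pow (k + 1) u
  have h2 : HasDerivAt (fun u => exp (-σ * u)) (exp (-σ * u) * (-σ * 1)) u :=
    ((hasDerivAt_id u).const_mul (-σ)).exp
  refine (h1.mul h2).neg.congr_deriv ?_
  unfold gker; simp only [Nat.add_sub_cancel]; push_cast; ring

lemma gker_integral (σ : ℝ) (hσ : 0 < σ) (k : ℕ) (v : ℝ) (hv : 0 ≤ v) :
    ∫ u in Ioi v, gker σ k u = v ^ (k + 1) * exp (-σ * v) := by
  have hi : IntegrableOn (gker σ k) (Ioi v) :=
    ((pow_exp_integrable σ hσ (k+1) v hv).const_mul σ).sub ((pow_exp_integrable σ hσ k v hv).const_mul _)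
  have := integral_Ioi_of_hasDerivAt_of_tendsto' (fun u _ => gker_hasDerivAt σ k u) hi
    (by simpa using (pow_exp_tendsto σ hσ (k + 1)).neg)
  rw [this]; ring

noncomputable def Tsum (σ : ℝ) (k : ℕ) : ℝ := ∑' n : ℕ, if n.Prime then (log n) ^ (k + 1) * (n:ℝ) ^ (-σ) else 0

lemma pi_part (σ : ℝ) (hσ : 1 < σ) (k : ℕ) :
    ∫ u in Ioi (log 2), (primePi (exp u) : ℝ) * gker σ k u = Tsum σ k := by
  have hc : 1 < (σ + 1) / 2 := by linarith
  have hmeas : Measurable (gker σ k) := by unfold gker; fun_prop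
  have h := laplace_sum (fun n => if n.Prime then 1 else 0) ((σ + 1) / 2)
    (σ * ((k+1).factorial / ((σ - 1) / 2) ^ (k+1)) + (k + 1) * (k.factorial / ((σ - 1) / 2) ^ k))
    (by linarith) (by
      refine Summable.of_nonneg_of_le (fun n => by positivity) (fun n => ?_)
        (Real.summable_nat_rpow.2 (by linarith : -((σ + 1) / 2) < -1))
      have : (0:ℝ) ≤ (n:ℝ) ^ (-((σ + 1) / 2)) := by positivity
      split_ifs
      · simp
      · simpa using this) (gker σ k) hmeas (by
      intro u hu
      have h1 := pow_exp_bound σ hσ (k+1) u hu.le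
      have h2 := pow_exp_bound σ hσ k u hu.le
      unfold gker
      calc _ ≤ |σ * (u ^ (k + 1) * exp (-σ * u))| + |(k + 1) * (u ^ k * exp (-σ * u))| := abs_sub _ _
        _ = σ * |u ^ (k + 1) * exp (-σ * u)| + (k + 1) * |u ^ k * exp (-σ * u)| := by
            rw [abs_mul σ, abs_mul ((k:ℝ)+1), abs_of_pos (by linarith : 0 < σ), abs_of_pos (by positivity : (0:ℝ) < k + 1)]
        _ ≤ σ * ((k+1).factorial / ((σ - 1) / 2) ^ (k+1) * exp (-((σ + 1) / 2) * u)) +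
            (k + 1) * (k.factorial / ((σ - 1) / 2) ^ k * exp (-((σ + 1) / 2) * u)) := by
            have : 0 ≤ σ := by linarith
            gcongr
        _ = _ := by ring)
  have e1 := h.tsum_eq
  have e2 : (∑' n : ℕ, (if n = 0 then 0 else (if n.Prime then (1:ℝ) else 0) * ∫ u in Ioi (log n), gker σ k u))
      = Tsum σ k := by
    unfold Tsum
    apply tsum_congr
    intro n
    by_cases hp : n.Prime
    · have h0 : n ≠ 0 := hp.ne_zero
      simp only [h0, hp, if_true, if_false, one_mul]
      rw [gker_integral σ (by linarith) k _ (log_natCast_nonneg n)]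
      congr 1
      rw [rpow_def_of_pos (by positivity)]; ring_nf
    · simp [hp]
  rw [← e2, e1, ← integral_Ici_eq_integral_Ioi]
  rw [← setIntegral_eq_of_subset_of_forall_sdiff_eq_zero (s := Ici (log 2)) (t := Ioi (0:ℝ)) measurableSet_Ioi
      (fun u hu => log2_pos.trans_le hu)]
  · apply setIntegral_congr_fun measurableSet_Ioi
    intro u hu
    simp only
    rw [primePi_eq _ (exp_pos u).le]
  · intro u hu
    have h2 : exp u < 2 := by
      have : ¬ (log 2 ≤ u) := hu.2
      rw [← log_lt_log_iff (exp_pos u) (by norm_num), log_exp]; linarith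
    have h3 : ⌊exp u⌋₊ < 2 := (Nat.floor_lt (exp_pos u).le).2 (by exact_mod_cast h2)
    rw [primePi_eq _ (exp_pos u).le, Finset.sum_eq_zero, zero_mul]
    intro n hn
    rw [Finset.mem_Icc] at hn
    rw [if_neg]
    intro hp
    have := hp.two_le
    omega

lemma Li_part (σ : ℝ) (hσ : 1 < σ) (k : ℕ) :
    IntegrableOn (fun u => Li (exp u) * gker σ k u) (Ioi (log 2)) ∧
    ∫ u in Ioi (log 2), Li (exp u) * gker σ k u = ∫ u in Ioi (log 2), u ^ k * exp (-(σ - 1) * u) := by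
  have hbd : ∀ j : ℕ, ∀ u, log 2 ≤ u → |Li (exp u) * (u ^ j * exp (-σ * u))| ≤
      2 * (u ^ j * exp (-(σ - 1) * u)) := by
    intro j u hu
    have h2 := Li_bounds (exp u) (two_le_exp u hu)
    have hu0 : 0 ≤ u := log2_pos.le.trans hu
    rw [abs_of_nonneg (mul_nonneg h2.1 (by positivity))]
    calc _ ≤ (2 * exp u) * (u ^ j * exp (-σ * u)) := by gcongr; exact h2.2
      _ = 2 * (u ^ j * (exp u * exp (-σ * u))) := by ring
      _ = _ := by rw [← exp_add]; ring_nf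
  have hIntg : ∀ j : ℕ, IntegrableOn (fun u => Li (exp u) * (u ^ j * exp (-σ * u))) (Ioi (log 2)) := by
    intro j
    refine Integrable.mono' ((pow_exp_integrable (σ - 1) (by linarith) j (log 2) log2_pos.le).const_mul 2) ?_ ?_
    · exact ((LiE_contOn.mono Ioi_subset_Ici_self).aestronglyMeasurable measurableSet_Ioi).mul (by fun_prop)
    · filter_upwards [ae_restrict_mem measurableSet_Ioi] with u hu
      exact hbd j u (le_of_lt hu)
  have hI : IntegrableOn (fun u => Li (exp u) * gker σ k u) (Ioi (log 2)) := by
    have := ((hIntg (k+1)).const_mul σ).sub ((hIntg k).const_mul (k + 1))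
    refine this.congr (ae_of_all _ fun u => ?_)
    simp only [gker, Pi.sub_apply]; ring
  have hJ := pow_exp_integrable (σ - 1) (by linarith) k (log 2) log2_pos.le
  refine ⟨hI, ?_⟩
  have hd : ∀ u ∈ Ici (log 2), HasDerivAt (fun u => Li (exp u) * -(u ^ (k + 1) * exp (-σ * u)))
      (Li (exp u) * gker σ k u - u ^ k * exp (-(σ - 1) * u)) u := by
    intro u hu
    have hu0 : 0 < u := log2_pos.trans_le hu
    have h1 : HasDerivAt (fun u => Li (exp u)) (1 / log (exp u) * exp u) u :=
      (Li_hasDerivAt (exp u) (by linarith [two_le_exp u hu])).comp u (hasDerivAt_exp u)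
    refine (h1.mul (gker_hasDerivAt σ k u)).congr_deriv ?_
    rw [log_exp, show -(σ - 1) * u = u + -σ * u by ring, exp_add]
    field_simp
    ring
  have := integral_Ioi_of_hasDerivAt_of_tendsto' hd (hI.sub hJ) (m := 0) (by
    refine squeeze_zero_norm' (a := fun u => 2 * (u ^ (k+1) * exp (-(σ - 1) * u))) ?_ ?_
    · filter_upwards [eventually_ge_atTop (log 2)] with u hu
      rw [mul_neg, norm_neg]
      exact hbd (k+1) u hu
    · simpa using (pow_exp_tendsto (σ - 1) (by linarith) (k+1)).const_mul 2)
  rw [integral_sub hI hJ] at this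
  have h2 : Li (exp (log 2)) = 0 := by
    rw [exp_log (by norm_num)]; simp [Li]
  rw [h2] at this
  linarith

lemma moment_rec (σ : ℝ) (hσ : 1 < σ) (k : ℕ) :
    σ * Amom σ (k + 1) - (k + 1) * Amom σ k =
      Tsum σ k - ∫ u in Ioi (log 2), u ^ k * exp (-(σ - 1) * u) := by
  obtain ⟨h1, h2⟩ := Li_part σ hσ k
  have hA : IntegrableOn (fun u => B u * gker σ k u) (Ioi (log 2)) := by
    have := ((moment_integrable σ hσ (k+1)).const_mul σ).sub ((moment_integrable σ hσ k).const_mul (k + 1))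
    refine this.congr (ae_of_all _ fun u => ?_)
    simp only [gker, Pi.sub_apply]; ring
  rw [← h2, ← pi_part σ hσ k]
  unfold Amom
  rw [← integral_const_mul, ← integral_const_mul, ← integral_sub
    ((moment_integrable σ hσ (k+1)).const_mul σ) ((moment_integrable σ hσ k).const_mul (k + 1)),
    ← integral_sub _ h1]
  · apply integral_congr_ae
    filter_upwards with u
    simp only [gker, B]; ring
  · refine (hA.add h1).congr (ae_of_all _ fun u => ?_)
    simp only [B, Pi.add_apply]; ring

lemma pow_exp_split (c : ℝ) (hc : 0 < c) (k : ℕ) :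
    |(∫ u in Ioi (log 2), u ^ k * exp (-c * u)) - k.factorial / c ^ (k + 1)| ≤ 1 := by
  have h0 := pow_exp_integrable c hc k 0 le_rfl
  have e : ∫ u in Ioi (0:ℝ), u ^ k * exp (-c * u) = k.factorial / c ^ (k + 1) := by
    have := Real.integral_rpow_mul_exp_neg_mul_Ioi (a := k + 1) (r := c) (by positivity) hc
    rw [Real.Gamma_nat_eq_factorial] at this
    rw [show ((k:ℝ) + 1) = ((k + 1 : ℕ) : ℝ) by push_cast; ring, rpow_natCast] at this
    rw [show (k.factorial / c ^ (k+1) : ℝ) = (1 / c) ^ (k + 1) * k.factorial by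
      rw [div_pow, one_pow]; ring, ← this]
    apply setIntegral_congr_fun measurableSet_Ioi
    intro u hu
    simp
  rw [← e]
  have hs := intervalIntegral.integral_Ioi_sub_Ioi' (f := fun u => u ^ k * exp (-c * u)) (μ := volume) (a := 0) (b := log 2)
    h0 (pow_exp_integrable c hc k _ log2_pos.le)
  rw [abs_sub_comm, hs]
  have h1 := intervalIntegral.norm_integral_le_of_norm_le_const (f := fun u => u ^ k * exp (-c * u))
    (a := 0) (b := log 2) (C := 1) (by
      intro u hu
      rw [uIoc_of_le log2_pos.le] at hu
      have hu0 := hu.1.le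
      rw [Real.norm_eq_abs, abs_of_nonneg (by positivity)]
      have : u ≤ 1 := hu.2.trans (by linarith [Real.log_two_lt_d9])
      have h2 : u ^ k ≤ 1 := pow_le_one₀ hu0 this
      have h3 : exp (-c * u) ≤ 1 := exp_le_one_iff.2 (by nlinarith)
      nlinarith [exp_pos (-c * u)])
  rw [Real.norm_eq_abs] at h1
  refine h1.trans ?_
  rw [sub_zero, abs_of_pos log2_pos]
  linarith [Real.log_two_lt_d9]

end Kacz

namespace Kacz

open MeasureTheory Asymptotics

lemma iterDeriv_inv_sub (k : ℕ) (a z : ℂ) :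
    iteratedDeriv k (fun s => (s - a)⁻¹) z = (-1) ^ k * k.factorial * ((z - a)⁻¹) ^ (k + 1) := by
  rw [iteratedDeriv_comp_sub_const k (fun s => s⁻¹) a, iteratedDeriv_eq_iterate]
  change deriv^[k] Inv.inv (z - a) = _
  rw [iter_deriv_inv]
  congr 1
  rw [show (-1 - (k:ℤ)) = -((k + 1 : ℕ) : ℤ) by push_cast; ring, zpow_neg, zpow_natCast, inv_pow]

noncomputable def fP (n : ℕ) : ℝ := if n.Prime then log n else 0
noncomputable def qP (n : ℕ) : ℝ := ArithmeticFunction.vonMangoldt n - fP n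

lemma qP_nonneg (n : ℕ) : 0 ≤ qP n := by
  unfold qP fP
  split_ifs with h
  · rw [ArithmeticFunction.vonMangoldt_apply_prime h]; simp
  · simpa using ArithmeticFunction.vonMangoldt_nonneg

lemma qP_sum (n : ℕ) : ∑ k ∈ Finset.Icc 1 n, qP k = Chebyshev.psi n - Chebyshev.theta n := by
  unfold qP fP
  rw [Finset.sum_sub_distrib, Chebyshev.psi, Chebyshev.theta, Finset.sum_filter, Nat.floor_natCast]
  rfl

lemma qP_bigO : (fun n : ℕ => ∑ k ∈ Finset.Icc 1 n, qP k) =O[atTop] fun n => (n:ℝ) ^ (1/2 : ℝ) := by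
  obtain ⟨C, hC⟩ := Chebyshev.psi_sub_theta_le_mul_sqrt
  apply IsBigO.of_bound C
  filter_upwards with n
  rw [qP_sum, Real.norm_eq_abs, abs_of_nonneg (sub_nonneg.2 (Chebyshev.theta_le_psi _)),
    Real.norm_eq_abs, abs_of_nonneg (by positivity), ← Real.sqrt_eq_rpow]
  exact hC n

lemma qP_summable (s : ℂ) (hs : 1/2 < s.re) : LSeriesSummable (fun n => (qP n : ℂ)) s :=
  LSeriesSummable_of_sum_norm_bigO_and_nonneg qP_bigO qP_nonneg (by norm_num) hs

lemma qP_abscissa : LSeries.abscissaOfAbsConv (fun n => (qP n : ℂ)) ≤ ((1/2 : ℝ) : EReal) :=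
  LSeries.abscissaOfAbsConv_le_of_forall_lt_LSeriesSummable fun y hy =>
    qP_summable y (by simpa using hy)

lemma qP_analytic (s : ℂ) (hs : 1/2 < s.re) : AnalyticAt ℂ (LSeries (fun n => (qP n : ℂ))) s := by
  apply LSeries_analyticOnNhd
  refine lt_of_le_of_lt qP_abscissa ?_
  exact_mod_cast hs

lemma fP_eq : (fun n => (fP n : ℂ)) = (fun n => ((ArithmeticFunction.vonMangoldt n : ℝ) : ℂ)) - fun n => (qP n : ℂ) := by
  funext n; simp [qP]

lemma fP_summable (s : ℂ) (hs : 1 < s.re) : LSeriesSummable (fun n => (fP n : ℂ)) s := by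
  rw [fP_eq]
  exact (ArithmeticFunction.LSeriesSummable_vonMangoldt hs).sub (qP_summable s (by linarith))

lemma fP_abscissa : LSeries.abscissaOfAbsConv (fun n => (fP n : ℂ)) ≤ ((1 : ℝ) : EReal) :=
  LSeries.abscissaOfAbsConv_le_of_forall_lt_LSeriesSummable fun y hy =>
    fP_summable y (by simpa using hy)

lemma zeta1_ne_zero_of_one_lt (s : ℂ) (hs : 1 < s.re) : riemannZeta₁ s ≠ 0 := by
  intro h0
  have h1 : s ≠ 1 := by rintro rfl; simp at hs
  have := riemannZeta_ne_zero_of_one_lt_re hs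
  rw [riemannZeta_eq_inv_sub_mul h1, h0] at this
  simp at this

lemma zeta_logDeriv (s : ℂ) (hs : 1 < s.re) :
    deriv riemannZeta s / riemannZeta s = deriv riemannZeta₁ s / riemannZeta₁ s - (s - 1)⁻¹ := by
  have h1 : s ≠ 1 := by rintro rfl; simp at hs
  have h1' := sub_ne_zero.2 h1
  rw [deriv_riemannZeta_eq_neg_inv_sub_sq_mul_add h1, riemannZeta_eq_inv_sub_mul h1]
  have := zeta1_ne_zero_of_one_lt s hs
  field_simp
  ring

lemma fP_LSeries (s : ℂ) (hs : 1 < s.re) :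
    - LSeries (fun n => (fP n : ℂ)) s + (s - 1)⁻¹ =
      deriv riemannZeta₁ s / riemannZeta₁ s + LSeries (fun n => (qP n : ℂ)) s := by
  rw [fP_eq, LSeries_sub (ArithmeticFunction.LSeriesSummable_vonMangoldt hs) (qP_summable s (by linarith)),
    ArithmeticFunction.LSeries_vonMangoldt_eq_deriv_riemannZeta_div hs, neg_div, zeta_logDeriv s hs]
  ring

lemma logMul_iter (k : ℕ) (n : ℕ) : (LSeries.logMul^[k] (fun n => (fP n : ℂ))) n = (log n : ℂ) ^ k * fP n := by
  induction k with
  | zero => simp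
  | succ k ih =>
    rw [Function.iterate_succ', Function.comp, LSeries.logMul, ih, pow_succ, Complex.natCast_log]; ring

lemma fP_LSeries_iter (σ : ℝ) (hσ : 1 < σ) (k : ℕ) :
    iteratedDeriv k (LSeries (fun n => (fP n : ℂ))) σ = (-1) ^ k * (Tsum σ k : ℂ) := by
  rw [LSeries_iteratedDeriv k (lt_of_le_of_lt fP_abscissa (by simpa using (by exact_mod_cast hσ : (1:EReal) < (σ:EReal))))]
  congr 1
  unfold LSeries Tsum
  rw [Complex.ofReal_tsum]
  apply tsum_congr
  intro n
  rw [LSeries.term_def, logMul_iter]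
  by_cases hn : n = 0
  · simp [hn]
  · by_cases hp : n.Prime
    · simp only [hn, hp, if_true, if_false, fP]
      push_cast
      rw [Complex.ofReal_cpow (by positivity), Complex.ofReal_neg, Complex.cpow_neg]
      push_cast
      rw [pow_succ]
      field_simp
    · simp [hp, hn, fP]

end Kacz

namespace Kacz

open MeasureTheory Asymptotics

lemma zeros_finite (f : ℂ → ℂ) (hf : Differentiable ℂ f) (z₀ : ℂ) (h0 : f z₀ ≠ 0) (c : ℂ) (r : ℝ) :
    {z | f z = 0 ∧ ‖c - z‖ ≤ r}.Finite := by
  have hA : AnalyticOnNhd ℂ f univ := fun z _ => hf.analyticAt z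
  have h1 := hA.preimage_zero_mem_codiscrete h0
  have h2 := mem_codiscrete'.mp h1
  have h3 : ((f ⁻¹' {0}ᶜ)ᶜ : Set ℂ) = {z | f z = 0} := by ext z; simp
  have hcl : IsClosed {z | f z = 0} := isClosed_eq hf.continuous continuous_const
  have h4 : IsCompact (Metric.closedBall c r ∩ {z | f z = 0}) := (isCompact_closedBall c r).inter_right hcl
  have h5 := h4.finite (h2.2.mono (by rw [h3]; exact inter_subset_right))
  refine h5.subset ?_
  rintro z ⟨hz1, hz2⟩
  refine ⟨?_, hz1⟩
  rw [Metric.mem_closedBall, dist_comm, dist_eq_norm]; exact hz2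

lemma zeros_countable (f : ℂ → ℂ) (hf : Differentiable ℂ f) (z₀ : ℂ) (h0 : f z₀ ≠ 0) :
    {z | f z = 0}.Countable := by
  have : {z | f z = 0} = ⋃ n : ℕ, {z | f z = 0 ∧ ‖(0:ℂ) - z‖ ≤ n} := by
    ext z
    simp only [mem_ofPred_eq, mem_iUnion]
    constructor
    · intro h; obtain ⟨n, hn⟩ := exists_nat_ge ‖(0:ℂ) - z‖; exact ⟨n, h, hn⟩
    · rintro ⟨n, h, _⟩; exact h
  rw [this]
  exact countable_iUnion fun n => (zeros_finite f hf z₀ h0 0 n).countable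

lemma normSq_real_sub (σ : ℝ) (z : ℂ) : ‖(σ:ℂ) - z‖ ^ 2 = σ ^ 2 - 2 * σ * z.re + (z.re ^ 2 + z.im ^ 2) := by
  rw [← Complex.normSq_eq_norm_sq, Complex.normSq_apply]; simp; ring

lemma exists_center (ρ₀ : ℂ) (h : riemannZeta₁ ρ₀ = 0) (hre : 1/2 < ρ₀.re) :
    ∃ σ : ℝ, 1 < σ ∧ ∃ (ρ : ℂ) (R' : ℝ), riemannZeta₁ ρ = 0 ∧ ρ.im ≠ 0 ∧ ρ.re < σ ∧ ‖(σ:ℂ) - ρ‖ < R' ∧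
      R' < σ - 1/2 ∧ ∀ z, riemannZeta₁ z = 0 → ‖(σ:ℂ) - z‖ ≤ R' → z = ρ ∨ z = (starRingEnd ℂ) ρ := by
  set Z : Set ℂ := {z | riemannZeta₁ z = 0} with hZ
  have hd := differentiable_riemannZeta₁
  have h1 : riemannZeta₁ 1 ≠ 0 := by rw [riemannZeta₁_one]; exact one_ne_zero
  have hZc : Z.Countable := zeros_countable _ hd 1 h1
  set bad : Set ℝ := (fun p : ℂ × ℂ => ((p.1.re ^ 2 + p.1.im ^ 2) - (p.2.re ^ 2 + p.2.im ^ 2)) /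
    (2 * (p.1.re - p.2.re))) '' (Z ×ˢ Z) with hbad
  have hbc : bad.Countable := (hZc.prod hZc).image _
  set c₀ := max 1 ((ρ₀.re ^ 2 + ρ₀.im ^ 2) / (2 * (ρ₀.re - 1/2))) with hc₀
  obtain ⟨σ, hσ1, hσ2⟩ : ∃ σ, σ ∈ Ioi c₀ ∧ σ ∉ bad := by
    by_contra hcon
    push Not at hcon
    have : (Ioi c₀).Countable := hbc.mono hcon
    have h9 := this.measure_zero (volume : Measure ℝ)
    simp at h9
  have hσ1' : c₀ < σ := hσ1
  have hσgt : 1 < σ := (le_max_left _ _).trans_lt hσ1'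
  have hσ3 : (ρ₀.re ^ 2 + ρ₀.im ^ 2) / (2 * (ρ₀.re - 1/2)) < σ := (le_max_right _ _).trans_lt hσ1'
  rw [div_lt_iff₀ (by linarith)] at hσ3
  have hr0 : ‖(σ:ℂ) - ρ₀‖ < σ - 1/2 := by
    apply lt_of_pow_lt_pow_left₀ 2 (by linarith)
    rw [normSq_real_sub]; nlinarith
  -- nearest zero
  have hfin := zeros_finite _ hd 1 h1 σ ‖(σ:ℂ) - ρ₀‖
  obtain ⟨ρ, hρ, hmin⟩ := Set.exists_min_image _ (fun z => ‖(σ:ℂ) - z‖) hfin ⟨ρ₀, h, le_rfl⟩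
  have hρ0 : riemannZeta₁ ρ = 0 := hρ.1
  have hρR : ‖(σ:ℂ) - ρ‖ < σ - 1/2 := lt_of_le_of_lt hρ.2 hr0
  have hnear : ∀ z, riemannZeta₁ z = 0 → ‖(σ:ℂ) - ρ‖ ≤ ‖(σ:ℂ) - z‖ := by
    intro z hz
    rcases le_total ‖(σ:ℂ) - z‖ ‖(σ:ℂ) - ρ₀‖ with h2 | h2
    · exact hmin z ⟨hz, h2⟩
    · exact le_trans hρ.2 h2
  have hρre : 1/2 < ρ.re := by
    have := (Complex.re_le_norm ((σ:ℂ) - ρ))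
    simp at this; linarith
  have hρim : ρ.im ≠ 0 := by
    intro him
    have : ρ = (ρ.re : ℂ) := by apply Complex.ext <;> simp [him]
    rw [this] at hρ0
    exact zeta1_ne_zero_real _ (by linarith) hρ0
  have hρlt : ρ.re < σ := by
    by_contra hcon
    have h3 := riemannZeta₁_one
    exact zeta1_ne_zero_of_one_lt ρ (by linarith) hρ0
  have huniq : ∀ z, riemannZeta₁ z = 0 → ‖(σ:ℂ) - z‖ = ‖(σ:ℂ) - ρ‖ → z = ρ ∨ z = (starRingEnd ℂ) ρ := by
    intro z hz heq
    have h2 : ‖(σ:ℂ) - z‖ ^ 2 = ‖(σ:ℂ) - ρ‖ ^ 2 := by rw [heq]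
    rw [normSq_real_sub, normSq_real_sub] at h2
    have hrr : z.re = ρ.re := by
      by_contra hne
      apply hσ2
      refine ⟨(z, ρ), ⟨hz, hρ0⟩, ?_⟩
      have : z.re - ρ.re ≠ 0 := sub_ne_zero.2 hne
      simp only
      rw [div_eq_iff (by simpa using this)]
      linarith
    rw [hrr] at h2
    have h3 : (z.im - ρ.im) * (z.im + ρ.im) = 0 := by nlinarith
    rcases mul_eq_zero.1 h3 with h4 | h4
    · left; exact Complex.ext hrr (by linarith)
    · right; exact Complex.ext (by simpa using hrr) (by simp; linarith)
  -- choose R'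
  set W := {z | riemannZeta₁ z = 0 ∧ ‖(σ:ℂ) - z‖ ≤ σ} \ {ρ, (starRingEnd ℂ) ρ} with hW
  have hWfin : W.Finite := (zeros_finite _ hd 1 h1 σ σ).sdiff
  have hex : ∃ R₁, ‖(σ:ℂ) - ρ‖ < R₁ ∧ ∀ z ∈ W, R₁ < ‖(σ:ℂ) - z‖ := by
    have hlt : ∀ z ∈ W, ‖(σ:ℂ) - ρ‖ < ‖(σ:ℂ) - z‖ := by
      intro z hz
      refine lt_of_le_of_ne (hnear z hz.1.1) fun heq => hz.2 ?_
      rcases huniq z hz.1.1 heq.symm with h | h <;> simp [h]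
    rcases W.eq_empty_or_nonempty with he | hne
    · exact ⟨‖(σ:ℂ) - ρ‖ + 1, by linarith, by simp [he]⟩
    · obtain ⟨z₁, hz₁, hm⟩ := Set.exists_min_image _ (fun z => ‖(σ:ℂ) - z‖) hWfin hne
      refine ⟨(‖(σ:ℂ) - ρ‖ + ‖(σ:ℂ) - z₁‖) / 2, by linarith [hlt z₁ hz₁], fun z hz => ?_⟩
      have := hm z hz
      linarith [hlt z₁ hz₁]
  obtain ⟨R₁, hR₁, hR₁'⟩ := hex
  have hmin2 : ‖(σ:ℂ) - ρ‖ < min R₁ ((‖(σ:ℂ) - ρ‖ + (σ - 1/2)) / 2) := lt_min hR₁ (by linarith)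
  refine ⟨σ, hσgt, ρ, _, hρ0, hρim, hρlt, hmin2, (min_le_right _ _).trans_lt (by linarith), ?_⟩
  intro z hz hzR
  by_contra hcon
  push Not at hcon
  have hzW : z ∈ W := ⟨⟨hz, hzR.trans ((min_le_right _ _).trans (by linarith))⟩, by simpa using hcon⟩
  have := hR₁' z hzW
  have := hzR.trans (min_le_left _ _)
  linarith

end Kacz

namespace Kacz

open MeasureTheory Asymptotics

lemma caseI_J (ρ₀ : ℂ) (h : riemannZeta₁ ρ₀ = 0) (hre : 1/2 < ρ₀.re) :
    ∃ (σ R m : ℝ) (c : ℂ), 1 < σ ∧ 0 < R ∧ R < σ ∧ 0 < m ∧ ‖c‖ * R = 1 ∧ c.im ≠ 0 ∧ 0 < c.re ∧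
      Tendsto (fun k : ℕ => R ^ k * (σ * Amom σ (k + 1) - (k + 1) * Amom σ k) / k.factorial
        + m * (R ^ k * (c ^ (k + 1)).re)) atTop (nhds 0) := by
  obtain ⟨σ, hσ, ρ, R', hρ, hρim, hρre, hRR', hR'σ, huniq⟩ := exists_center ρ₀ h hre
  set R := ‖(σ:ℂ) - ρ‖ with hR
  have hne : (σ:ℂ) - ρ ≠ 0 := by
    intro h0
    have := congrArg Complex.im h0
    simp at this
    exact hρim this
  have hRpos : 0 < R := norm_pos_iff.2 hne
  have hR'pos : 0 < R' := hRpos.trans hRR'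
  have hd := differentiable_riemannZeta₁
  have h1 : riemannZeta₁ 1 ≠ 0 := by rw [riemannZeta₁_one]; exact one_ne_zero
  set c : ℂ := ((σ:ℂ) - ρ)⁻¹ with hc
  set ρ' := (starRingEnd ℂ) ρ with hρ'
  have hρρ' : ρ ≠ ρ' := by
    intro h0
    have := congrArg Complex.im h0
    simp [hρ'] at this
    apply hρim; linarith
  obtain ⟨G, hG, hGS, hfac⟩ := factor_finset _ hd 1 h1 {ρ, ρ'}
  set n := fun a => analyticOrderNatAt riemannZeta₁ a with hn
  have hGne : ∀ z ∈ Metric.closedBall (σ:ℂ) R', G z ≠ 0 := by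
    intro z hz hGz
    have hz0 : riemannZeta₁ z = 0 := by rw [hfac z, hGz, mul_zero]
    rw [Metric.mem_closedBall, dist_comm, dist_eq_norm] at hz
    apply hGS z _ hGz
    rcases huniq z hz0 hz with h | h <;> simp [h]
  set A : ℂ → ℂ := fun z => deriv G z / G z + LSeries (fun n => (qP n : ℂ)) z with hA
  have hAd : ∀ z ∈ Metric.closedBall (σ:ℂ) R', DifferentiableAt ℂ A z := by
    intro z hz
    apply DifferentiableAt.add
    · exact (hG.analyticAt z).deriv.differentiableAt.div (hG z) (hGne z hz)
    · apply (qP_analytic z _).differentiableAt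
      rw [Metric.mem_closedBall, dist_comm, dist_eq_norm] at hz
      have := Complex.re_le_norm ((σ:ℂ) - z)
      simp at this; linarith
  have hAcont : ContinuousOn A (Metric.closedBall (σ:ℂ) R') :=
    fun z hz => (hAd z hz).continuousAt.continuousWithinAt
  obtain ⟨M, hM⟩ := (isCompact_closedBall (σ:ℂ) R').exists_bound_of_continuousOn hAcont
  have hAcl : DiffContOnCl ℂ A (Metric.ball (σ:ℂ) R') := by
    refine ⟨fun z hz => (hAd z (Metric.ball_subset_closedBall hz)).differentiableWithinAt, ?_⟩
    rw [closure_ball _ hR'pos.ne']; exact hAcont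
  have hAk : ∀ k : ℕ, ‖iteratedDeriv k A σ‖ ≤ k.factorial * M / R' ^ k := fun k =>
    Complex.norm_iteratedDeriv_le_of_forall_mem_sphere_norm_le k hR'pos hAcl
      (fun z hz => hM z (Metric.sphere_subset_closedBall hz))
  have hev : (fun s : ℂ => - LSeries (fun n => (fP n : ℂ)) s + (s - 1)⁻¹) =ᶠ[nhds (σ:ℂ)]
      fun s => ((n ρ : ℂ) * (s - ρ)⁻¹ + (n ρ' : ℂ) * (s - ρ')⁻¹) + A s := by
    have : {s : ℂ | 1 < s.re} ∈ nhds (σ:ℂ) :=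
      (isOpen_lt continuous_const Complex.continuous_re).mem_nhds (by simpa using hσ)
    filter_upwards [this] with s hs
    rw [fP_LSeries s hs, logDeriv_factor _ G hG _ _ hfac s (zeta1_ne_zero_of_one_lt s hs),
      Finset.sum_pair hρρ']
    simp only [hA, hn, div_eq_mul_inv]; ring
  have hσ1 : (σ:ℂ) - 1 ≠ 0 := by
    apply sub_ne_zero.2; exact_mod_cast hσ.ne'
  have hne' : (σ:ℂ) - ρ' ≠ 0 := by
    intro h0
    have := congrArg Complex.im h0
    simp [hρ'] at this
    exact hρim this
  have hcd : ∀ (k : ℕ) (a : ℂ), (σ:ℂ) - a ≠ 0 → ContDiffAt ℂ k (fun s => (s - a)⁻¹) (σ:ℂ) := by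
    intro k a ha
    exact (contDiffAt_id.sub contDiffAt_const).inv ha
  have hLan : AnalyticAt ℂ (LSeries (fun n => (fP n : ℂ))) (σ:ℂ) :=
    LSeries_analyticOnNhd _ _ (lt_of_le_of_lt fP_abscissa (by exact_mod_cast hσ))
  have hAan : AnalyticAt ℂ A (σ:ℂ) := by
    apply DifferentiableOn.analyticAt (s := Metric.closedBall (σ:ℂ) R')
      (fun z hz => (hAd z hz).differentiableWithinAt)
    exact Metric.closedBall_mem_nhds _ hR'pos
  have hiter : ∀ k : ℕ, -((-1) ^ k * (Tsum σ k : ℂ)) + (-1) ^ k * k.factorial * (((σ:ℂ) - 1)⁻¹) ^ (k + 1) =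
      ((n ρ : ℂ) * ((-1) ^ k * k.factorial * (((σ:ℂ) - ρ)⁻¹) ^ (k + 1)) +
        (n ρ' : ℂ) * ((-1) ^ k * k.factorial * (((σ:ℂ) - ρ')⁻¹) ^ (k + 1))) + iteratedDeriv k A σ := by
    intro k
    have := hev.iteratedDeriv_eq k
    rw [iteratedDeriv_fun_add hLan.contDiffAt.neg (hcd k 1 hσ1), iteratedDeriv_fun_add
      ((contDiffAt_const.mul (hcd k ρ hne)).add (contDiffAt_const.mul (hcd k ρ' hne'))) hAan.contDiffAt,
      iteratedDeriv_fun_add (contDiffAt_const.mul (hcd k ρ hne)) (contDiffAt_const.mul (hcd k ρ' hne')),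
      iteratedDeriv_const_mul _ (hcd k ρ hne), iteratedDeriv_const_mul _ (hcd k ρ' hne'),
      iterDeriv_inv_sub, iterDeriv_inv_sub, iterDeriv_inv_sub] at this
    rw [← this]
    congr 1
    have e := iteratedDeriv_neg k (LSeries (fun n => (fP n : ℂ))) (σ:ℂ)
    rw [fP_LSeries_iter σ hσ k] at e
    rw [← e]; rfl
  have hc' : ((σ:ℂ) - ρ')⁻¹ = (starRingEnd ℂ) c := by
    rw [hc, map_inv₀, map_sub, Complex.conj_ofReal]
  set m : ℝ := (n ρ : ℝ) + n ρ' with hm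
  have hmpos : 0 < m := by
    have : 0 < n ρ := order_pos _ hd 1 h1 ρ hρ
    have : (0:ℝ) < n ρ := by exact_mod_cast this
    positivity
  have hkey : ∀ k : ℕ, |Tsum σ k - k.factorial / (σ - 1) ^ (k + 1) + k.factorial * (m * (c ^ (k + 1)).re)|
      ≤ k.factorial * M / R' ^ k := by
    intro k
    refine le_trans ?_ (hAk k)
    have h2 : ((Tsum σ k - k.factorial / (σ - 1) ^ (k + 1) : ℝ) : ℂ) + k.factorial *
        ((n ρ : ℂ) * c ^ (k + 1) + (n ρ' : ℂ) * (starRingEnd ℂ) (c ^ (k + 1))) =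
        - (-1) ^ k * iteratedDeriv k A σ := by
      have h3 := hiter k
      rw [hc', ← hc, ← map_pow] at h3
      have h4 : ((-1:ℂ) ^ k) * (-1) ^ k = 1 := by rw [← mul_pow]; simp
      push_cast
      rw [div_eq_mul_inv, ← inv_pow]
      linear_combination (-(-1) ^ k) * h3 + (-(Tsum σ k : ℂ) + k.factorial * (((σ:ℂ) - 1)⁻¹) ^ (k + 1)
        - k.factorial * ((n ρ : ℂ) * c ^ (k + 1) + (n ρ' : ℂ) * (starRingEnd ℂ) (c ^ (k + 1)))) * h4
    have h5 : ‖- (-1) ^ k * iteratedDeriv k A σ‖ = ‖iteratedDeriv k A σ‖ := by simp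
    rw [← h5, ← h2]
    refine le_trans (le_of_eq ?_) (Complex.abs_re_le_norm _)
    congr 1
    rw [Complex.add_re, Complex.ofReal_re]
    congr 1
    have h6 : ((k.factorial : ℂ)) = ((k.factorial : ℝ) : ℂ) := by simp
    have h7 : ∀ j : ℕ, ((j : ℂ)) = ((j : ℝ) : ℂ) := by simp
    rw [h6, Complex.re_ofReal_mul, Complex.add_re, h7 (n ρ), h7 (n ρ'), Complex.re_ofReal_mul,
      Complex.re_ofReal_mul, Complex.conj_re, hm]
    ring
  refine ⟨σ, R, m, c, hσ, hRpos, by linarith, hmpos, ?_, ?_, ?_, ?_⟩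
  · rw [hc, norm_inv, inv_mul_cancel₀ hRpos.ne']
  · rw [hc, Complex.inv_im]
    apply div_ne_zero
    · simpa using hρim
    · exact (Complex.normSq_pos.2 hne).ne'
  · rw [hc, Complex.inv_re]
    apply div_pos
    · simpa using hρre
    · exact Complex.normSq_pos.2 hne
  · have hlim : Tendsto (fun k : ℕ => M * (R / R') ^ k + R ^ k / k.factorial) atTop (nhds 0) := by
      have h2 := (tendsto_pow_atTop_nhds_zero_of_lt_one (r := R / R') (by positivity)
        ((div_lt_one hR'pos).2 hRR')).const_mul M
      have h3 := FloorSemiring.tendsto_pow_div_factorial_atTop R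
      simpa using h2.add h3
    refine squeeze_zero_norm (fun k => ?_) hlim
    rw [moment_rec σ hσ k]
    have h2 := hkey k
    have h3 := pow_exp_split (σ - 1) (by linarith) k
    set I := ∫ u in Ioi (log 2), u ^ k * exp (-(σ - 1) * u)
    have hf : (0:ℝ) < k.factorial := by positivity
    have e : R ^ k * (Tsum σ k - I) / k.factorial + m * (R ^ k * (c ^ (k + 1)).re) =
      R ^ k / k.factorial * ((Tsum σ k - k.factorial / (σ - 1) ^ (k + 1) + k.factorial * (m * (c ^ (k + 1)).re))
        - (I - k.factorial / (σ - 1) ^ (k + 1))) := by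
      field_simp; ring
    rw [e, Real.norm_eq_abs, abs_mul, abs_of_pos (by positivity : 0 < R ^ k / k.factorial)]
    calc _ ≤ R ^ k / k.factorial * (k.factorial * M / R' ^ k + 1) := by
          gcongr
          exact (abs_sub _ _).trans (add_le_add h2 h3)
      _ = _ := by rw [div_pow]; field_simp

end Kacz

namespace Kacz

open MeasureTheory Asymptotics

lemma contraction (x ε : ℕ → ℝ) (q : ℝ) (hq0 : 0 ≤ q) (hq : q < 1) (hx : ∀ k, 0 ≤ x k)
    (hε : Tendsto ε atTop (nhds 0)) (h : ∀ᶠ k in atTop, x (k + 1) ≤ q * x k + ε k) :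
    Tendsto x atTop (nhds 0) := by
  rw [Metric.tendsto_atTop]
  intro δ hδ
  have h1 : ∀ᶠ k in atTop, ε k < (1 - q) * (δ / 2) := by
    apply hε.eventually_lt_const
    have : 0 < 1 - q := by linarith
    positivity
  obtain ⟨K, hK⟩ := eventually_atTop.1 (h.and h1)
  have h2 : ∀ n, x (K + n) - δ / 2 ≤ q ^ n * |x K - δ / 2| := by
    intro n
    induction n with
    | zero =>
      rw [add_zero, pow_zero, one_mul]
      exact le_abs_self (x K - δ / 2)
    | succ n ih =>
      obtain ⟨h3, h4⟩ := hK (K + n) (by omega)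
      rw [← add_assoc, pow_succ]
      have := mul_le_mul_of_nonneg_left ih hq0
      nlinarith
  have h3 : Tendsto (fun n => q ^ n * |x K - δ / 2|) atTop (nhds 0) := by
    simpa using (tendsto_pow_atTop_nhds_zero_of_lt_one hq0 hq).mul_const (|x K - δ / 2|)
  obtain ⟨n₀, hn₀⟩ := eventually_atTop.1 (h3.eventually_lt_const (by positivity : (0:ℝ) < δ / 2))
  refine ⟨K + n₀, fun n hn => ?_⟩
  obtain ⟨m, rfl⟩ := Nat.exists_eq_add_of_le hn
  rw [Real.dist_eq, sub_zero, abs_of_nonneg (hx _), add_assoc]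
  have := h2 (n₀ + m)
  have := hn₀ (n₀ + m) (by omega)
  linarith

lemma caseI_y (ρ₀ : ℂ) (h : riemannZeta₁ ρ₀ = 0) (hre : 1/2 < ρ₀.re) :
    ∃ (σ R : ℝ) (w D : ℂ), 1 < σ ∧ 0 < R ∧ ‖w‖ = 1 ∧ w.im ≠ 0 ∧ 0 < w.re ∧ D ≠ 0 ∧
      Tendsto (fun k : ℕ => k * (R ^ k * Amom σ k / k.factorial) - (D * w ^ k).re)
        atTop (nhds 0) := by
  obtain ⟨σ, R, m, c, hσ, hR, hRσ, hm, hc1, hcim, hcre, hlim⟩ := caseI_J ρ₀ h hre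
  set q : ℝ := R / σ with hq
  have hq0 : 0 < q := by positivity
  have hq1 : q < 1 := (div_lt_one (by linarith)).2 hRσ
  set w : ℂ := R * c with hw
  have hwn : ‖w‖ = 1 := by
    rw [hw, norm_mul, Complex.norm_real, Real.norm_eq_abs, abs_of_pos hR, mul_comm]; exact hc1
  have hwim : w.im ≠ 0 := by
    rw [hw, Complex.im_ofReal_mul]; exact mul_ne_zero hR.ne' hcim
  have hwre : 0 < w.re := by
    rw [hw, Complex.re_ofReal_mul]; positivity
  have hwq : w - q ≠ 0 := by
    intro h0
    apply hwim
    have := congrArg Complex.im h0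
    simpa using this
  have hc0 : c ≠ 0 := by rintro rfl; simp at hcim
  set D : ℂ := q * (-m * c) / (w - q) with hD
  have hD0 : D ≠ 0 := by
    rw [hD]
    refine div_ne_zero (mul_ne_zero ?_ (mul_ne_zero ?_ hc0)) hwq
    · exact_mod_cast hq0.ne'
    · exact neg_ne_zero.2 (by exact_mod_cast hm.ne')
  refine ⟨σ, R, w, D, hσ, hR, hwn, hwim, hwre, hD0, ?_⟩
  have hDw : D * (w - q) = q * (-m * c) := by rw [hD]; field_simp
  set J : ℕ → ℝ := fun k => R ^ k * (σ * Amom σ (k + 1) - (k + 1) * Amom σ k) / k.factorial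
        + m * (R ^ k * (c ^ (k + 1)).re) with hJ
  set y : ℕ → ℝ := fun k => k * (R ^ k * Amom σ k / k.factorial) with hy
  set e : ℕ → ℝ := fun k => y k - (D * w ^ k).re with he
  have hrec : ∀ k : ℕ, 1 ≤ k → e (k + 1) = q * (1 + 1 / k) * e k + ((q / k) * (D * w ^ k).re + q * J k) := by
    intro k hk
    have hk0 : (k : ℝ) ≠ 0 := by positivity
    have h1 : (D * w ^ (k + 1)).re = q * (D * w ^ k).re - q * (m * (R ^ k * (c ^ (k + 1)).re)) := by
      have : D * w ^ (k + 1) = (q:ℂ) * (D * w ^ k) - ((q * (m * R ^ k) : ℝ) : ℂ) * c ^ (k + 1) := by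
        have e1 : w ^ k = R ^ k * c ^ k := by rw [hw, mul_pow]
        have : D * w ^ (k + 1) = (D * (w - q)) * w ^ k + q * (D * w ^ k) := by ring
        rw [this, hDw, e1]; push_cast; ring
      rw [this, Complex.sub_re, Complex.re_ofReal_mul, Complex.re_ofReal_mul]; ring
    simp only [he, h1, hJ, hy]
    rw [Nat.factorial_succ]
    have hf : (k.factorial : ℝ) ≠ 0 := by positivity
    have hs : σ ≠ 0 := by linarith
    push_cast
    have hk1 : (k : ℝ) + 1 ≠ 0 := by positivity
    rw [hq]
    field_simp
    ring
  obtain ⟨q', hqq', hq'1⟩ := exists_between hq1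
  have hab : Tendsto (fun k => |e k|) atTop (nhds 0) := by
    apply contraction _ (fun k : ℕ => (q * ‖D‖) / k + q * |J k|) q' (by linarith) hq'1 (fun k => abs_nonneg _)
    · have h1 := tendsto_const_div_atTop_nhds_zero_nat (q * ‖D‖)
      have h2 : Tendsto (fun k => q * |J k|) atTop (nhds 0) := by
        simpa using hlim.abs.const_mul q
      simpa using h1.add h2
    · have h3 : Tendsto (fun k : ℕ => q * (1 + 1 / (k:ℝ))) atTop (nhds q) := by
        have := (tendsto_const_div_atTop_nhds_zero_nat (1:ℝ)).const_add 1 |>.const_mul q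
        simpa using this
      filter_upwards [h3.eventually_lt_const hqq', eventually_ge_atTop 1] with k hk hk1
      rw [hrec k hk1]
      have hk0 : (0 : ℝ) < k := by positivity
      refine (abs_add_le _ _).trans (add_le_add ?_ ((abs_add_le _ _).trans (add_le_add ?_ ?_)))
      · rw [abs_mul, abs_of_pos (by positivity : 0 < q * (1 + 1 / (k:ℝ)))]
        gcongr
      · rw [abs_mul, abs_of_pos (by positivity : 0 < q / (k:ℝ)), div_mul_eq_mul_div]
        gcongr
        refine (Complex.abs_re_le_norm _).trans ?_
        rw [norm_mul, norm_pow, hwn, one_pow, mul_one]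
      · rw [abs_mul, abs_of_pos hq0]
  exact (tendsto_zero_iff_abs_tendsto_zero _).2 hab

lemma exists_angle (w D : ℂ) (hw : ‖w‖ = 1) (him : w.im ≠ 0) (hre : 0 < w.re) :
    ∃ θ φ : ℝ, 0 < θ ∧ θ < π / 2 ∧ ∀ k : ℕ, (D * w ^ k).re = ‖D‖ * cos (φ + k * θ) := by
  have key : ∀ k : ℕ, (D * w ^ k).re = ‖D‖ * cos (Complex.arg D + k * Complex.arg w) := by
    intro k
    have h1 : D * w ^ k = ‖D‖ * Complex.exp (((Complex.arg D + k * Complex.arg w : ℝ) : ℂ) * Complex.I) := by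
      have e1 := Complex.norm_mul_exp_arg_mul_I D
      have e2 := Complex.norm_mul_exp_arg_mul_I w
      rw [hw, Complex.ofReal_one, one_mul] at e2
      have e3 : w ^ k = Complex.exp (k * (Complex.arg w * Complex.I)) := by
        rw [Complex.exp_nat_mul, e2]
      rw [e3]
      conv_lhs => rw [← e1]
      rw [mul_assoc, ← Complex.exp_add]
      congr 2
      push_cast; ring
    rw [h1, Complex.re_ofReal_mul, Complex.exp_ofReal_mul_I_re]
  have h1 : |Complex.arg w| < π / 2 := Complex.abs_arg_lt_pi_div_two_iff.2 (Or.inl hre)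
  have h0 : Complex.arg w ≠ 0 := by
    intro h
    rw [Complex.arg_eq_zero_iff] at h
    exact him h.2
  rcases lt_or_gt_of_ne h0 with h2 | h2
  · refine ⟨- Complex.arg w, - Complex.arg D, by linarith, ?_, fun k => ?_⟩
    · rw [abs_of_neg h2] at h1; exact h1
    · rw [key, ← cos_neg]; congr 2; ring
  · exact ⟨Complex.arg w, Complex.arg D, h2, by rwa [abs_of_pos h2] at h1, key⟩

lemma sign_lemma (y : ℕ → ℝ) (w D : ℂ) (hw : ‖w‖ = 1) (him : w.im ≠ 0) (hre : 0 < w.re) (hD : D ≠ 0)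
    (h : Tendsto (fun k => y k - (D * w ^ k).re) atTop (nhds 0)) :
    ∃ (k : ℕ → ℕ) (δ C : ℝ), 0 < δ ∧ 0 ≤ C ∧ (∀ i, k i < k (i + 1)) ∧ (∀ i, 1 ≤ k i) ∧
      (∀ i, (k i : ℝ) ≤ C * (i + 1)) ∧ (∀ i, y (k i) * y (k (i + 1)) < 0) ∧ (∀ i, δ ≤ |y (k i)|) := by
  obtain ⟨θ, φ, hθ, hθ2, hcos⟩ := exists_angle w D hw him hre
  have hDp : 0 < ‖D‖ := norm_pos_iff.2 hD
  have hpi := pi_pos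
  obtain ⟨K, hK⟩ := eventually_atTop.1 ((Metric.tendsto_nhds.1 h) (‖D‖ / 4) (by positivity))
  set a : ℕ → ℝ := fun j => (π * j - π / 4 - φ) / θ with ha
  obtain ⟨j₀, hj₀⟩ : ∃ j₀ : ℕ, (K : ℝ) + 1 ≤ a j₀ := by
    obtain ⟨j, hj⟩ := exists_nat_ge (((K + 1) * θ + π / 4 + φ) / π)
    refine ⟨j, ?_⟩
    rw [ha, le_div_iff₀ hθ]
    rw [div_le_iff₀ hpi] at hj
    linarith
  have hstep : ∀ j, a j + 1 ≤ a (j + 1) := by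
    intro j
    simp only [ha]
    push_cast
    rw [div_add' _ _ _ hθ.ne']
    gcongr
    linarith
  have hamono : Monotone a := monotone_nat_of_le_succ fun j => by linarith [hstep j]
  have hapos : ∀ i, (K:ℝ) + 1 ≤ a (j₀ + i) := fun i => hj₀.trans (hamono (by omega))
  set k : ℕ → ℕ := fun i => ⌈a (j₀ + i)⌉₊ with hk
  have hk1 : ∀ i, a (j₀ + i) ≤ k i := fun i => Nat.le_ceil _
  have hk2 : ∀ i, (k i : ℝ) < a (j₀ + i) + 1 := fun i =>
    Nat.ceil_lt_add_one (by have := hapos i; have : (0:ℝ) ≤ K := by positivity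
                            linarith)
  have hkK : ∀ i, K ≤ k i := fun i => by
    have : (K : ℝ) ≤ k i := by linarith [hapos i, hk1 i]
    exact_mod_cast this
  have hval : ∀ i, ‖D‖ / 4 ≤ (-1) ^ (j₀ + i) * y (k i) := by
    intro i
    have h1 := hK (k i) (hkK i)
    rw [Real.dist_eq, sub_zero, hcos] at h1
    set t := φ + k i * θ - (j₀ + i : ℕ) * π with ht
    have ht1 : - (π / 4) ≤ t := by
      have := hk1 i
      simp only [ha] at this
      rw [div_le_iff₀ hθ] at this
      rw [ht]; linarith
    have ht2 : t ≤ π / 4 := by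
      have := hk2 i
      simp only [ha] at this
      rw [div_add' _ _ _ hθ.ne', lt_div_iff₀ hθ] at this
      rw [ht]; linarith
    have hct : 1 / 2 ≤ cos t := by
      have := one_sub_sq_div_two_le_cos (x := t)
      have h3 : |t| ≤ 1 := by rw [abs_le]; constructor <;> linarith [pi_lt_four]
      have h4 : t ^ 2 ≤ 1 := by rw [← sq_abs]; nlinarith [abs_nonneg t]
      linarith
    have e : cos (φ + k i * θ) = (-1) ^ (j₀ + i) * cos t := by
      rw [← cos_add_nat_mul_pi, ht]; congr 1; ring
    rw [e] at h1
    have h2 : |(-1) ^ (j₀ + i) * y (k i) - ‖D‖ * cos t| < ‖D‖ / 4 := by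
      rcases neg_one_pow_eq_or ℝ (j₀ + i) with h5 | h5
      · rw [h5] at h1 ⊢
        simpa using h1
      · rw [h5] at h1 ⊢
        rw [← abs_neg]
        convert h1 using 2; ring
    have := (abs_lt.1 h2).1
    nlinarith
  have hδ : ∀ i, ‖D‖ / 4 ≤ |y (k i)| := fun i => by
    refine (hval i).trans ((le_abs_self _).trans (le_of_eq ?_))
    rw [abs_mul, abs_pow, abs_neg, abs_one, one_pow, one_mul]
  refine ⟨k, ‖D‖ / 4, |a j₀| + 1 + π / θ, by positivity, by positivity, ?_, ?_, ?_, ?_, hδ⟩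
  · intro i
    have h1 := hk2 i
    have h2 := hk1 (i + 1)
    have h3 := hstep (j₀ + i)
    rw [← add_assoc] at h2
    exact_mod_cast (by linarith : (k i : ℝ) < k (i + 1))
  · intro i
    have := hk1 i; have := hapos i; have h0 : (0:ℝ) ≤ K := by positivity
    exact_mod_cast (by linarith : (1:ℝ) ≤ k i)
  · intro i
    have h1 := hk2 i
    have h2 : a (j₀ + i) = a j₀ + π / θ * i := by
      simp only [ha]; push_cast; field_simp; ring
    rw [h2] at h1
    have : a j₀ ≤ |a j₀| := le_abs_self _
    have h3 : 0 ≤ (|a j₀| + 1) * i := by positivity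
    have h4 : 0 < π / θ := by positivity
    nlinarith
  · intro i
    have h1 := hval i
    have h2 := hval (i + 1)
    have h3 : (0:ℝ) < ((-1) ^ (j₀ + i) * y (k i)) * ((-1) ^ (j₀ + (i + 1)) * y (k (i + 1))) := by
      apply mul_pos <;> linarith
    have h4 : ((-1:ℝ) ^ (j₀ + i)) * (-1) ^ (j₀ + i) = 1 := by rw [← mul_pow]; simp
    have e : ((-1:ℝ) ^ (j₀ + i) * y (k i)) * ((-1) ^ (j₀ + (i + 1)) * y (k (i + 1))) =
      - (((-1:ℝ) ^ (j₀ + i)) * (-1) ^ (j₀ + i)) * (y (k i) * y (k (i + 1))) := by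
      rw [← add_assoc, pow_succ]; ring
    rw [e, h4] at h3
    linarith

end Kacz

namespace Kacz

open MeasureTheory Asymptotics

lemma tail_bound (σ : ℝ) (hσ : 1 < σ) (k : ℕ) (U : ℝ) (hU : log 2 ≤ U) :
    |Amom σ k - ∫ u in (log 2)..U, (B u * exp (-σ * u)) * u ^ k| ≤
      2 * (k.factorial / ((σ - 1) / 2) ^ k) * (exp (-((σ - 1) / 2) * U) / ((σ - 1) / 2)) := by
  have hIntg := moment_integrable σ hσ k
  have hlam : 0 < (σ - 1) / 2 := by linarith
  have e1 : ∫ u in (log 2)..U, (B u * exp (-σ * u)) * u ^ k =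
      ∫ u in (log 2)..U, B u * (u ^ k * exp (-σ * u)) := by
    congr 1; ext u; ring
  have hintU : IntegrableOn (fun u => B u * (u ^ k * exp (-σ * u))) (Ioi U) :=
    hIntg.mono_set (Ioi_subset_Ioi hU)
  have e2 : Amom σ k - ∫ u in (log 2)..U, (B u * exp (-σ * u)) * u ^ k =
      ∫ u in Ioi U, B u * (u ^ k * exp (-σ * u)) := by
    rw [e1, Amom, ← intervalIntegral.integral_Ioi_sub_Ioi hIntg hU]
    ring
  rw [e2, ← Real.norm_eq_abs]
  have hexp : IntegrableOn (fun u => 2 * (k.factorial / ((σ - 1) / 2) ^ k) * exp (-((σ - 1) / 2) * u)) (Ioi U) :=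
    (integrableOn_exp_mul_Ioi (by linarith) U).const_mul _
  refine (norm_integral_le_of_norm_le hexp ?_).trans (le_of_eq ?_)
  · refine (ae_restrict_iff' measurableSet_Ioi).2 (Eventually.of_forall fun u hu => ?_)
    exact moment_bound σ hσ k u (hU.trans (le_of_lt hu))
  · rw [integral_const_mul, integral_exp_mul_Ioi (by linarith)]
    congr 1
    rw [neg_div, div_neg, neg_neg]

theorem caseI (ρ₀ : ℂ) (h : riemannZeta₁ ρ₀ = 0) (hre : 1/2 < ρ₀.re) :
    ∃ C₁ C₂ : ℝ, 0 < C₁ ∧ ∀ N : ℕ, Alt B (log 2) (C₁ * N + C₂) N := by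
  obtain ⟨σ, R, w, D, hσ, hR, hw, him, hwre, hD, hlim⟩ := caseI_y ρ₀ h hre
  obtain ⟨k, δ, C, hδ, hC, hkmono, hk1, hkC, hsign, hlow⟩ := sign_lemma _ w D hw him hwre hD hlim
  set lam : ℝ := (σ - 1) / 2 with hlam
  have hl : 0 < lam := by rw [hlam]; linarith
  set c : ℝ := |log (R / lam)| with hc
  have hcR : R / lam ≤ exp c := by
    rw [← log_le_iff_le_exp (by positivity)]; exact le_abs_self _
  set c2 : ℝ := |log (2 / (lam * δ))| + 1 with hc2
  have hc2' : 2 / lam * exp (-c2) < δ := by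
    have h1 : exp (-c2) < exp (- log (2 / (lam * δ))) := by
      apply exp_lt_exp.2
      rw [hc2]
      linarith [le_abs_self (log (2 / (lam * δ)))]
    rw [exp_neg (log _), exp_log (by positivity)] at h1
    calc 2 / lam * exp (-c2) < 2 / lam * (2 / (lam * δ))⁻¹ := by gcongr
      _ = δ := by field_simp
  have hc0 : 0 ≤ c := abs_nonneg _
  have hc20 : 0 ≤ c2 := by positivity
  refine ⟨(1 + c) * C / lam + 1, ((1 + c) * C + c2) / lam + 1, by positivity, fun N => ?_⟩
  set U : ℝ := ((1 + c) * C / lam + 1) * N + (((1 + c) * C + c2) / lam + 1) with hU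
  have hU1 : 1 ≤ U := by
    have h1 : 0 ≤ ((1 + c) * C / lam + 1) * N := by positivity
    have h2 : 0 ≤ ((1 + c) * C + c2) / lam := by positivity
    rw [hU]; linarith
  have hlog2 : log 2 < U := by have := Real.log_two_lt_d9; linarith
  have hUb : (1 + c) * (C * (N + 1)) + c2 ≤ lam * U := by
    have : lam * U = (1 + c) * (C * (N + 1)) + c2 + lam * (N + 1) := by
      rw [hU]; field_simp; ring
    rw [this]
    have : 0 ≤ lam * ((N:ℝ) + 1) := by positivity
    linarith
  have hsame : ∀ i ≤ N, 0 < Amom σ (k i) * ∫ u in (log 2)..U, (B u * exp (-σ * u)) * u ^ (k i) := by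
    intro i hi
    have h1 := tail_bound σ hσ (k i) U hlog2.le
    set A := Amom σ (k i)
    set T := ∫ u in (log 2)..U, (B u * exp (-σ * u)) * u ^ (k i)
    set n := k i with hn
    have hlow' := hlow i
    rw [← hn, abs_mul, abs_div, abs_mul, abs_of_pos (by positivity : 0 < R ^ n),
      Nat.abs_cast, Nat.abs_cast] at hlow'
    have hn0 : (0:ℝ) < n := by have := hk1 i; positivity
    have hf : (0:ℝ) < n.factorial := by positivity
    have hAlow : δ * n.factorial / (n * R ^ n) ≤ |A| := by
      rw [div_le_iff₀ (by positivity)]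
      calc δ * n.factorial ≤ (n * (R ^ n * |A| / n.factorial)) * n.factorial := by gcongr
        _ = _ := by field_simp
    have hlt : |A - T| < |A| := by
      refine lt_of_le_of_lt h1 (lt_of_lt_of_le ?_ hAlow)
      rw [← hlam]
      have e : 2 * (n.factorial / lam ^ n) * (exp (-lam * U) / lam) =
          (n.factorial / (n * R ^ n)) * (2 / lam * (n * (R / lam) ^ n * exp (-lam * U))) := by
        rw [div_pow R lam n]; field_simp
      rw [e, mul_comm δ, mul_div_right_comm]
      refine mul_lt_mul_of_pos_left ?_ (by positivity)
      refine lt_of_le_of_lt ?_ hc2'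
      gcongr
      have hne : (n:ℝ) ≤ exp n := by linarith [add_one_le_exp (n:ℝ)]
      have hkn : (n:ℝ) ≤ C * (N + 1) := by
        refine (hkC i).trans ?_
        have : (i:ℝ) ≤ N := by exact_mod_cast hi
        gcongr
      calc n * (R / lam) ^ n * exp (-lam * U) ≤ exp n * (exp c) ^ n * exp (-lam * U) := by gcongr
        _ = exp ((1 + c) * n - lam * U) := by
          rw [← exp_nat_mul, ← exp_add, ← exp_add]; congr 1; ring
        _ ≤ exp (-c2) := by
          apply exp_le_exp.2
          have : (1 + c) * n ≤ (1 + c) * (C * (N + 1)) := by gcongr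
          linarith
    have h2 : (A - T) ^ 2 < A ^ 2 := sq_lt_sq.2 hlt
    nlinarith [sq_nonneg T]
  have hIntg : IntervalIntegrable (fun u => B u * exp (-σ * u)) volume (log 2) U := by
    rw [intervalIntegrable_iff_integrableOn_Ioc_of_le hlog2.le]
    have := (moment_integrable σ hσ 0).mono_set (fun x (hx : x ∈ Ioc (log 2) U) => hx.1)
    simpa using this
  have hAA : ∀ i, Amom σ (k i) * Amom σ (k (i + 1)) < 0 := by
    intro i
    have h1 := hsign i
    by_contra hcon
    push Not at hcon
    have : 0 ≤ (↑(k i) * (R ^ k i * Amom σ (k i) / ↑(k i).factorial)) *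
        (↑(k (i + 1)) * (R ^ k (i + 1) * Amom σ (k (i + 1)) / ↑(k (i + 1)).factorial)) := by
      have e : (↑(k i) * (R ^ k i * Amom σ (k i) / ↑(k i).factorial)) *
        (↑(k (i + 1)) * (R ^ k (i + 1) * Amom σ (k (i + 1)) / ↑(k (i + 1)).factorial)) =
        (↑(k i) * (R ^ k i / ↑(k i).factorial)) * (↑(k (i + 1)) * (R ^ k (i + 1) / ↑(k (i + 1)).factorial))
          * (Amom σ (k i) * Amom σ (k (i + 1))) := by ring
      rw [e]
      positivity
    linarith
  have hS : SAlt (fun j => ∫ u in (log 2)..U, (B u * exp (-σ * u)) * u ^ j) N := by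
    refine ⟨k, fun i _ => hkmono i, fun i hi => ?_⟩
    have h1 := hsame i hi.le
    have h2 := hsame (i + 1) hi
    have h3 := hAA i
    have h4 := mul_pos h1 h2
    by_contra hcon
    push Not at hcon
    have := mul_nonneg_of_nonpos_of_nonpos h3.le (neg_nonpos.2 hcon)
    nlinarith
  obtain ⟨x, hx1, hx2, hx3⟩ := variation (log 2) U log2_pos hlog2 N _ hIntg hS
  refine ⟨x, hx1, hx2, fun i hi => ?_⟩
  have := hx3 i hi
  by_contra hcon
  push Not at hcon
  have h5 : 0 ≤ (B (x i) * exp (-σ * x i)) * (B (x (i + 1)) * exp (-σ * x (i + 1))) := by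
    have e : (B (x i) * exp (-σ * x i)) * (B (x (i + 1)) * exp (-σ * x (i + 1))) =
      (B (x i) * B (x (i + 1))) * (exp (-σ * x i) * exp (-σ * x (i + 1))) := by ring
    rw [e]; positivity
  linarith

end Kacz

namespace Kacz

open MeasureTheory Asymptotics

/-- The Riemann xi function, centred at `1/2`. -/
noncomputable def xi (z : ℂ) : ℂ := (z ^ 2 - 1 / 4) * completedRiemannZeta₀ (1 / 2 + z) + 1

lemma xi_diff : Differentiable ℂ xi := by
  unfold xi
  have h : Differentiable ℂ (fun z : ℂ => completedRiemannZeta₀ (1 / 2 + z)) :=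
    differentiable_completedZeta₀.comp (by fun_prop : Differentiable ℂ fun z : ℂ => 1 / 2 + z)
  fun_prop

lemma xi_even (z : ℂ) : xi (-z) = xi z := by
  unfold xi
  have : (1 / 2 + -z : ℂ) = 1 - (1 / 2 + z) := by ring
  rw [this, completedRiemannZeta₀_one_sub]
  ring

lemma xi_eq (s : ℂ) (hs : 0 < s.re) : xi (s - 1 / 2) = s * s.Gammaℝ * riemannZeta₁ s := by
  unfold xi
  have e : (1 / 2 + (s - 1 / 2) : ℂ) = s := by ring
  rw [e]
  have hs0 : s ≠ 0 := by rintro rfl; simp at hs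
  by_cases h1 : s = 1
  · subst h1
    rw [riemannZeta₁_one, Complex.Gammaℝ_one]; ring
  · have hs1 : s - 1 ≠ 0 := sub_ne_zero.2 h1
    have hs2 : 1 - s ≠ 0 := sub_ne_zero.2 (Ne.symm h1)
    have h2 := riemannZeta_eq_inv_sub_mul h1
    rw [riemannZeta_def_of_ne_zero hs0, completedRiemannZeta_eq] at h2
    have hG : s.Gammaℝ ≠ 0 := Complex.Gammaℝ_ne_zero_of_re_pos hs
    have h3 : riemannZeta₁ s = (s - 1) * ((completedRiemannZeta₀ s - 1 / s - 1 / (1 - s)) / s.Gammaℝ) := by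
      rw [h2]; field_simp
    rw [h3]
    have e2 : (1:ℂ) / (1 - s) = - (1 / (s - 1)) := by
      rw [← neg_sub s 1, div_neg]
    rw [e2]
    field_simp
    ring

lemma xi_zero_ne : xi 0 ≠ 0 := by
  have h := xi_eq (1 / 2) (by norm_num)
  rw [sub_self] at h
  rw [h]
  refine mul_ne_zero (mul_ne_zero (by norm_num) (Complex.Gammaℝ_ne_zero_of_re_pos (by norm_num))) ?_
  have := zeta1_ne_zero_real (1 / 2) (by norm_num)
  simpa using this

lemma xi_zeros (hRH : ∀ ρ : ℂ, riemannZeta₁ ρ = 0 → ρ.re ≤ 1 / 2) (a : ℂ) (ha : xi a = 0) : a.re = 0 := by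
  have key : ∀ a : ℂ, xi a = 0 → a.re ≤ 0 := by
    intro a ha
    by_contra hcon
    push Not at hcon
    have hre : (0:ℝ) < (a + 1 / 2).re := by
      have : (a + 1 / 2).re = a.re + 1 / 2 := by simp
      rw [this]; linarith
    have h := xi_eq (a + 1 / 2) hre
    rw [add_sub_cancel_right, ha] at h
    have h2 := mul_eq_zero.1 h.symm
    rcases h2 with h2 | h2
    · rcases mul_eq_zero.1 h2 with h3 | h3
      · rw [h3] at hre; simp at hre
      · exact Complex.Gammaℝ_ne_zero_of_re_pos hre h3
    · have := hRH _ h2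
      have e : (a + 1 / 2).re = a.re + 1 / 2 := by simp
      linarith
  have h1 := key a ha
  have h2 := key (-a) (by rw [xi_even, ha])
  rw [Complex.neg_re] at h2
  linarith

lemma Gamma_bound (w : ℂ) (n : ℕ) (h1 : 1 / 4 ≤ w.re) (h2 : w.re ≤ n + 1) :
    ‖Complex.Gamma w‖ ≤ Real.Gamma (1 / 4) + n.factorial := by
  have hw : 0 < w.re := by linarith
  rw [Complex.Gamma_eq_integral hw, ← Real.Gamma_nat_eq_factorial, Real.Gamma_eq_integral (by norm_num),
    Real.Gamma_eq_integral (by positivity)]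
  have i1 := Real.GammaIntegral_convergent (s := 1 / 4) (by norm_num)
  have i2 := Real.GammaIntegral_convergent (s := (n:ℝ) + 1) (by positivity)
  rw [← integral_add i1 i2, Complex.GammaIntegral]
  refine norm_integral_le_of_norm_le (i1.add i2) ?_
  refine (ae_restrict_iff' measurableSet_Ioi).2 (Eventually.of_forall fun t ht => ?_)
  have ht : 0 < t := ht
  rw [norm_mul, Complex.norm_real, Complex.norm_cpow_eq_rpow_re_of_pos ht, Real.norm_eq_abs, abs_of_pos (exp_pos _),
    ← mul_add]
  gcongr
  simp only [Complex.sub_re, Complex.one_re]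
  rcases le_total t 1 with h | h
  · have : t ^ (w.re - 1) ≤ t ^ ((1:ℝ) / 4 - 1) := rpow_le_rpow_of_exponent_ge ht h (by linarith)
    have : 0 ≤ t ^ ((n:ℝ) + 1 - 1) := by positivity
    linarith
  · have : t ^ (w.re - 1) ≤ t ^ ((n:ℝ) + 1 - 1) := rpow_le_rpow_of_exponent_le h (by linarith)
    have : 0 ≤ t ^ ((1:ℝ) / 4 - 1) := by positivity
    linarith

lemma FF_mellin_bound (s : ℂ) (hs : 1 / 2 ≤ s.re) : ‖mellin FF (-s)‖ ≤ 2 := by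
  have hIntg : IntegrableOn (fun t : ℝ => t ^ (-(3:ℝ) / 2)) (Ioi 1) :=
    integrableOn_Ioi_rpow_of_lt (by norm_num) one_pos
  have h1 : mellin FF (-s) = ∫ t in Ioi (1:ℝ), (t:ℂ) ^ (-s - 1) • FF t := by
    rw [mellin]
    refine setIntegral_eq_of_subset_of_forall_diff_eq_zero measurableSet_Ioi
      (Ioi_subset_Ioi (by norm_num)) ?_
    intro t ht
    have : ¬ (1 < t) := ht.2
    simp [FF, this]
  rw [h1]
  refine (norm_integral_le_of_norm_le hIntg ?_).trans ?_
  · refine (ae_restrict_iff' measurableSet_Ioi).2 (Eventually.of_forall fun t ht => ?_)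
    have ht : 1 < t := ht
    rw [norm_smul, Complex.norm_cpow_eq_rpow_re_of_pos (by linarith)]
    calc t ^ (-s - 1).re * ‖FF t‖ ≤ t ^ (-(3:ℝ) / 2) * 1 := by
          gcongr
          · exact ht.le
          · simp; linarith
          · exact FF_norm_le t
      _ = _ := mul_one _
  · rw [integral_Ioi_rpow_of_lt (by norm_num) one_pos]
    norm_num

/-- growth exponent -/
noncomputable def MR (R : ℝ) : ℝ := log (Real.Gamma (1 / 4) + 1) + (R + 5) * log (R + 7)

lemma xi_bound_aux (R : ℝ) (z : ℂ) (hz : ‖z‖ ≤ R) (hre : 0 ≤ z.re) : ‖xi z‖ ≤ exp (MR R) := by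
  have hR : 0 ≤ R := (norm_nonneg z).trans hz
  set s : ℂ := z + 1 / 2 with hs
  have hsre : s.re = z.re + 1 / 2 := by simp [hs]
  have hs0 : 0 < s.re := by rw [hsre]; linarith
  have hzs : z = s - 1 / 2 := by rw [hs]; ring
  have hzre : z.re ≤ R := (Complex.re_le_norm z).trans hz
  rw [hzs, xi_eq s hs0, zeta1_formula s hs0]
  set n := ⌈R⌉₊ with hn
  have hnR : (n:ℝ) ≤ R + 1 := (Nat.ceil_lt_add_one hR).le
  have hRn : R ≤ n := Nat.le_ceil R
  have hG4 : 0 < Real.Gamma (1 / 4) := Real.Gamma_pos_of_pos (by norm_num)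
  have hsn : ‖s‖ ≤ R + 1 := by
    rw [hs]
    refine (norm_add_le _ _).trans ?_
    have : ‖(1 / 2 : ℂ)‖ = 1 / 2 := by norm_num
    rw [this]; linarith
  have hsn1 : ‖s - 1‖ ≤ R + 1 := by
    have e : s - 1 = z - 1 / 2 := by rw [hs]; ring
    rw [e]
    refine (norm_sub_le _ _).trans ?_
    have : ‖(1 / 2 : ℂ)‖ = 1 / 2 := by norm_num
    rw [this]; linarith
  have hGam : ‖s.Gammaℝ‖ ≤ Real.Gamma (1 / 4) + n.factorial := by
    rw [Complex.Gammaℝ_def, norm_mul]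
    have h1 : ‖(π:ℂ) ^ (-s / 2)‖ ≤ 1 := by
      rw [Complex.norm_cpow_eq_rpow_re_of_pos pi_pos]
      apply rpow_le_one_of_one_le_of_nonpos (by linarith [pi_gt_three])
      have : (-s / 2).re = - s.re / 2 := by simp
      rw [this]; linarith
    have e2 : (s / 2).re = s.re / 2 := by simp
    have h2 := Gamma_bound (s / 2) n (by rw [e2]; linarith) (by rw [e2]; linarith)
    calc _ ≤ 1 * (Real.Gamma (1 / 4) + n.factorial) := by gcongr
      _ = _ := one_mul _
  have hz1 : ‖s - s * (s - 1) * mellin FF (-s)‖ ≤ (R + 1) + (R + 1) * (R + 1) * 2 := by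
    refine (norm_sub_le _ _).trans ?_
    rw [norm_mul, norm_mul]
    have := FF_mellin_bound s (by linarith)
    gcongr
  rw [norm_mul, norm_mul]
  have hf : (n.factorial : ℝ) ≤ (R + 7) ^ (R + 1) := by
    calc (n.factorial : ℝ) ≤ (n:ℝ) ^ n := by exact_mod_cast Nat.factorial_le_pow n
      _ ≤ (R + 7) ^ n := by gcongr; linarith
      _ = (R + 7) ^ (n:ℝ) := (rpow_natCast _ _).symm
      _ ≤ _ := rpow_le_rpow_of_exponent_le (by linarith) hnR
  have hone : (1:ℝ) ≤ (R + 7) ^ (R + 1) := one_le_rpow (by linarith) (by linarith)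
  have hexp : exp (MR R) = (Real.Gamma (1 / 4) + 1) * ((R + 7) ^ (R + 1) * (R + 7) ^ 4) := by
    rw [MR, exp_add, exp_log (by positivity)]
    congr 1
    rw [← rpow_natCast (R + 7) 4, ← rpow_add (by linarith), rpow_def_of_pos (by linarith)]
    congr 1; push_cast; ring
  rw [hexp]
  calc ‖s‖ * ‖s.Gammaℝ‖ * ‖s - s * (s - 1) * mellin FF (-s)‖
      ≤ (R + 1) * (Real.Gamma (1 / 4) + n.factorial) * ((R + 1) + (R + 1) * (R + 1) * 2) := by gcongr
    _ = (Real.Gamma (1 / 4) + n.factorial) * ((R + 1) * ((R + 1) + (R + 1) * (R + 1) * 2)) := by ring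
    _ ≤ ((Real.Gamma (1 / 4) + 1) * (R + 7) ^ (R + 1)) * (R + 7) ^ 4 := by
        gcongr
        · nlinarith
        · nlinarith [pow_nonneg hR 2, pow_nonneg hR 3, pow_nonneg hR 4]
    _ = _ := by ring

lemma xi_bound (R : ℝ) (z : ℂ) (hz : ‖z‖ ≤ R) : ‖xi z‖ ≤ exp (MR R) := by
  rcases le_total 0 z.re with h | h
  · exact xi_bound_aux R z hz h
  · rw [← xi_even]
    exact xi_bound_aux R (-z) (by rwa [norm_neg]) (by simpa using h)

lemma MR_small : Tendsto (fun R : ℝ => MR R / R ^ 2) atTop (nhds 0) := by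
  have h1 : Tendsto (fun R : ℝ => log (R + 7) / (R + 7)) atTop (nhds 0) :=
    (isLittleO_log_id_atTop.tendsto_div_nhds_zero).comp (tendsto_atTop_add_const_right _ 7 tendsto_id)
  have h2 : Tendsto (fun R : ℝ => R⁻¹) atTop (nhds 0) := tendsto_inv_atTop_zero
  have h3 : Tendsto (fun R : ℝ => log (Real.Gamma (1 / 4) + 1) * (R⁻¹ * R⁻¹) +
      (1 + 5 * R⁻¹) * (1 + 7 * R⁻¹) * (log (R + 7) / (R + 7))) atTop (nhds (log (Real.Gamma (1 / 4) + 1) * (0 * 0)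
      + (1 + 5 * 0) * (1 + 7 * 0) * 0)) :=
    ((h2.mul h2).const_mul _).add ((((h2.const_mul 5).const_add 1).mul ((h2.const_mul 7).const_add 1)).mul h1)
  have e : (log (Real.Gamma (1 / 4) + 1) * (0 * 0)
      + (1 + 5 * 0) * (1 + 7 * 0) * 0 : ℝ) = 0 := by ring
  rw [e] at h3
  refine h3.congr' ?_
  filter_upwards [eventually_gt_atTop 0] with R hR
  have : R + 7 ≠ 0 := by positivity
  rw [MR]
  field_simp

end Kacz

namespace Kacz

open MeasureTheory Asymptotics

lemma BC_logDeriv (G : ℂ → ℂ) (hG : Differentiable ℂ G) (R A : ℝ) (hR : 0 < R) (hA : 0 < A)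
    (hnz : ∀ z, ‖z‖ < R → G z ≠ 0) (hb : ∀ z, ‖z‖ < R → ‖G z‖ ≤ exp A * ‖G 0‖) (x : ℂ) (hx : ‖x‖ ≤ R / 8) :
    ‖deriv G x / G x - deriv G (-x) / G (-x)‖ ≤ 128 * A * ‖x‖ / R ^ 2 := by
  set h : ℂ → ℂ := fun z => deriv G z / G z with hh
  have hball : ∀ z, z ∈ Metric.ball (0:ℂ) R ↔ ‖z‖ < R := fun z => by simp
  have hdiffh : DifferentiableOn ℂ h (Metric.ball 0 R) := by
    intro z hz
    have h1 : DifferentiableAt ℂ (deriv G) z := (hG.analyticAt z).deriv.differentiableAt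
    exact (h1.div (hG z) (hnz z ((hball z).1 hz))).differentiableWithinAt
  have hex := hdiffh.isExactOn_ball
  obtain ⟨g, hg0, hg⟩ := hex.with_val_at 0 0
  have hgd : DifferentiableOn ℂ g (Metric.ball 0 R) := fun z hz => (hg z hz).differentiableAt.differentiableWithinAt
  have hconst : ∀ z, ‖z‖ < R → G z = G 0 * Complex.exp (g z) := by
    intro z hz
    have hd : ∀ w ∈ Metric.ball (0:ℂ) R, HasDerivAt (fun w => G w * Complex.exp (-g w)) 0 w := by
      intro w hw
      have h1 := (hG w).hasDerivAt.mul ((hg w hw).neg.cexp)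
      refine h1.congr_deriv ?_
      have := hnz w ((hball w).1 hw)
      simp only [hh]
      field_simp
      ring
    have h2 := Metric.isOpen_ball.is_const_of_deriv_eq_zero (convex_ball (0:ℂ) R).isPreconnected
      (fun w hw => (hd w hw).differentiableAt.differentiableWithinAt)
      (fun w hw => (hd w hw).deriv) ((hball z).2 hz) (Metric.mem_ball_self hR)
    simp only [hg0, neg_zero, Complex.exp_zero, mul_one] at h2
    rw [← h2, mul_assoc, ← Complex.exp_add]; simp
  have hre : MapsTo g (Metric.ball 0 R) {z | z.re ≤ A} := by
    intro z hz
    have h1 := hb z ((hball z).1 hz)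
    rw [hconst z ((hball z).1 hz), norm_mul, Complex.norm_exp, mul_comm] at h1
    have h0 : 0 < ‖G 0‖ := norm_pos_iff.2 (hnz 0 (by simpa using hR))
    exact exp_le_exp.1 (le_of_mul_le_mul_right h1 h0)
  have hg2 : ∀ z, ‖z‖ ≤ R / 2 → ‖g z‖ ≤ 2 * A := by
    intro z hz
    refine (Complex.borelCaratheodory_zero hA hgd hre hR ((hball z).2 (by linarith)) hg0).trans ?_
    rw [div_le_iff₀ (by linarith)]
    nlinarith
  have hgder : ∀ z, ‖z‖ ≤ R / 4 → ‖h z‖ ≤ 8 * A / R := by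
    intro z hz
    have hzb : z ∈ Metric.ball (0:ℂ) R := (hball z).2 (by linarith)
    rw [← (hg z hzb).deriv]
    have hd : DiffContOnCl ℂ g (Metric.ball z (R / 4)) := by
      apply DifferentiableOn.diffContOnCl
      refine hgd.mono ?_
      rw [closure_ball _ (by positivity)]
      intro w hw
      rw [hball]
      have : ‖w - z‖ ≤ R / 4 := by simpa [dist_eq_norm] using hw
      have := norm_add_le (w - z) z
      rw [sub_add_cancel] at this
      linarith
    refine (Complex.norm_deriv_le_of_forall_mem_sphere_norm_le (C := 2 * A) (by positivity) hd ?_).trans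
      (le_of_eq (by field_simp; ring))
    intro w hw
    apply hg2
    have : ‖w - z‖ = R / 4 := by simpa [dist_eq_norm] using hw
    have := norm_add_le (w - z) z
    rw [sub_add_cancel] at this
    linarith
  have hhder : ∀ z, ‖z‖ ≤ R / 8 → ‖deriv h z‖ ≤ 64 * A / R ^ 2 := by
    intro z hz
    have hd : DiffContOnCl ℂ h (Metric.ball z (R / 8)) := by
      apply DifferentiableOn.diffContOnCl
      refine hdiffh.mono ?_
      rw [closure_ball _ (by positivity)]
      intro w hw
      rw [hball]
      have : ‖w - z‖ ≤ R / 8 := by simpa [dist_eq_norm] using hw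
      have := norm_add_le (w - z) z
      rw [sub_add_cancel] at this
      linarith
    refine (Complex.norm_deriv_le_of_forall_mem_sphere_norm_le (C := 8 * A / R) (by positivity) hd ?_).trans
      (le_of_eq (by field_simp; ring))
    intro w hw
    apply hgder
    have : ‖w - z‖ = R / 8 := by simpa [dist_eq_norm] using hw
    have := norm_add_le (w - z) z
    rw [sub_add_cancel] at this
    linarith
  have hfin := Convex.norm_image_sub_le_of_norm_deriv_le (𝕜 := ℂ) (f := h) (s := Metric.closedBall (0:ℂ) (R / 8))
    (C := 64 * A / R ^ 2) (x := -x) (y := x)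
    (fun w hw => (hdiffh w ((hball w).2 (by have : ‖w‖ ≤ R / 8 := by simpa using hw
                                            linarith))).differentiableAt
      (Metric.isOpen_ball.mem_nhds ((hball w).2 (by have : ‖w‖ ≤ R / 8 := by simpa using hw
                                                    linarith))))
    (fun w hw => hhder w (by simpa using hw)) (convex_closedBall _ _) (by simpa using hx) (by simpa using hx)
  refine hfin.trans (le_of_eq ?_)
  have : ‖x - -x‖ = 2 * ‖x‖ := by
    rw [sub_neg_eq_add, ← two_mul, norm_mul]; simp
  rw [this]; ring

lemma logDeriv_approx (f : ℂ → ℂ) (hf : Differentiable ℂ f) (h0 : f 0 ≠ 0) (R M : ℝ) (hR : 0 < R)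
    (hM : ∀ z, ‖z‖ ≤ 2 * R → ‖f z‖ ≤ exp M) (S : Finset ℂ) (hS : ∀ a, a ∈ S ↔ (f a = 0 ∧ ‖a‖ ≤ R))
    (x : ℂ) (hx : ‖x‖ ≤ R / 8) (hfx : f x ≠ 0) (hfx' : f (-x) ≠ 0) :
    ‖deriv f x / f x - deriv f (-x) / f (-x) -
      ∑ a ∈ S, (analyticOrderNatAt f a : ℂ) * (1 / (x - a) + 1 / (x + a))‖ ≤
      128 * (|M| + |log ‖f 0‖| + 1) * ‖x‖ / R ^ 2 := by
  obtain ⟨G, hG, hGS, hfac⟩ := factor_finset f hf 0 h0 S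
  set n : ℂ → ℕ := fun a => analyticOrderNatAt f a with hn
  have hGnz : ∀ z, ‖z‖ < R → G z ≠ 0 := by
    intro z hz hGz
    have hfz : f z = 0 := by rw [hfac z, hGz, mul_zero]
    exact hGS z ((hS z).2 ⟨hfz, hz.le⟩) hGz
  have ha0 : ∀ a ∈ S, 0 < ‖a‖ := by
    intro a ha
    rw [norm_pos_iff]
    rintro rfl
    exact h0 ((hS 0).1 ha).1
  set P : ℝ := ∏ a ∈ S, ‖a‖ ^ (n a) with hP
  have hPpos : 0 < P := Finset.prod_pos fun a ha => pow_pos (ha0 a ha) _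
  have hf0 : ‖f 0‖ = P * ‖G 0‖ := by
    rw [hfac 0, norm_mul, norm_prod, hP]
    congr 1
    apply Finset.prod_congr rfl
    intro a _
    rw [zero_sub, norm_pow, norm_neg]
  have hfr : ∀ z, ‖z‖ = 2 * R → ‖G z‖ ≤ exp M / P := by
    intro z hz
    rw [le_div_iff₀ hPpos]
    refine le_trans ?_ (hM z hz.le)
    rw [hfac z, norm_mul, norm_prod, mul_comm]
    gcongr
    rw [hP]
    apply Finset.prod_le_prod
    · intro a _; positivity
    · intro a ha
      rw [norm_pow]
      gcongr
      have h1 := ((hS a).1 ha).2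
      have h2 := norm_sub_norm_le z a
      linarith
  have hin : ∀ z, ‖z‖ < R → ‖G z‖ ≤ exp M / P := by
    intro z hz
    refine Complex.norm_le_of_forall_mem_frontier_norm_le (U := Metric.ball (0:ℂ) (2 * R)) Metric.isBounded_ball
      hG.diffContOnCl ?_ (subset_closure (by simp; linarith))
    intro w hw
    rw [frontier_ball _ (by positivity)] at hw
    exact hfr w (by simpa using hw)
  set A := |M| + |log ‖f 0‖| + 1 with hA
  have hApos : 0 < A := by positivity
  have hf0pos : 0 < ‖f 0‖ := norm_pos_iff.2 h0
  have hb : ∀ z, ‖z‖ < R → ‖G z‖ ≤ exp A * ‖G 0‖ := by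
    intro z hz
    refine (hin z hz).trans ?_
    have hG0 : ‖G 0‖ = ‖f 0‖ / P := by rw [hf0]; field_simp
    rw [hG0, ← mul_div_assoc]
    gcongr
    calc exp M ≤ exp (A + log ‖f 0‖) := by
          apply exp_le_exp.2
          linarith [le_abs_self M, neg_abs_le (log ‖f 0‖)]
      _ = _ := by rw [exp_add, exp_log hf0pos]
  have hmain := BC_logDeriv G hG R A hR hApos hGnz hb x hx
  rw [logDeriv_factor f G hG S n hfac x hfx, logDeriv_factor f G hG S n hfac (-x) hfx']
  refine le_trans (le_of_eq ?_) hmain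
  congr 1
  have e : ∑ a ∈ S, (n a : ℂ) * (1 / (x - a) + 1 / (x + a)) =
      ∑ a ∈ S, (n a : ℂ) / (x - a) - ∑ a ∈ S, (n a : ℂ) / (-x - a) := by
    rw [← Finset.sum_sub_distrib]
    apply Finset.sum_congr rfl
    intro a _
    rw [show -x - a = -(x + a) by ring, div_neg]
    ring
  rw [e]; ring

end Kacz

namespace Kacz

open MeasureTheory Asymptotics

/-- logarithmic derivative of xi on the reals -/
noncomputable def xiL (x : ℝ) : ℝ := (deriv xi x / xi x).re

lemma deriv_xi_neg (x : ℂ) : deriv xi (-x) = - deriv xi x := by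
  have h : (fun z => xi (-z)) = xi := funext xi_even
  have h1 := deriv_comp_neg xi x
  rw [h] at h1
  rw [h1, neg_neg]

theorem hadamard (hRH : ∀ ρ : ℂ, riemannZeta₁ ρ = 0 → ρ.re ≤ 1 / 2) :
    ∃ (ι : Type) (_ : Countable ι) (γ n : ι → ℝ), (∀ i, 0 ≤ n i) ∧
      ∀ x : ℝ, 0 < x → HasSum (fun i => n i * (x / (x ^ 2 + γ i ^ 2))) (xiL x) := by
  classical
  have hfin : ∀ R : ℝ, {z | xi z = 0 ∧ ‖(0:ℂ) - z‖ ≤ R}.Finite := zeros_finite xi xi_diff 0 xi_zero_ne 0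
  set S : ℕ → Finset ℂ := fun R => (hfin R).toFinset with hSdef
  have hS : ∀ (R : ℕ) (a : ℂ), a ∈ S R ↔ (xi a = 0 ∧ ‖a‖ ≤ R) := by
    intro R a; simp [hSdef]
  set Z : Set ℂ := {z | xi z = 0} with hZ
  have hZc : Z.Countable := zeros_countable xi xi_diff 0 xi_zero_ne
  refine ⟨Z, hZc.to_subtype, fun i => (i : ℂ).im, fun i => (analyticOrderNatAt xi i : ℝ),
    fun i => by positivity, fun x hx => ?_⟩
  set t : ℂ → ℝ := fun a => (analyticOrderNatAt xi a : ℝ) * (x / (x ^ 2 + a.im ^ 2)) with ht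
  have ht0 : ∀ a, 0 ≤ t a := fun a => by simp only [ht]; positivity
  have hxne : xi x ≠ 0 := by
    intro h
    have := xi_zeros hRH _ h
    simp at this
    exact hx.ne' this
  have hlim : Tendsto (fun R : ℕ => ∑ a ∈ S R, t a) atTop (nhds (xiL x)) := by
    have hbound : ∀ᶠ R : ℕ in atTop, ‖(∑ a ∈ S R, t a) - xiL x‖ ≤
        64 * (|MR (2 * R)| + |log ‖xi 0‖| + 1) * x / (R:ℝ) ^ 2 := by
      obtain ⟨R₀, hR₀⟩ := exists_nat_ge (8 * x)
      filter_upwards [eventually_ge_atTop R₀, eventually_gt_atTop 0] with R hR hRpos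
      have hRR : (8 * x) ≤ R := hR₀.trans (by exact_mod_cast hR)
      have hR0 : (0:ℝ) < R := by exact_mod_cast hRpos
      have h1 := logDeriv_approx xi xi_diff xi_zero_ne R (MR (2 * R)) hR0
        (fun z hz => xi_bound _ z hz) (S R) (hS R) x
        (by rw [Complex.norm_real, Real.norm_eq_abs, abs_of_pos hx]; linarith) hxne
        (by rw [xi_even]; exact hxne)
      rw [deriv_xi_neg, xi_even] at h1
      have e : deriv xi x / xi x - -deriv xi x / xi x -
          ∑ a ∈ S R, (analyticOrderNatAt xi a : ℂ) * (1 / (x - a) + 1 / (x + a)) =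
          2 * (deriv xi x / xi x - ((∑ a ∈ S R, t a : ℝ) : ℂ)) := by
        have e2 : ∑ a ∈ S R, (analyticOrderNatAt xi a : ℂ) * (1 / (x - a) + 1 / (x + a)) =
            2 * ((∑ a ∈ S R, t a : ℝ) : ℂ) := by
          push_cast
          rw [Finset.mul_sum]
          apply Finset.sum_congr rfl
          intro a ha
          have hare := xi_zeros hRH a ((hS R a).1 ha).1
          have ea : a = a.im * Complex.I := by
            apply Complex.ext <;> simp [hare]
          have eq : (x:ℂ) ^ 2 + (a.im:ℂ) ^ 2 = (x - a) * (x + a) := by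
            conv_rhs => rw [ea]
            ring_nf
            rw [Complex.I_sq]; ring
          have hne : (x:ℂ) ^ 2 + (a.im:ℂ) ^ 2 ≠ 0 := by
            have : (0:ℝ) < x ^ 2 + a.im ^ 2 := by positivity
            exact_mod_cast this.ne'
          rw [eq] at hne
          have h3 := left_ne_zero_of_mul hne
          have h4 := right_ne_zero_of_mul hne
          simp only [ht]
          push_cast
          rw [eq]
          field_simp
          ring
        rw [e2]; ring
      rw [e, norm_mul, Complex.norm_real, Real.norm_eq_abs x, abs_of_pos hx] at h1
      have h2 : ‖(∑ a ∈ S R, t a) - xiL x‖ ≤ ‖deriv xi x / xi x - ((∑ a ∈ S R, t a : ℝ) : ℂ)‖ := by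
        rw [Real.norm_eq_abs, abs_sub_comm, xiL]
        have := Complex.abs_re_le_norm (deriv xi x / xi x - ((∑ a ∈ S R, t a : ℝ) : ℂ))
        rwa [Complex.sub_re, Complex.ofReal_re] at this
      refine h2.trans ?_
      have h5 : ‖(2:ℂ)‖ = 2 := by norm_num
      rw [h5] at h1
      have e6 : 128 * (|MR (2 * R)| + |log ‖xi 0‖| + 1) * x / (R:ℝ) ^ 2 =
        2 * (64 * (|MR (2 * R)| + |log ‖xi 0‖| + 1) * x / (R:ℝ) ^ 2) := by ring
      rw [e6] at h1
      linarith
    have hz : Tendsto (fun R : ℕ => 64 * (|MR (2 * R)| + |log ‖xi 0‖| + 1) * x / (R:ℝ) ^ 2) atTop (nhds 0) := by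
      have h1 : Tendsto (fun R : ℕ => 2 * (R:ℝ)) atTop atTop :=
        tendsto_natCast_atTop_atTop.const_mul_atTop (by norm_num)
      have h2 := (MR_small.comp h1).abs
      have h3 : Tendsto (fun R : ℕ => ((R:ℝ))⁻¹) atTop (nhds 0) := tendsto_inv_atTop_nhds_zero_nat
      have h4 := ((h2.const_mul 4).add ((h3.mul h3).const_mul (|log ‖xi 0‖| + 1))).const_mul (64 * x)
      simp only [abs_zero, mul_zero, add_zero] at h4
      refine h4.congr fun R => ?_
      simp only [Function.comp]
      rw [abs_div, abs_of_nonneg (by positivity : 0 ≤ (2 * (R:ℝ)) ^ 2)]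
      rcases eq_or_ne (R:ℝ) 0 with h | h
      · simp [h]
      · field_simp
        ring
    have h3 := squeeze_zero_norm' hbound hz
    have := h3.add_const (xiL x)
    simpa using this
  -- pass to the subtype
  set T : ℕ → Finset Z := fun R => (S R).subtype (· ∈ Z) with hT
  have hsumT : ∀ R, ∑ i ∈ T R, t i = ∑ a ∈ S R, t a := by
    intro R
    rw [hT]
    simp only
    rw [Finset.sum_subtype_eq_sum_filter]
    congr 1
    ext a
    simp only [Finset.mem_filter, and_iff_left_iff_imp]
    intro ha
    exact ((hS R a).1 ha).1
  have hTmono : Monotone T := by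
    intro R R' hRR i hi
    rw [hT, Finset.mem_subtype] at hi ⊢
    rw [hS] at hi ⊢
    exact ⟨hi.1, hi.2.trans (by exact_mod_cast hRR)⟩
  have hTtop : Tendsto T atTop atTop := by
    apply tendsto_atTop_finset_of_monotone hTmono
    intro i
    obtain ⟨R, hR⟩ := exists_nat_ge ‖(i:ℂ)‖
    refine ⟨R, ?_⟩
    rw [hT, Finset.mem_subtype, hS]
    exact ⟨i.2, hR⟩
  have hlimT : Tendsto (fun R => ∑ i ∈ T R, t i) atTop (nhds (xiL x)) := by
    simpa only [hsumT] using hlim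
  have hmono : Monotone (fun R => ∑ i ∈ T R, t i) := fun R R' h =>
    Finset.sum_le_sum_of_subset_of_nonneg (hTmono h) (fun i _ _ => ht0 i)
  have hsummable : Summable (fun i : Z => t i) := by
    apply summable_of_sum_le (f := fun i : Z => t i) (c := xiL x) (fun i => ht0 i)
    intro u
    obtain ⟨R, hR⟩ := (hTtop.eventually_ge_atTop u).exists
    exact (Finset.sum_le_sum_of_subset_of_nonneg hR (fun i _ _ => ht0 i)).trans (hmono.ge_of_tendsto hlimT R)
  have h5 := hsummable.hasSum
  have h6 : Tendsto (fun R => ∑ i ∈ T R, t i) atTop (nhds (∑' i : Z, t i)) := h5.comp hTtop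
  rw [tendsto_nhds_unique h6 hlimT] at h5
  exact h5

end Kacz

namespace Kacz

open MeasureTheory Asymptotics

/-- the Dirichlet series of the von Mangoldt function -/
noncomputable def LV (s : ℝ) : ℝ := ∑' k : ℕ, ArithmeticFunction.vonMangoldt k * (k:ℝ) ^ (-s)

lemma LV_term (s : ℝ) (k : ℕ) : LSeries.term (fun n => ((ArithmeticFunction.vonMangoldt n : ℝ) : ℂ)) s k =
    ((ArithmeticFunction.vonMangoldt k * (k:ℝ) ^ (-s) : ℝ) : ℂ) := by
  rw [LSeries.term_def]
  split_ifs with h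
  · simp [h]
  · rw [rpow_neg (by positivity)]
    push_cast
    rw [Complex.ofReal_cpow (by positivity), div_eq_mul_inv]
    simp

lemma LV_summable (s : ℝ) (hs : 1 < s) :
    Summable (fun k : ℕ => ArithmeticFunction.vonMangoldt k * (k:ℝ) ^ (-s)) := by
  have h := ArithmeticFunction.LSeriesSummable_vonMangoldt (s := (s:ℂ)) (by simpa using hs)
  unfold LSeriesSummable at h
  have e : LSeries.term (fun n => ((ArithmeticFunction.vonMangoldt n : ℝ) : ℂ)) s =
    fun k : ℕ => ((ArithmeticFunction.vonMangoldt k * (k:ℝ) ^ (-s) : ℝ) : ℂ) := funext (LV_term s)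
  rw [e] at h
  exact_mod_cast h

lemma LV_eq (s : ℝ) (hs : 1 < s) : deriv riemannZeta₁ s / riemannZeta₁ s = ((1 / (s - 1) - LV s : ℝ) : ℂ) := by
  have h := ArithmeticFunction.LSeries_vonMangoldt_eq_deriv_riemannZeta_div (s := (s:ℂ)) (by simpa using hs)
  have e : LSeries (fun n => ((ArithmeticFunction.vonMangoldt n : ℝ) : ℂ)) s = ((LV s : ℝ) : ℂ) := by
    rw [LSeries, LV, Complex.ofReal_tsum]
    exact tsum_congr (LV_term s)
  rw [e, neg_div, zeta_logDeriv _ (by simpa using hs)] at h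
  push_cast
  rw [h, one_div]; ring

lemma xiL_formula (m : ℕ) : xiL (2 * (m + 1) - 1 / 2) =
    1 / (2 * (m + 1)) - 1 / 2 * log π + 1 / 2 * ((harmonic m : ℝ) - eulerMascheroniConstant)
      + 1 / (2 * (m + 1) - 1) - LV (2 * (m + 1)) := by
  set s : ℝ := 2 * (m + 1) with hs
  have hm : (0:ℝ) ≤ m := by positivity
  have hs1 : 1 < s := by rw [hs]; linarith
  set z₀ : ℂ := ((s - 1 / 2 : ℝ) : ℂ) with hz₀
  have hz : z₀ + 1 / 2 = (s:ℂ) := by rw [hz₀]; push_cast; ring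
  have hev : xi =ᶠ[nhds z₀] fun z => (z + 1 / 2) * ((π:ℂ) ^ (-(z + 1 / 2) / 2) * Complex.Gamma ((z + 1 / 2) / 2)) *
      riemannZeta₁ (z + 1 / 2) := by
    have : {z : ℂ | 0 < z.re} ∈ nhds z₀ :=
      (isOpen_lt continuous_const Complex.continuous_re).mem_nhds (by simp [hz₀]; linarith)
    filter_upwards [this] with z hzz
    have hzz : 0 < z.re := hzz
    have := xi_eq (z + 1 / 2) (by simp; linarith)
    rw [add_sub_cancel_right, Complex.Gammaℝ_def] at this
    exact this
  have hlin : HasDerivAt (fun z : ℂ => z + 1 / 2) 1 z₀ := (hasDerivAt_id z₀).add_const _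
  have hpi : (π:ℂ) ≠ 0 := by exact_mod_cast pi_pos.ne'
  have hpow : HasDerivAt (fun z : ℂ => (π:ℂ) ^ (-(z + 1 / 2) / 2))
      ((π:ℂ) ^ (-(z₀ + 1 / 2) / 2) * Complex.log π * (-1 / 2)) z₀ := by
    have := (hlin.neg.div_const 2).const_cpow (c := (π:ℂ)) (Or.inl hpi)
    exact this
  have hs2 : (s:ℂ) / 2 = m + 1 := by rw [hs]; push_cast; ring
  have hgam : HasDerivAt (fun z : ℂ => Complex.Gamma ((z + 1 / 2) / 2))
      ((m.factorial : ℂ) * (-eulerMascheroniConstant + harmonic m) * (1 / 2)) z₀ := by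
    have h1 := Complex.hasDerivAt_Gamma_nat m
    have e : (z₀ + 1 / 2) / 2 = (m:ℂ) + 1 := by rw [hz, hs2]
    rw [← e] at h1
    exact h1.comp z₀ (hlin.div_const 2)
  have hzet : HasDerivAt (fun z : ℂ => riemannZeta₁ (z + 1 / 2)) (deriv riemannZeta₁ s) z₀ := by
    have h1 := (differentiable_riemannZeta₁ (z₀ + 1 / 2)).hasDerivAt.comp z₀ hlin
    rw [mul_one, hz] at h1
    exact h1
  have hall := (hlin.mul (hpow.mul hgam)).mul hzet
  have hder : deriv xi z₀ = _ := hev.deriv_eq.trans hall.deriv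
  have hval : xi z₀ = _ := hev.eq_of_nhds
  have hzne : riemannZeta₁ s ≠ 0 := zeta1_ne_zero_of_one_lt s (by simpa using hs1)
  have hG : Complex.Gamma ((z₀ + 1 / 2) / 2) = m.factorial := by
    rw [hz, hs2, Complex.Gamma_nat_eq_factorial]
  have hfm : (m.factorial : ℂ) ≠ 0 := by exact_mod_cast m.factorial_ne_zero
  have hs0 : (s:ℂ) ≠ 0 := by exact_mod_cast (by linarith : s ≠ 0)
  have hpp : (π:ℂ) ^ (-(s:ℂ) / 2) ≠ 0 := by
    rw [Complex.cpow_def_of_ne_zero hpi]; exact Complex.exp_ne_zero _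
  have hlogpi : Complex.log π = ((log π : ℝ) : ℂ) := (Complex.ofReal_log pi_pos.le).symm
  have hfinal : deriv xi z₀ / xi z₀ = ((1 / s - 1 / 2 * log π + 1 / 2 * ((harmonic m : ℝ) - eulerMascheroniConstant)
      + (1 / (s - 1) - LV s) : ℝ) : ℂ) := by
    have hz1 := LV_eq s hs1
    rw [div_eq_iff hzne] at hz1
    rw [hder, hval]
    simp only [Pi.mul_apply]
    rw [hG, hz, hz1, hlogpi]
    have hsub : (s:ℂ) - 1 ≠ 0 := by
      have : s - 1 ≠ 0 := by linarith
      exact_mod_cast this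
    push_cast
    field_simp
    ring
  rw [xiL, hfinal, Complex.ofReal_re]
  ring

lemma xiL_unbounded (K : ℝ) : ∃ x : ℝ, 1 ≤ x ∧ K < xiL x := by
  have hLV : ∀ m : ℕ, LV (2 * (m + 1)) ≤ LV 2 := by
    intro m
    have hm : (0:ℝ) ≤ m := by positivity
    apply (LV_summable _ (by linarith)).tsum_le_tsum _ (LV_summable 2 (by norm_num))
    intro k
    rcases Nat.eq_zero_or_pos k with rfl | hk
    · simp
    · apply mul_le_mul_of_nonneg_left _ ArithmeticFunction.vonMangoldt_nonneg
      apply rpow_le_rpow_of_exponent_le (by exact_mod_cast hk)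
      linarith
  obtain ⟨m, hm⟩ : ∃ m : ℕ, 2 * (K + 1 / 2 * log π + 1 / 2 * eulerMascheroniConstant + LV 2) < log (m + 1) := by
    have h1 : Tendsto (fun m : ℕ => log ((m:ℝ) + 1)) atTop atTop :=
      tendsto_log_atTop.comp (tendsto_atTop_add_const_right _ 1 tendsto_natCast_atTop_atTop)
    exact (h1.eventually_gt_atTop _).exists
  have hm0 : (0:ℝ) ≤ m := by positivity
  refine ⟨2 * (m + 1) - 1 / 2, by linarith, ?_⟩
  rw [xiL_formula]
  have h2 := log_add_one_le_harmonic m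
  have h2 : log (m + 1) ≤ (harmonic m : ℝ) := by exact_mod_cast h2
  have h3 := hLV m
  have h4 : 0 < 1 / (2 * ((m:ℝ) + 1)) := by positivity
  have h5 : 0 < 1 / (2 * ((m:ℝ) + 1) - 1) := by
    apply one_div_pos.2; linarith
  linarith

end Kacz

namespace Kacz
open MeasureTheory Asymptotics

/-- Uniqueness of Laplace moments. -/
lemma moment_unique (h : ℝ → ℝ) (hc : Continuous h) (C : ℝ)
    (hb : ∀ u, 0 ≤ u → |h u| ≤ C * exp (2*u))
    (hm : ∀ k : ℕ, ∫ u in Ioi (0:ℝ), h u * exp (-(2*(k+2))*u) = 0) :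
    ∀ u, 0 ≤ u → h u = 0 := by
  have hC : 0 ≤ C := by
    have := hb 0 le_rfl
    simp at this
    exact (abs_nonneg _).trans this
  set φ : ℝ → ℝ := fun x => h (-log x/2) * x^(3/2:ℝ) with hφ
  have hφb : ∀ x ∈ Icc (0:ℝ) 1, |φ x| ≤ C * x^(1/2:ℝ) := by
    intro x hx
    rcases hx.1.eq_or_lt with h0 | h0
    · rw [hφ]; simp only [← h0]
      rw [Real.zero_rpow (by norm_num), Real.zero_rpow (by norm_num)]; simp
    · have hl : 0 ≤ -log x/2 := by
        have := Real.log_nonpos hx.1 hx.2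
        linarith
      have h1 := hb _ hl
      rw [hφ]; simp only
      rw [abs_mul, abs_of_nonneg (Real.rpow_nonneg hx.1 _)]
      have e1 : exp (2*(-log x/2)) = x^(-1:ℝ) := by
        rw [Real.rpow_def_of_pos h0]; ring_nf
      rw [e1] at h1
      calc |h (-log x/2)| * x^(3/2:ℝ) ≤ (C * x^(-1:ℝ)) * x^(3/2:ℝ) := by gcongr
        _ = C * x^(1/2:ℝ) := by
          rw [mul_assoc, ← Real.rpow_add h0]; norm_num
  have hφc : ContinuousOn φ (Icc 0 1) := by
    intro x hx
    rcases hx.1.eq_or_lt with h0 | h0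
    · subst h0
      have e0 : φ 0 = 0 := by
        rw [hφ]; simp only; rw [Real.zero_rpow (by norm_num)]; simp
      rw [ContinuousWithinAt, e0]
      apply squeeze_zero_norm' (a := fun x => C * x^(1/2:ℝ))
      · filter_upwards [self_mem_nhdsWithin] with x hx
        exact hφb x hx
      · have : ContinuousAt (fun x:ℝ => C * x^(1/2:ℝ)) 0 := by
          apply ContinuousAt.mul continuousAt_const
          exact Real.continuousAt_rpow_const _ _ (Or.inr (by norm_num))
        have h2 := this.tendsto
        rw [Real.zero_rpow (by norm_num), mul_zero] at h2
        exact h2.mono_left nhdsWithin_le_nhds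
    · apply ContinuousAt.continuousWithinAt
      apply ContinuousAt.mul
      · apply hc.continuousAt.comp
        exact (Real.continuousAt_log h0.ne').neg.div_const 2
      · exact Real.continuousAt_rpow_const _ _ (Or.inl h0.ne')
  have hφe : ∀ u, φ (exp (-2*u)) = h u * exp (-3*u) := by
    intro u
    rw [hφ]; simp only
    rw [Real.log_exp, ← Real.exp_mul]
    congr 2 <;> ring
  -- integrability
  have hIntg : ∀ k : ℕ, IntegrableOn (fun u => h u * exp (-(2*(k+2))*u)) (Ioi 0) := by
    intro k
    apply integrableOn_of_exp_bound _ 0 2 C (by norm_num)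
    · have : Continuous (fun u => h u * exp (-(2*(k+2))*u)) := by fun_prop
      exact this.aestronglyMeasurable
    · intro u hu
      have hu : (0:ℝ) < u := hu
      rw [abs_mul, abs_of_pos (exp_pos _)]
      calc |h u| * exp (-(2*(k+2))*u) ≤ (C*exp (2*u)) * exp (-(2*(k+2))*u) := by
            gcongr; exact hb u hu.le
        _ = C * exp (2*u + -(2*(k+2))*u) := by rw [exp_add]; ring
        _ ≤ C * exp (-2*u) := by
          gcongr
          have : (0:ℝ) ≤ k*u := by positivity
          nlinarith
  have hpoly : ∀ p : Polynomial ℝ,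
      IntegrableOn (fun u => h u * exp (-4*u) * p.eval (exp (-2*u))) (Ioi 0) ∧
      ∫ u in Ioi (0:ℝ), h u * exp (-4*u) * p.eval (exp (-2*u)) = 0 := by
    intro p
    have e : (fun u => h u * exp (-4*u) * p.eval (exp (-2*u))) =
        fun u => ∑ k ∈ Finset.range (p.natDegree+1), p.coeff k * (h u * exp (-(2*(k+2))*u)) := by
      funext u
      rw [Polynomial.eval_eq_sum_range, Finset.mul_sum]
      apply Finset.sum_congr rfl
      intro k _
      rw [← Real.exp_nat_mul]
      have : exp (-(2*(k+2))*u) = exp (-4*u) * exp (k * (-2*u)) := by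
        rw [← exp_add]; ring_nf
      rw [this]; ring
    rw [e]
    constructor
    · apply integrable_finsetSum
      intro k _
      exact (hIntg k).const_mul _
    · rw [integral_finsetSum]
      · apply Finset.sum_eq_zero
        intro k _
        rw [integral_const_mul, hm k, mul_zero]
      · intro k _
        exact (hIntg k).const_mul _
  -- square integral
  set q : ℝ → ℝ := fun u => h u * exp (-4*u) * (h u * exp (-3*u)) with hq
  have hqi : IntegrableOn q (Ioi 0) := by
    apply integrableOn_of_exp_bound _ 0 3 (C*C) (by norm_num)
    · have : Continuous q := by rw [hq]; fun_prop
      exact this.aestronglyMeasurable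
    · intro u hu
      have hu : (0:ℝ) < u := hu
      rw [hq]; simp only
      rw [abs_mul, abs_mul, abs_mul, abs_of_pos (exp_pos _), abs_of_pos (exp_pos _)]
      have h1 := hb u hu.le
      calc |h u| * exp (-4*u) * (|h u| * exp (-3*u))
          ≤ (C*exp (2*u)) * exp (-4*u) * ((C*exp (2*u)) * exp (-3*u)) := by gcongr
        _ = C*C*(exp (2*u) * exp (-4*u) * exp (2*u) * exp (-3*u)) := by ring
        _ = C*C*exp (-3*u) := by
          rw [← exp_add, ← exp_add, ← exp_add]; ring_nf
  have hq0 : ∫ u in Ioi (0:ℝ), q u = 0 := by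
    have hle : ∀ ε > 0, |∫ u in Ioi (0:ℝ), q u| ≤ ε * (∫ u in Ioi (0:ℝ), C * exp (-2*u)) := by
      intro ε hε
      obtain ⟨p, hp⟩ := exists_polynomial_near_of_continuousOn 0 1 φ hφc ε hε
      have e : ∫ u in Ioi (0:ℝ), q u = ∫ u in Ioi (0:ℝ),
          (q u - h u * exp (-4*u) * p.eval (exp (-2*u))) := by
        rw [integral_sub hqi (hpoly p).1, (hpoly p).2, sub_zero]
      rw [e, ← integral_const_mul, ← Real.norm_eq_abs]
      apply norm_integral_le_of_norm_le
      · exact ((integrableOn_exp_mul_Ioi (by norm_num : (-2:ℝ)<0) 0).const_mul C).const_mul ε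
      · filter_upwards [ae_restrict_mem measurableSet_Ioi] with u hu
        have hu : (0:ℝ) < u := hu
        have h1 := hb u hu.le
        have h2 := hp (exp (-2*u)) ⟨(exp_pos _).le, exp_le_one_iff.2 (by linarith)⟩
        rw [hφe] at h2
        rw [hq]; simp only
        rw [← mul_sub, Real.norm_eq_abs, abs_mul, abs_mul, abs_of_pos (exp_pos _), abs_sub_comm (h u * _)]
        calc |h u| * exp (-4*u) * |p.eval (exp (-2*u)) - h u * exp (-3*u)|
            ≤ (C*exp (2*u)) * exp (-4*u) * ε := by gcongr
          _ = ε * (C * (exp (2*u) * exp (-4*u))) := by ring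
          _ = ε * (C * exp (-2*u)) := by rw [← exp_add]; ring_nf
    by_contra hne
    have hpos : 0 < |∫ u in Ioi (0:ℝ), q u| := abs_pos.2 hne
    set A := |∫ u in Ioi (0:ℝ), q u|
    set D := ∫ u in Ioi (0:ℝ), C * exp (-2*u)
    have hD : 0 ≤ D := integral_nonneg (fun u => by positivity)
    have := hle (A/(2*(D+1))) (by positivity)
    have h3 : A/(2*(D+1)) * D ≤ A/2 := by
      rw [div_mul_eq_mul_div, div_le_div_iff₀ (by positivity) (by norm_num)]
      nlinarith
    linarith
  have hqnn : ∀ u, 0 ≤ q u := by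
    intro u
    have : q u = (h u)^2 * (exp (-4*u) * exp (-3*u)) := by rw [hq]; ring
    rw [this]; positivity
  have hae := (setIntegral_eq_zero_iff_of_nonneg_ae (Eventually.of_forall hqnn) hqi).1 hq0
  have heq : EqOn q 0 (Ioi 0) := by
    apply Measure.eqOn_open_of_ae_eq hae isOpen_Ioi
    · exact Continuous.continuousOn (by rw [hq]; fun_prop)
    · exact continuousOn_const
  have hpos : EqOn h 0 (Ioi 0) := by
    intro u hu
    have h1 := heq hu
    have : q u = (h u)^2 * (exp (-4*u) * exp (-3*u)) := by rw [hq]; ring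
    rw [this] at h1
    have h2 : exp (-4*u) * exp (-3*u) ≠ 0 := by positivity
    simpa [h2] using h1
  have hcl : EqOn h 0 (closure (Ioi 0)) := hpos.closure hc continuous_const
  intro u hu
  rw [closure_Ioi] at hcl
  exact hcl hu

end Kacz

namespace Kacz
open MeasureTheory Asymptotics

noncomputable def Ef (v : ℝ) : ℝ := Chebyshev.psi (exp v) - exp v

noncomputable def Psi1 (u : ℝ) : ℝ := ∫ v in (0:ℝ)..u, Ef v

lemma psi_exp_mono : Monotone (fun v => Chebyshev.psi (exp v)) :=
  fun _ _ h => Chebyshev.psi_mono (exp_le_exp.2 h)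

lemma Ef_int (a b : ℝ) : IntervalIntegrable Ef volume a b :=
  psi_exp_mono.intervalIntegrable.sub (continuous_exp.intervalIntegrable a b)

lemma Ef_meas : Measurable Ef := psi_exp_mono.measurable.sub measurable_exp

lemma Ef_bound (v : ℝ) : |Ef v| ≤ 7 * exp v := by
  have h1 := Chebyshev.psi_le_const_mul_self (exp_pos v).le
  have h2 := Chebyshev.psi_nonneg (exp v)
  have h3 : log 4 ≤ 2 := by
    have : (4:ℝ) = 2^2 := by norm_num
    rw [this, log_pow]
    have := Real.log_two_lt_d9
    push_cast; linarith
  have := exp_pos v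
  unfold Ef
  rw [abs_le]; constructor <;> nlinarith

lemma Psi1_cont : Continuous Psi1 :=
  intervalIntegral.continuous_primitive Ef_int 0

lemma Psi1_bound (u : ℝ) (hu : 0 ≤ u) : |Psi1 u| ≤ 7 * exp u := by
  have h1 : ‖∫ v in (0:ℝ)..u, Ef v‖ ≤ ∫ v in (0:ℝ)..u, 7 * exp v := by
    apply intervalIntegral.norm_integral_le_of_norm_le hu
    · exact Eventually.of_forall fun t _ => Ef_bound t
    · exact Continuous.intervalIntegrable (by fun_prop) _ _
  rw [intervalIntegral.integral_const_mul, integral_exp] at h1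
  unfold Psi1
  rw [Real.norm_eq_abs] at h1
  have : exp 0 = 1 := exp_zero
  linarith

lemma Ef_rightcont (u : ℝ) : ContinuousWithinAt Ef (Ici u) u := by
  apply ContinuousWithinAt.sub _ continuous_exp.continuousWithinAt
  have h1 : ∀ᶠ v in nhdsWithin u (Ici u), Chebyshev.psi (exp v) = Chebyshev.psi (exp u) := by
    have h2 : ∀ᶠ v in nhdsWithin u (Ici u), exp v < (⌊exp u⌋₊:ℝ) + 1 := by
      have := (continuous_exp.tendsto u).eventually_lt_const (Nat.lt_floor_add_one (exp u))
      exact this.filter_mono nhdsWithin_le_nhds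
    filter_upwards [h2, self_mem_nhdsWithin] with v hv hv2
    have hv2 : u ≤ v := hv2
    rw [Chebyshev.psi_eq_psi_coe_floor (exp v), Chebyshev.psi_eq_psi_coe_floor (exp u)]
    congr 2
    rw [Nat.floor_eq_iff (exp_pos v).le]
    exact ⟨(Nat.floor_le (exp_pos u).le).trans (exp_le_exp.2 hv2), hv⟩
  exact (tendsto_const_nhds.congr' (h1.mono fun v hv => hv.symm))

lemma Psi1_rightderiv (u : ℝ) : HasDerivWithinAt Psi1 (Ef u) (Ioi u) u := by
  have h := intervalIntegral.integral_hasDerivWithinAt_right (a := 0) (b := u) (s := Ici u)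
    (t := Ioi u) (Ef_int 0 u)
    (Ef_meas.stronglyMeasurable.stronglyMeasurableAtFilter)
    ((Ef_rightcont u).mono Ioi_subset_Ici_self)
  exact h.mono Ioi_subset_Ici_self

lemma LV_laplace (s : ℝ) (hs : 1 < s) :
    ∫ u in Ioi (0:ℝ), Chebyshev.psi (exp u) * exp (-s*u) = LV s / s := by
  have hs0 : 0 < s := by linarith
  have h1 := laplace_sum (fun n => ArithmeticFunction.vonMangoldt n) s 1 hs0
    (by
      have := LV_summable s hs
      refine this.congr fun k => ?_
      rw [abs_of_nonneg ArithmeticFunction.vonMangoldt_nonneg])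
    (fun u => exp (-s*u)) (by fun_prop)
    (by intro u _; rw [abs_of_pos (exp_pos _), one_mul])
  have h2 : HasSum (fun n : ℕ => ArithmeticFunction.vonMangoldt n * (n:ℝ)^(-s) / s) (LV s / s) :=
    (LV_summable s hs).hasSum.div_const s
  have e : ∀ u, Chebyshev.psi (exp u) = ∑ n ∈ Finset.Icc 1 ⌊exp u⌋₊, ArithmeticFunction.vonMangoldt n := by
    intro u; rfl
  simp_rw [e]
  refine h1.unique ?_
  have e2 : (fun n : ℕ => (if n = 0 then 0 else ArithmeticFunction.vonMangoldt n *
      ∫ u in Ioi (log n), exp (-s*u))) =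
      fun n : ℕ => ArithmeticFunction.vonMangoldt n * (n:ℝ)^(-s) / s := by
    funext n
    split_ifs with hn
    · simp [hn]
    · have hn0 : (0:ℝ) < n := by exact_mod_cast Nat.pos_of_ne_zero hn
      rw [integral_exp_Ioi _ _ hs0, Real.rpow_def_of_pos hn0, mul_div_assoc]
      congr 3; ring
  rw [e2]
  exact h2

lemma Ef_laplace (s : ℝ) (hs : 1 < s) :
    ∫ u in Ioi (0:ℝ), Ef u * exp (-s*u) = LV s / s - 1/(s-1) := by
  have hI1 : IntegrableOn (fun u => Chebyshev.psi (exp u) * exp (-s*u)) (Ioi 0) := by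
    apply integrableOn_of_exp_bound _ 0 (s-1) 7 (by linarith)
    · exact (psi_exp_mono.measurable.mul (by fun_prop : Measurable fun u:ℝ => exp (-s*u))).aestronglyMeasurable
    · intro u hu
      have h1 := Chebyshev.psi_le_const_mul_self (exp_pos u).le
      have h2 := Chebyshev.psi_nonneg (exp u)
      have h3 := abs_le.1 (Ef_bound u)
      rw [abs_mul, abs_of_pos (exp_pos _), abs_of_nonneg h2]
      have h4 : Chebyshev.psi (exp u) ≤ 7 * exp u := by
        have h3 : log 4 ≤ 2 := by
          have : (4:ℝ) = 2^2 := by norm_num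
          rw [this, log_pow]
          have := Real.log_two_lt_d9
          push_cast; linarith
        have := exp_pos u
        nlinarith
      calc Chebyshev.psi (exp u) * exp (-s*u) ≤ 7 * exp u * exp (-s*u) := by gcongr
        _ = 7 * exp (-(s-1)*u) := by rw [mul_assoc, ← exp_add]; ring_nf
  have hI2 : IntegrableOn (fun u => exp (-(s-1)*u)) (Ioi 0) :=
    integrableOn_exp_mul_Ioi (by linarith) 0
  have e : ∀ u, Ef u * exp (-s*u) = Chebyshev.psi (exp u) * exp (-s*u) - exp (-(s-1)*u) := by
    intro u
    have : exp (-(s-1)*u) = exp u * exp (-s*u) := by rw [← exp_add]; ring_nf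
    rw [this]; unfold Ef; ring
  simp_rw [e]
  rw [integral_sub hI1 hI2, LV_laplace s hs, integral_exp_Ioi _ _ (by linarith)]
  simp

lemma Psi1_laplace (s : ℝ) (hs : 1 < s) :
    IntegrableOn (fun u => Psi1 u * exp (-s*u)) (Ioi 0) ∧
    ∫ u in Ioi (0:ℝ), Psi1 u * exp (-s*u) = LV s / s^2 - 1/(s*(s-1)) := by
  have hs0 : 0 < s := by linarith
  have hI1 : IntegrableOn (fun u => Ef u * exp (-s*u)) (Ioi 0) := by
    apply integrableOn_of_exp_bound _ 0 (s-1) 7 (by linarith)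
    · exact (Ef_meas.mul (by fun_prop : Measurable fun u:ℝ => exp (-s*u))).aestronglyMeasurable
    · intro u hu
      rw [abs_mul, abs_of_pos (exp_pos _)]
      calc |Ef u| * exp (-s*u) ≤ 7 * exp u * exp (-s*u) := by gcongr; exact Ef_bound u
        _ = 7 * exp (-(s-1)*u) := by rw [mul_assoc, ← exp_add]; ring_nf
  have hbd : ∀ u, 0 ≤ u → |Psi1 u * exp (-s*u)| ≤ 7 * exp (-(s-1)*u) := by
    intro u hu
    rw [abs_mul, abs_of_pos (exp_pos _)]
    calc |Psi1 u| * exp (-s*u) ≤ 7 * exp u * exp (-s*u) := by gcongr; exact Psi1_bound u hu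
      _ = 7 * exp (-(s-1)*u) := by rw [mul_assoc, ← exp_add]; ring_nf
  have hI2 : IntegrableOn (fun u => Psi1 u * exp (-s*u)) (Ioi 0) := by
    apply integrableOn_of_exp_bound _ 0 (s-1) 7 (by linarith)
    · exact (Psi1_cont.mul (by fun_prop : Continuous fun u:ℝ => exp (-s*u))).aestronglyMeasurable
    · intro u hu; exact hbd u hu.le
  refine ⟨hI2, ?_⟩
  set D : ℝ → ℝ := fun u => Ef u * exp (-s*u) - s * (Psi1 u * exp (-s*u)) with hD
  have hDI : IntegrableOn D (Ioi 0) := hI1.sub (hI2.const_mul s)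
  have hFTC : ∀ R, 0 ≤ R → ∫ u in (0:ℝ)..R, D u = Psi1 R * exp (-s*R) := by
    intro R hR
    have h := intervalIntegral.integral_eq_sub_of_hasDeriv_right
      (f := fun u => Psi1 u * exp (-s*u)) (f' := D) (a := 0) (b := R)
      (Psi1_cont.mul (by fun_prop : Continuous fun u:ℝ => exp (-s*u))).continuousOn
      (by
        intro u _
        have h1 := Psi1_rightderiv u
        have h2 : HasDerivAt (fun u:ℝ => exp (-s*u)) (exp (-s*u) * (-s*1)) u :=
          ((hasDerivAt_id u).const_mul (-s)).exp
        refine (h1.mul h2.hasDerivWithinAt).congr_deriv ?_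
        rw [hD]; ring)
      (by
        rw [intervalIntegrable_iff_integrableOn_Ioc_of_le hR]
        exact hDI.mono_set Ioc_subset_Ioi_self)
    rw [h]
    simp [Psi1]
  have hlim1 : Tendsto (fun R => ∫ u in (0:ℝ)..R, D u) atTop (nhds (∫ u in Ioi 0, D u)) :=
    intervalIntegral_tendsto_integral_Ioi 0 hDI tendsto_id
  have hlim2 : Tendsto (fun R => ∫ u in (0:ℝ)..R, D u) atTop (nhds 0) := by
    have h3 : Tendsto (fun R => Psi1 R * exp (-s*R)) atTop (nhds 0) := by
      apply squeeze_zero_norm' (a := fun R => 7 * exp (-(s-1)*R))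
      · filter_upwards [eventually_ge_atTop 0] with R hR
        exact hbd R hR
      · have : Tendsto (fun R:ℝ => -(s-1)*R) atTop atBot :=
          tendsto_id.const_mul_atTop_of_neg (by linarith)
        have := (Real.tendsto_exp_atBot.comp this).const_mul 7
        simpa using this
    refine h3.congr' ?_
    filter_upwards [eventually_ge_atTop 0] with R hR
    exact (hFTC R hR).symm
  have h0 := tendsto_nhds_unique hlim1 hlim2
  rw [hD, integral_sub hI1 (hI2.const_mul s), integral_const_mul, Ef_laplace s hs] at h0
  have hs1 : s - 1 ≠ 0 := by linarith
  have : ∫ u in Ioi (0:ℝ), Psi1 u * exp (-s*u) = (LV s / s - 1/(s-1))/s := by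
    rw [eq_div_iff hs0.ne']; linarith
  rw [this]
  field_simp

end Kacz

namespace Kacz
open MeasureTheory Asymptotics

lemma exp_mul_cos_int (x g : ℝ) (hx : 0 < x) :
    IntegrableOn (fun u => cos (g*u) * exp (-x*u)) (Ioi 0) := by
  apply integrableOn_of_exp_bound _ 0 x 1 hx
  · exact (by fun_prop : Continuous fun u:ℝ => cos (g*u) * exp (-x*u)).aestronglyMeasurable
  · intro u _
    rw [abs_mul, abs_of_pos (exp_pos _)]
    have := Real.abs_cos_le_one (g*u)
    gcongr

lemma exp_mul_sin_int (x g : ℝ) (hx : 0 < x) :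
    IntegrableOn (fun u => sin (g*u) * exp (-x*u)) (Ioi 0) := by
  apply integrableOn_of_exp_bound _ 0 x 1 hx
  · exact (by fun_prop : Continuous fun u:ℝ => sin (g*u) * exp (-x*u)).aestronglyMeasurable
  · intro u _
    rw [abs_mul, abs_of_pos (exp_pos _)]
    have := Real.abs_sin_le_one (g*u)
    gcongr

lemma exp_lim (x : ℝ) (hx : 0 < x) (f : ℝ → ℝ) (C : ℝ) (hf : ∀ u, |f u| ≤ C) :
    Tendsto (fun u => f u * exp (-x*u)) atTop (nhds 0) := by
  apply squeeze_zero_norm (a := fun R => C * exp (-x*R))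
  · intro R
    rw [Real.norm_eq_abs, abs_mul, abs_of_pos (exp_pos _)]
    gcongr; exact hf R
  · have : Tendsto (fun R:ℝ => -x*R) atTop atBot :=
      tendsto_id.const_mul_atTop_of_neg (by linarith)
    have := (Real.tendsto_exp_atBot.comp this).const_mul C
    simpa using this

lemma cosLap (x g : ℝ) (hx : 0 < x) :
    ∫ u in Ioi (0:ℝ), cos (g*u) * exp (-x*u) = x/(x^2+g^2) := by
  have hq : x^2+g^2 ≠ 0 := by positivity
  have h := integral_Ioi_of_hasDerivAt_of_tendsto' (a := 0) (m := 0)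
    (f := fun u => ((g * sin (g*u) - x * cos (g*u))/(x^2+g^2)) * exp (-x*u))
    (f' := fun u => cos (g*u) * exp (-x*u))
    (by
      intro u _
      have h1 : HasDerivAt (fun u:ℝ => g*u) (g*1) u := (hasDerivAt_id u).const_mul g
      have h2 : HasDerivAt (fun u:ℝ => exp (-x*u)) (exp (-x*u) * (-x*1)) u :=
          ((hasDerivAt_id u).const_mul (-x)).exp
      refine ((((h1.sin.const_mul g).sub (h1.cos.const_mul x)).div_const _).mul h2).congr_deriv ?_
      field_simp
      simp only [Pi.sub_apply]
      ring)
    (exp_mul_cos_int x g hx)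
    (by
      apply exp_lim x hx _ ((|g|+x)/(x^2+g^2))
      intro u
      rw [abs_div, abs_of_pos (by positivity : 0 < x^2+g^2)]
      gcongr
      refine (abs_sub _ _).trans ?_
      rw [abs_mul, abs_mul, abs_of_pos hx]
      have h1 := Real.abs_cos_le_one (g*u)
      have h2 := Real.abs_sin_le_one (g*u)
      have := abs_nonneg g
      nlinarith)
  rw [h]; simp; ring

lemma sinLap (x g : ℝ) (hx : 0 < x) :
    ∫ u in Ioi (0:ℝ), sin (g*u) * exp (-x*u) = g/(x^2+g^2) := by
  have hq : x^2+g^2 ≠ 0 := by positivity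
  have h := integral_Ioi_of_hasDerivAt_of_tendsto' (a := 0) (m := 0)
    (f := fun u => ((-g * cos (g*u) - x * sin (g*u))/(x^2+g^2)) * exp (-x*u))
    (f' := fun u => sin (g*u) * exp (-x*u))
    (by
      intro u _
      have h1 : HasDerivAt (fun u:ℝ => g*u) (g*1) u := (hasDerivAt_id u).const_mul g
      have h2 : HasDerivAt (fun u:ℝ => exp (-x*u)) (exp (-x*u) * (-x*1)) u :=
          ((hasDerivAt_id u).const_mul (-x)).exp
      refine ((((h1.cos.const_mul (-g)).sub (h1.sin.const_mul x)).div_const _).mul h2).congr_deriv ?_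
      field_simp
      simp only [Pi.sub_apply]
      ring)
    (exp_mul_sin_int x g hx)
    (by
      apply exp_lim x hx _ ((|g|+x)/(x^2+g^2))
      intro u
      rw [abs_div, abs_of_pos (by positivity : 0 < x^2+g^2)]
      gcongr
      refine (abs_sub _ _).trans ?_
      rw [abs_mul, abs_mul, abs_of_pos hx, abs_neg]
      have h1 := Real.abs_cos_le_one (g*u)
      have h2 := Real.abs_sin_le_one (g*u)
      have := abs_nonneg g
      nlinarith)
  rw [h]; simp; ring

/-- `Re (e^{iγu}/ρ²)`, where `ρ = 1/2 + iγ`. -/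
noncomputable def wf (g u : ℝ) : ℝ := ((1/4-g^2)*cos (g*u) + g*sin (g*u))/(1/4+g^2)^2

lemma wf_cont (g : ℝ) : Continuous (wf g) := by unfold wf; fun_prop

lemma wf_bound (g u : ℝ) : |wf g u| ≤ 1/(1/4+g^2) := by
  have hq : 0 < 1/4+g^2 := by positivity
  unfold wf
  rw [abs_div, abs_of_pos (by positivity : 0 < (1/4+g^2)^2), div_le_div_iff₀ (by positivity) hq]
  have : |(1/4-g^2)*cos (g*u) + g*sin (g*u)| ≤ 1/4+g^2 := by
    apply abs_le_of_sq_le_sq _ hq.le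
    have h := Real.sin_sq_add_cos_sq (g*u)
    nlinarith [sq_nonneg ((1/4-g^2)*sin (g*u) - g*cos (g*u))]
  nlinarith

lemma wf_laplace (x g : ℝ) (hx : 0 < x) :
    IntegrableOn (fun u => wf g u * exp (-x*u)) (Ioi 0) ∧
    ∫ u in Ioi (0:ℝ), wf g u * exp (-x*u) = ((1/4-g^2)*x+g^2)/((1/4+g^2)^2*(x^2+g^2)) := by
  have h1 := (exp_mul_cos_int x g hx).const_mul ((1/4-g^2)/(1/4+g^2)^2)
  have h2 := (exp_mul_sin_int x g hx).const_mul (g/(1/4+g^2)^2)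
  have e : (fun u => wf g u * exp (-x*u)) = fun u => ((1/4-g^2)/(1/4+g^2)^2) * (cos (g*u) * exp (-x*u))
      + (g/(1/4+g^2)^2) * (sin (g*u) * exp (-x*u)) := by
    funext u; unfold wf; ring
  rw [e]
  refine ⟨h1.add h2, ?_⟩
  rw [integral_add h1 h2, integral_const_mul, integral_const_mul, cosLap x g hx, sinLap x g hx]
  have : 1/4+g^2 ≠ 0 := by positivity
  have : x^2+g^2 ≠ 0 := by positivity
  field_simp

noncomputable def Wc {ι : Type} (γ n : ι → ℝ) (u : ℝ) : ℝ := ∑' i, n i * wf (γ i) u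

lemma Wc_cont {ι : Type} (γ n : ι → ℝ) (hn : ∀ i, 0 ≤ n i) (hS : Summable fun i => n i / (1/4+γ i^2)) :
    Continuous (Wc γ n) := by
  apply continuous_tsum (fun i => continuous_const.mul (wf_cont (γ i))) hS
  intro i u
  show ‖n i * wf (γ i) u‖ ≤ _
  rw [Real.norm_eq_abs, abs_mul, abs_of_nonneg (hn i), div_eq_mul_one_div]
  exact mul_le_mul_of_nonneg_left (wf_bound _ _) (hn i)

lemma Wc_summable {ι : Type} (γ n : ι → ℝ) (hn : ∀ i, 0 ≤ n i) (hS : Summable fun i => n i / (1/4+γ i^2)) (u : ℝ) :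
    Summable (fun i => n i * wf (γ i) u) := by
  apply Summable.of_norm_bounded hS
  intro i
  rw [Real.norm_eq_abs, abs_mul, abs_of_nonneg (hn i), div_eq_mul_one_div]
  exact mul_le_mul_of_nonneg_left (wf_bound _ _) (hn i)

lemma Wc_bound {ι : Type} (γ n : ι → ℝ) (hn : ∀ i, 0 ≤ n i) (hS : Summable fun i => n i / (1/4+γ i^2)) (u : ℝ) :
    |Wc γ n u| ≤ ∑' i, n i / (1/4+γ i^2) := by
  rw [← Real.norm_eq_abs]
  apply tsum_of_norm_bounded hS.hasSum
  intro i
  rw [Real.norm_eq_abs, abs_mul, abs_of_nonneg (hn i), div_eq_mul_one_div]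
  exact mul_le_mul_of_nonneg_left (wf_bound _ _) (hn i)

lemma Wc_laplace {ι : Type} [Countable ι] (γ n : ι → ℝ) (hn : ∀ i, 0 ≤ n i) (hS : Summable fun i => n i / (1/4+γ i^2))
    (x : ℝ) (hx : 0 < x) :
    HasSum (fun i => n i * (((1/4-γ i^2)*x+γ i^2)/((1/4+γ i^2)^2*(x^2+γ i^2))))
      (∫ u in Ioi (0:ℝ), Wc γ n u * exp (-x*u)) := by
  have hI : ∀ i, IntegrableOn (fun u => n i * wf (γ i) u * exp (-x*u)) (Ioi 0) := by
    intro i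
    simp_rw [mul_assoc]
    exact (wf_laplace x (γ i) hx).1.const_mul _
  have h := hasSum_integral_of_summable_integral_norm
    (F := fun i u => n i * wf (γ i) u * exp (-x*u)) (μ := volume.restrict (Ioi 0)) hI
    (by
      have hS2 : Summable fun i => n i / (1/4+γ i^2) * (∫ u in Ioi (0:ℝ), exp (-x*u)) := hS.mul_right _
      apply Summable.of_nonneg_of_le _ _ hS2
      · intro i; exact integral_nonneg fun u => norm_nonneg _
      · intro i
        rw [← integral_const_mul]
        apply integral_mono (hI i).norm ((integrableOn_exp_mul_Ioi (by linarith) 0).const_mul _)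
        intro u
        simp only
        rw [Real.norm_eq_abs, abs_mul, abs_mul, abs_of_nonneg (hn i), abs_of_pos (exp_pos _), div_eq_mul_one_div (n i)]
        have := wf_bound (γ i) u
        have := hn i
        gcongr)
  have e1 : ∀ i, ∫ u in Ioi (0:ℝ), n i * wf (γ i) u * exp (-x*u) =
      n i * (((1/4-γ i^2)*x+γ i^2)/((1/4+γ i^2)^2*(x^2+γ i^2))) := by
    intro i
    simp_rw [mul_assoc (n i)]
    rw [integral_const_mul, (wf_laplace x (γ i) hx).2]
  have e2 : ∀ u, ∑' i, n i * wf (γ i) u * exp (-x*u) = Wc γ n u * exp (-x*u) := by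
    intro u
    rw [tsum_mul_right]; rfl
  simp_rw [e1, e2] at h
  exact h

end Kacz

namespace Kacz
open MeasureTheory Asymptotics

noncomputable def Jf (u : ℝ) : ℝ := ∑' j : ℕ, (1 - exp (-(2*(j+1))*|u|))/(4*((j:ℝ)+1)^2)

lemma Jsum : Summable (fun j : ℕ => 1/(4*((j:ℝ)+1)^2)) := by
  have h := (summable_nat_add_iff 1).2 (Real.summable_one_div_nat_pow.2 (by norm_num : 1 < 2))
  refine (h.mul_left (1/4)).congr fun j => ?_
  push_cast
  field_simp

lemma Jterm_bound (j : ℕ) (u : ℝ) :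
    |(1 - exp (-(2*(j+1))*|u|))/(4*((j:ℝ)+1)^2)| ≤ 1/(4*((j:ℝ)+1)^2) := by
  rw [abs_div, abs_of_pos (by positivity : 0 < 4*((j:ℝ)+1)^2)]
  gcongr
  have h1 : exp (-(2*((j:ℝ)+1))*|u|) ≤ 1 := by
    apply exp_le_one_iff.2
    have : 0 ≤ (2*((j:ℝ)+1))*|u| := by positivity
    linarith
  have h2 := exp_pos (-(2*((j:ℝ)+1))*|u|)
  rw [abs_le]; constructor <;> linarith

lemma Jf_cont : Continuous Jf := by
  apply continuous_tsum (fun j => by fun_prop) Jsum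
  intro j u
  exact Jterm_bound j u

lemma Jf_bound (u : ℝ) : |Jf u| ≤ ∑' j : ℕ, 1/(4*((j:ℝ)+1)^2) := by
  rw [← Real.norm_eq_abs]
  exact tsum_of_norm_bounded Jsum.hasSum (fun j => Jterm_bound j u)

lemma harm_sum (m : ℕ) : HasSum (fun j : ℕ => 1/((j:ℝ)+1) - 1/((j:ℝ)+1+m)) (harmonic m : ℝ) := by
  induction m with
  | zero => simp [hasSum_zero]
  | succ m ih =>
    have h : HasSum (fun j : ℕ => 1/((j:ℝ)+1+m) - 1/((j:ℝ)+1+(m+1))) (1/((m:ℝ)+1)) := by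
      rw [hasSum_iff_tendsto_nat_of_nonneg]
      · have e : ∀ N : ℕ, ∑ j ∈ Finset.range N, (1/((j:ℝ)+1+m) - 1/((j:ℝ)+1+(m+1))) =
            1/((m:ℝ)+1) - 1/((N:ℝ)+1+m) := by
          intro N
          induction N with
          | zero => simp [add_comm]
          | succ N ihN =>
            rw [Finset.sum_range_succ, ihN]
            push_cast
            have : (N:ℝ)+1+(m+1) = N+1+1+m := by ring
            rw [this]; ring
        simp_rw [e]
        have h1 : Tendsto (fun N : ℕ => 1/((N:ℝ)+1+m)) atTop (nhds 0) := by
          apply tendsto_const_nhds.div_atTop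
          apply tendsto_atTop_add_const_right
          apply tendsto_atTop_add_const_right
          exact tendsto_natCast_atTop_atTop
        simpa using h1.const_sub (1/((m:ℝ)+1))
      · intro j
        rw [sub_nonneg]
        apply one_div_le_one_div_of_le (by positivity)
        linarith
    have h2 := ih.add h
    rw [harmonic_succ]
    push_cast
    rw [← one_div]
    have e3 : (fun j : ℕ => 1/((j:ℝ)+1) - 1/((j:ℝ)+1+((m:ℝ)+1))) = fun j : ℕ =>
        1/((j:ℝ)+1) - 1/((j:ℝ)+1+m) + (1/((j:ℝ)+1+m) - 1/((j:ℝ)+1+(m+1))) := by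
      funext j; ring
    rw [e3]
    exact h2

lemma Jf_laplace (m : ℕ) :
    ∫ u in Ioi (0:ℝ), Jf u * exp (-(2*(m+1))*u) = (harmonic (m+1):ℝ)/(2*(2*(m+1))^2) := by
  set s : ℝ := 2*(m+1) with hs
  have hs0 : 0 < s := by positivity
  have hI : ∀ j : ℕ, IntegrableOn (fun u => (1 - exp (-(2*(j+1))*|u|))/(4*((j:ℝ)+1)^2) * exp (-s*u)) (Ioi 0) := by
    intro j
    apply integrableOn_of_exp_bound _ 0 s (1/(4*((j:ℝ)+1)^2)) hs0
    · exact (by fun_prop : Continuous fun u => (1 - exp (-(2*(j+1))*|u|))/(4*((j:ℝ)+1)^2) * exp (-s*u)).aestronglyMeasurable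
    · intro u _
      rw [abs_mul, abs_of_pos (exp_pos (-s*u))]
      have := Jterm_bound j u
      gcongr
  have h := hasSum_integral_of_summable_integral_norm
    (F := fun (j:ℕ) u => (1 - exp (-(2*(j+1))*|u|))/(4*((j:ℝ)+1)^2) * exp (-s*u))
    (μ := volume.restrict (Ioi 0)) hI
    (by
      have hS2 := Jsum.mul_right (∫ u in Ioi (0:ℝ), exp (-s*u))
      apply Summable.of_nonneg_of_le _ _ hS2
      · intro i; exact integral_nonneg fun u => norm_nonneg _
      · intro j
        rw [← integral_const_mul]
        apply integral_mono (hI j).norm ((integrableOn_exp_mul_Ioi (by linarith) 0).const_mul _)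
        intro u
        simp only
        rw [Real.norm_eq_abs, abs_mul, abs_of_pos (exp_pos (-s*u))]
        have := Jterm_bound j u
        gcongr)
  have e1 : ∀ j : ℕ, ∫ u in Ioi (0:ℝ), (1 - exp (-(2*(j+1))*|u|))/(4*((j:ℝ)+1)^2) * exp (-s*u) =
      (1/((j:ℝ)+1) - 1/((j:ℝ)+1+(m+1:ℕ))) / (2*s^2) := by
    intro j
    have hj : (0:ℝ) < (j:ℝ)+1 := by positivity
    have e : ∫ u in Ioi (0:ℝ), (1 - exp (-(2*(j+1))*|u|))/(4*((j:ℝ)+1)^2) * exp (-s*u) =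
        ∫ u in Ioi (0:ℝ), (1/(4*((j:ℝ)+1)^2)) * (exp (-s*u) - exp (-(s+2*(j+1))*u)) := by
      apply setIntegral_congr_fun measurableSet_Ioi
      intro u hu
      have hu : (0:ℝ) < u := hu
      simp only
      rw [abs_of_pos hu]
      have : exp (-(s+2*((j:ℝ)+1))*u) = exp (-(2*((j:ℝ)+1))*u) * exp (-s*u) := by
        rw [← exp_add]; ring_nf
      rw [this]; ring
    rw [e, integral_const_mul, integral_sub (integrableOn_exp_mul_Ioi (by linarith) 0)
      (integrableOn_exp_mul_Ioi (by linarith) 0), integral_exp_Ioi _ _ hs0, integral_exp_Ioi _ _ (by positivity)]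
    simp only [mul_zero, exp_zero]
    have h3 : (0:ℝ) < (j:ℝ)+1+(m+1:ℕ) := by positivity
    push_cast at h3 ⊢
    rw [hs]
    have h4 : 2 * ((m:ℝ) + 1) + 2 * ((j:ℝ) + 1) = 2 * ((j:ℝ)+1+(m+1)) := by ring
    rw [h4]
    field_simp
    ring
  have e2 : ∀ u, ∑' j : ℕ, (1 - exp (-(2*(j+1))*|u|))/(4*((j:ℝ)+1)^2) * exp (-s*u) = Jf u * exp (-s*u) := by
    intro u
    rw [tsum_mul_right]; rfl
  simp_rw [e1, e2] at h
  exact h.unique ((harm_sum (m+1)).div_const _)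

lemma u_laplace (s : ℝ) (hs : 0 < s) :
    IntegrableOn (fun u => u * exp (-s*u)) (Ioi 0) ∧
    ∫ u in Ioi (0:ℝ), u * exp (-s*u) = 1/s^2 := by
  have hI : IntegrableOn (fun u => u * exp (-s*u)) (Ioi 0) := by
    apply integrableOn_of_exp_bound _ 0 (s/2) (2/s) (by linarith)
    · exact (by fun_prop : Continuous fun u => u * exp (-s*u)).aestronglyMeasurable
    · intro u hu
      rw [abs_mul, abs_of_pos (exp_pos _), abs_of_pos hu]
      have h1 := add_one_le_exp (s/2*u)
      have h2 : u ≤ 2/s * exp (s/2*u) := by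
        have : 2/s * (s/2*u) = u := by field_simp
        have h3 : 0 < 2/s := by positivity
        nlinarith
      calc u * exp (-s*u) ≤ 2/s * exp (s/2*u) * exp (-s*u) := by gcongr
        _ = 2/s * exp (-(s/2)*u) := by rw [mul_assoc, ← exp_add]; ring_nf
  refine ⟨hI, ?_⟩
  have h := integral_Ioi_of_hasDerivAt_of_tendsto' (a := 0) (m := 0)
    (f := fun u => (-(u/s) - 1/s^2) * exp (-s*u))
    (f' := fun u => u * exp (-s*u))
    (by
      intro u _
      have h2 : HasDerivAt (fun u:ℝ => exp (-s*u)) (exp (-s*u) * (-s*1)) u :=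
          ((hasDerivAt_id u).const_mul (-s)).exp
      refine (((((hasDerivAt_id u).div_const s).neg).sub_const (1/s^2)).mul h2).congr_deriv ?_
      simp only [Pi.neg_apply, id]
      field_simp
      ring)
    hI
    (by
      have h1 : Tendsto (fun u:ℝ => u * exp (-s*u)) atTop (nhds 0) := by
        have := tendsto_rpow_mul_exp_neg_mul_atTop_nhds_zero 1 s hs
        simpa using this
      have h2 : Tendsto (fun u:ℝ => 1 * exp (-s*u)) atTop (nhds 0) :=
        exp_lim s hs (fun _ => 1) 1 (by simp)
      have h3 := (h1.const_mul (-(1/s))).sub (h2.const_mul (1/s^2))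
      simp only [mul_zero, sub_zero] at h3
      refine h3.congr fun u => ?_
      ring)
  rw [h]; simp

end Kacz

namespace Kacz
open MeasureTheory Asymptotics

lemma expl_alg (x g N : ℝ) (hx : 0 < x) : N * (x/(x^2+g^2)) * (1/(x+1/2)^2) =
    N * (((1/4-g^2)*x+g^2)/((1/4+g^2)^2*(x^2+g^2))) - N * ((1/4-g^2)/(1/4+g^2)^2) * (1/(x+1/2))
      - N / (1/4+g^2) * (1/(2*(x+1/2)^2)) := by
  have q2 : x^2+g^2 ≠ 0 := by positivity
  have q3 : 1/4+g^2 ≠ 0 := by positivity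
  have q4 : x+1/2 ≠ 0 := by positivity
  have q5 : 1+4*g^2 ≠ 0 := by positivity
  have q6 : x*2+1 ≠ 0 := by positivity
  field_simp
  ring

lemma explicit_formula {ι : Type} [Countable ι] (γ n : ι → ℝ) (hn : ∀ i, 0 ≤ n i)
    (hH : ∀ x : ℝ, 0 < x → HasSum (fun i => n i*(x/(x^2+γ i^2))) (xiL x))
    (hS : Summable fun i => n i / (1/4+γ i^2)) :
    ∃ C, 0 < C ∧ ∀ u, 0 ≤ u → |Psi1 u + exp (u/2) * Wc γ n u| ≤ C * (1+u) := by
  set S : ℝ := ∑' i, n i / (1/4+γ i^2) with hSdef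
  set κ : ℝ := 1 + 1/2*log π + 1/2*eulerMascheroniConstant with hκ
  set J0 : ℝ := ∑' j : ℕ, 1/(4*((j:ℝ)+1)^2) with hJ0
  have hS0 : 0 ≤ S := tsum_nonneg fun i => div_nonneg (hn i) (by positivity)
  have hJ00 : 0 ≤ J0 := tsum_nonneg fun i => by positivity
  have hWb := Wc_bound γ n hn hS
  have hWc := Wc_cont γ n hn hS
  set F : ℝ → ℝ := fun u => Psi1 u + (exp (u/2) * Wc γ n u - Wc γ n 0 - S/2*u) + κ*u - Jf u with hF
  have hzero : ∀ u, 0 ≤ u → F u = 0 := by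
    apply moment_unique F _ (7 + S + S + S/2 + |κ| + J0)
    · intro u hu
      have a1 := abs_le.1 (Psi1_bound u hu)
      have a2 := abs_le.1 (hWb u)
      have a3 := abs_le.1 (hWb 0)
      have a4 := abs_le.1 (Jf_bound u)
      have a5 : exp (u/2) ≤ exp (2*u) := exp_le_exp.2 (by linarith)
      have a6 : exp u ≤ exp (2*u) := exp_le_exp.2 (by linarith)
      have a7 : 1 ≤ exp (2*u) := one_le_exp (by linarith)
      have a8 : u ≤ exp (2*u) := by linarith [add_one_le_exp (2*u)]
      have b1 : |Psi1 u| ≤ 7 * exp (2*u) := (Psi1_bound u hu).trans (by linarith)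
      have b2 : |exp (u/2) * Wc γ n u| ≤ S * exp (2*u) := by
        rw [abs_mul, abs_of_pos (exp_pos _), mul_comm]
        exact mul_le_mul (hWb u) a5 (exp_pos _).le hS0
      have b3 : |Wc γ n 0| ≤ S * exp (2*u) := (hWb 0).trans (by nlinarith)
      have b4 : |S/2*u| ≤ S/2 * exp (2*u) := by
        rw [abs_of_nonneg (by positivity)]
        gcongr
      have b5 : |κ*u| ≤ |κ| * exp (2*u) := by
        rw [abs_mul, abs_of_nonneg hu]; gcongr
      have b6 : |Jf u| ≤ J0 * exp (2*u) := (Jf_bound u).trans (by nlinarith)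
      rw [abs_le] at b1 b2 b3 b4 b5 b6 ⊢
      simp only [hF]
      constructor <;> linarith [b1.1, b2.1, b3.1, b4.1, b5.1, b6.1, b1.2, b2.2, b3.2, b4.2, b5.2, b6.2]
    · intro k
      set m : ℕ := k+1 with hm
      have hsm : (2*((k:ℝ)+2)) = 2*((m:ℝ)+1) := by rw [hm]; push_cast; ring
      rw [hsm]
      set s : ℝ := 2*((m:ℝ)+1) with hs
      have hs2 : 2 ≤ s := by have : (0:ℝ) ≤ m := by positivity
                             linarith
      have hs0 : 0 < s := by linarith
      have hx : 0 < s - 1/2 := by linarith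
      obtain ⟨hP1, hP2⟩ := Psi1_laplace s (by linarith)
      obtain ⟨hu1, hu2⟩ := u_laplace s hs0
      have hexp : IntegrableOn (fun u => exp (-s*u)) (Ioi 0) := integrableOn_exp_mul_Ioi (by linarith) 0
      have hW1 : IntegrableOn (fun u => Wc γ n u * exp (-(s-1/2)*u)) (Ioi 0) := by
        apply integrableOn_of_exp_bound _ 0 (s-1/2) S hx
        · exact (hWc.mul (by fun_prop : Continuous fun u:ℝ => exp (-(s-1/2)*u))).aestronglyMeasurable
        · intro u _
          rw [abs_mul, abs_of_pos (exp_pos _)]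
          have := hWb u
          gcongr
      have hJ1 : IntegrableOn (fun u => Jf u * exp (-s*u)) (Ioi 0) := by
        apply integrableOn_of_exp_bound _ 0 s J0 hs0
        · exact (Jf_cont.mul (by fun_prop : Continuous fun u:ℝ => exp (-s*u))).aestronglyMeasurable
        · intro u _
          rw [abs_mul, abs_of_pos (exp_pos _)]
          have := Jf_bound u
          gcongr
      have hJ2 := Jf_laplace m
      rw [← hs] at hJ2
      have eF : (fun u => F u * exp (-s*u)) = fun u => Psi1 u * exp (-s*u) + Wc γ n u * exp (-(s-1/2)*u)
          - Wc γ n 0 * exp (-s*u) + (κ - S/2) * (u * exp (-s*u)) - Jf u * exp (-s*u) := by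
        funext u
        have : exp (-(s-1/2)*u) = exp (u/2) * exp (-s*u) := by rw [← exp_add]; ring_nf
        rw [this]
        simp only [hF]; ring
      have i1 : IntegrableOn (fun u => Psi1 u * exp (-s*u) + Wc γ n u * exp (-(s-1/2)*u)) (Ioi 0) :=
        hP1.add hW1
      have i2 : IntegrableOn (fun u => Psi1 u * exp (-s*u) + Wc γ n u * exp (-(s-1/2)*u)
          - Wc γ n 0 * exp (-s*u)) (Ioi 0) := i1.sub (hexp.const_mul (Wc γ n 0))
      have i3 : IntegrableOn (fun u => Psi1 u * exp (-s*u) + Wc γ n u * exp (-(s-1/2)*u)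
          - Wc γ n 0 * exp (-s*u) + (κ - S/2) * (u * exp (-s*u))) (Ioi 0) :=
        i2.add (hu1.const_mul (κ - S/2))
      rw [eF]
      have hsplit : ∫ u in Ioi (0:ℝ), (Psi1 u * exp (-s*u) + Wc γ n u * exp (-(s-1/2)*u)
          - Wc γ n 0 * exp (-s*u) + (κ - S/2) * (u * exp (-s*u)) - Jf u * exp (-s*u)) =
          (LV s / s^2 - 1/(s*(s-1))) + (∫ u in Ioi (0:ℝ), Wc γ n u * exp (-(s-1/2)*u))
          - Wc γ n 0 * (1/s) + (κ - S/2) * (1/s^2) - (harmonic (m+1):ℝ)/(2*s^2) := by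
        rw [integral_sub i3 hJ1, integral_add i2 (hu1.const_mul (κ - S/2)),
          integral_sub i1 (hexp.const_mul (Wc γ n 0)), integral_add hP1 hW1, hP2, hJ2,
          integral_const_mul, integral_const_mul, hu2, integral_exp_Ioi _ _ hs0]
        simp
      rw [hsplit]
      -- moment of Wc
      have hWL := Wc_laplace γ n hn hS (s-1/2) hx
      have hsum : HasSum (fun i => n i * (((s-1/2))/((s-1/2)^2+γ i^2)) * (1/s^2))
          ((∫ u in Ioi (0:ℝ), Wc γ n u * exp (-(s-1/2)*u)) - Wc γ n 0 * (1/s) - S * (1/(2*s^2))) := by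
        have h1 := (hWL.sub ((Wc_summable γ n hn hS 0).hasSum.mul_right (1/s))).sub
          (hS.hasSum.mul_right (1/(2*s^2)))
        have e : (fun i => n i * (((s-1/2))/((s-1/2)^2+γ i^2)) * (1/s^2)) = fun i =>
            n i * (((1/4-γ i^2)*(s-1/2)+γ i^2)/((1/4+γ i^2)^2*((s-1/2)^2+γ i^2))) - n i * wf (γ i) 0 * (1/s)
            - n i / (1/4+γ i^2) * (1/(2*s^2)) := by
          funext i
          unfold wf
          simp only [mul_zero, cos_zero, sin_zero, mul_one, add_zero]
          have := expl_alg (s-1/2) (γ i) (n i) hx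
          rw [sub_add_cancel] at this
          exact this
        rw [e]
        exact h1
      have hxi := ((hH (s-1/2) hx).mul_right (1/s^2)).unique hsum
      have hform := xiL_formula m
      rw [← hs] at hform
      rw [hform] at hxi
      have hharm : (harmonic (m+1):ℝ) = harmonic m + 2/s := by
        rw [harmonic_succ]; push_cast; rw [hs]; field_simp
      have hI : (∫ u in Ioi (0:ℝ), Wc γ n u * exp (-(s-1/2)*u)) = (1 / s - 1 / 2 * log π + 1 / 2 * ((harmonic m:ℝ) - eulerMascheroniConstant) +
        1 / (s - 1) - LV s) * (1 / s ^ 2) + Wc γ n 0 * (1/s) + S * (1/(2*s^2)) := by linarith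
      rw [hI, hharm, hκ]
      have hs1 : s - 1 ≠ 0 := by linarith
      field_simp
      ring
    · simp only [hF]
      have := Psi1_cont
      have := Jf_cont
      fun_prop
  refine ⟨S + S/2 + |κ| + J0 + 1, by positivity, ?_⟩
  intro u hu
  have h0 := hzero u hu
  simp only [hF] at h0
  have e : Psi1 u + exp (u/2) * Wc γ n u = Wc γ n 0 + S/2*u - κ*u + Jf u := by linarith
  rw [e]
  have b3 : |Wc γ n 0| ≤ S := hWb 0
  have b4 : |S/2*u| = S/2 * u := abs_of_nonneg (by positivity)
  have b5 : |κ*u| = |κ| * u := by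
    rw [abs_mul, abs_of_nonneg hu]
  have b6 : |Jf u| ≤ J0 := Jf_bound u
  have c1 : 0 ≤ S*u := by positivity
  have c2 : 0 ≤ J0*u := by positivity
  have c3 := abs_nonneg κ
  calc |Wc γ n 0 + S/2*u - κ*u + Jf u| ≤ |Wc γ n 0| + |S/2*u| + |κ*u| + |Jf u| :=
        (abs_add_le _ _).trans (add_le_add ((abs_sub _ _).trans (add_le_add (abs_add_le _ _) le_rfl)) le_rfl)
    _ ≤ _ := by rw [b4, b5]; nlinarith

end Kacz

namespace Kacz
open MeasureTheory Asymptotics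

lemma wf_diff (g u t : ℝ) :
    |wf g (u+t) - wf g u| ≤ 1/(1/4+g^2) * (|cos (g*t) - 1| + |sin (g*t)|) := by
  have hq : 0 < 1/4+g^2 := by positivity
  have e : wf g (u+t) - wf g u = wf g u * (cos (g*t) - 1) +
      ((g*cos (g*u) - (1/4-g^2)*sin (g*u))/(1/4+g^2)^2) * sin (g*t) := by
    unfold wf
    rw [mul_add, cos_add, sin_add]
    ring
  have h2 : |(g*cos (g*u) - (1/4-g^2)*sin (g*u))/(1/4+g^2)^2| ≤ 1/(1/4+g^2) := by
    rw [abs_div, abs_of_pos (by positivity : 0 < (1/4+g^2)^2), div_le_div_iff₀ (by positivity) hq]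
    have : |g*cos (g*u) - (1/4-g^2)*sin (g*u)| ≤ 1/4+g^2 := by
      apply abs_le_of_sq_le_sq _ hq.le
      have h := Real.sin_sq_add_cos_sq (g*u)
      nlinarith [sq_nonneg ((1/4-g^2)*cos (g*u) + g*sin (g*u))]
    nlinarith
  rw [e, mul_add]
  refine (abs_add_le _ _).trans ?_
  rw [abs_mul, abs_mul]
  have := wf_bound g u
  gcongr

lemma cos_sin_le (x y : ℝ) : |cos (x-y) - 1| + |sin (x-y)| ≤
    2 * ‖Complex.exp (x*Complex.I) - Complex.exp (y*Complex.I)‖ := by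
  set z : ℂ := Complex.exp ((x-y:ℝ)*Complex.I) - 1 with hz
  have h1 : Complex.exp (x*Complex.I) - Complex.exp (y*Complex.I) = Complex.exp (y*Complex.I) * z := by
    rw [hz, mul_sub, ← Complex.exp_add]
    push_cast; ring_nf
  rw [h1, norm_mul, Complex.norm_exp_ofReal_mul_I, one_mul]
  have h2 : z.re = cos (x-y) - 1 := by
    rw [hz, Complex.sub_re, Complex.exp_ofReal_mul_I_re, Complex.one_re]
  have h3 : z.im = sin (x-y) := by
    rw [hz, Complex.sub_im, Complex.exp_ofReal_mul_I_im, Complex.one_im, sub_zero]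
  have := Complex.abs_re_le_norm z
  have := Complex.abs_im_le_norm z
  rw [← h2, ← h3]; linarith

lemma kronecker_weak {ι : Type} (γ : ι → ℝ) (T : Finset ι) (δ : ℝ) (hδ : 0 < δ) :
    ∃ L, 0 < L ∧ ∀ U, ∃ t, U ≤ t ∧ t ≤ U + L ∧ ∀ i ∈ T, |cos (γ i*t) - 1| + |sin (γ i*t)| ≤ 2*δ := by
  set f : ℝ → (T → ℂ) := fun t i => Complex.exp ((γ i * t : ℝ) * Complex.I) with hf
  have hb : range f ⊆ Metric.closedBall 0 1 := by
    rintro _ ⟨t, rfl⟩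
    rw [mem_closedBall_zero_iff, pi_norm_le_iff_of_nonneg zero_le_one]
    intro i
    simp only [hf]
    rw [Complex.norm_exp_ofReal_mul_I]
  have htb : TotallyBounded (range f) :=
    (isCompact_closedBall (0 : T → ℂ) 1).totallyBounded.subset hb
  obtain ⟨s, hs1, hs2, hs3⟩ := Metric.finite_approx_of_totallyBounded htb δ hδ
  have : ∀ y : T → ℂ, ∃ t : ℝ, y ∈ s → f t = y := by
    intro y
    by_cases hy : y ∈ s
    · obtain ⟨t, ht⟩ := hs1 hy
      exact ⟨t, fun _ => ht⟩
    · exact ⟨0, fun h => absurd h hy⟩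
  choose g hg using this
  obtain ⟨M, hM⟩ := (hs2.image (fun y => |g y|)).bddAbove
  have hM' : ∀ y ∈ s, |g y| ≤ |M| := fun y hy => (hM (mem_image_of_mem _ hy)).trans (le_abs_self M)
  refine ⟨2*|M|+1, by positivity, fun U => ?_⟩
  have h1 := hs3 (mem_range_self (U+|M|))
  simp only [mem_iUnion] at h1
  obtain ⟨y, hy, hd⟩ := h1
  have h2 := abs_le.1 (hM' y hy)
  refine ⟨U+|M| - g y, by linarith [h2.1, h2.2], by linarith [h2.1, h2.2], ?_⟩
  intro i hi
  rw [Metric.mem_ball, ← hg y hy] at hd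
  have h3 := (dist_pi_lt_iff hδ).1 hd ⟨i, hi⟩
  rw [mul_sub]
  refine (cos_sin_le _ _).trans ?_
  simp only [hf, dist_eq_norm] at h3
  linarith

lemma almost_periodic {ι : Type} (γ n : ι → ℝ) (hn : ∀ i, 0 ≤ n i)
    (hS : Summable fun i => n i / (1/4+γ i^2)) (ε : ℝ) (hε : 0 < ε) :
    ∃ L, 0 < L ∧ ∀ U, ∃ t, U ≤ t ∧ t ≤ U + L ∧ ∀ u, |Wc γ n (u+t) - Wc γ n u| ≤ ε := by
  classical
  set a : ι → ℝ := fun i => n i / (1/4+γ i^2) with ha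
  have ha0 : ∀ i, 0 ≤ a i := fun i => div_nonneg (hn i) (by positivity)
  set S := ∑' i, a i with hSd
  have hS0 : 0 ≤ S := tsum_nonneg ha0
  have hlim : Tendsto (fun T : Finset ι => ∑ i ∈ T, a i) atTop (nhds S) := hS.hasSum
  obtain ⟨T, hT⟩ := (hlim.eventually_const_lt (by linarith : S - ε/6 < S)).exists
  obtain ⟨L, hL, h⟩ := kronecker_weak γ T (ε/(4*(S+1))) (by positivity)
  refine ⟨L, hL, fun U => ?_⟩
  obtain ⟨t, h1, h2, h3⟩ := h U
  refine ⟨t, h1, h2, fun u => ?_⟩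
  set δ := ε/(4*(S+1)) with hδ
  have hsub : Wc γ n (u+t) - Wc γ n u = ∑' i, (n i * wf (γ i) (u+t) - n i * wf (γ i) u) :=
    ((Wc_summable γ n hn hS (u+t)).tsum_sub (Wc_summable γ n hn hS u)).symm
  have hfin : HasSum (fun i => if i ∈ T then a i else 0) (∑ i ∈ T, a i) := by
    have h4 := hasSum_sum_of_ne_finset_zero (f := fun i => if i ∈ T then a i else 0) (s := T)
      (L := SummationFilter.unconditional ι)
      (fun b hb => by simp [hb])
    rw [Finset.sum_congr rfl (fun i hi => if_pos hi)] at h4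
    exact h4
  have hdom : HasSum (fun i => a i * (2*δ) + 3 * (a i - if i ∈ T then a i else 0))
      (S*(2*δ) + 3 * (S - ∑ i ∈ T, a i)) :=
    (hS.hasSum.mul_right _).add ((hS.hasSum.sub hfin).mul_left 3)
  rw [hsub, ← Real.norm_eq_abs]
  refine (tsum_of_norm_bounded hdom ?_).trans ?_
  · intro i
    rw [← mul_sub, Real.norm_eq_abs, abs_mul, abs_of_nonneg (hn i)]
    have h5 := wf_diff (γ i) u t
    have h6 : n i * |wf (γ i) (u+t) - wf (γ i) u| ≤ a i * (|cos (γ i*t) - 1| + |sin (γ i*t)|) := by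
      calc _ ≤ n i * (1/(1/4+γ i^2) * (|cos (γ i*t) - 1| + |sin (γ i*t)|)) :=
            mul_le_mul_of_nonneg_left h5 (hn i)
        _ = _ := by rw [ha]; ring
    refine h6.trans ?_
    split_ifs with hi
    · have := mul_le_mul_of_nonneg_left (h3 i hi) (ha0 i)
      linarith
    · have h7 : |cos (γ i*t) - 1| + |sin (γ i*t)| ≤ 3 := by
        have c1 := Real.abs_sin_le_one (γ i*t)
        have c2 := abs_le.1 (Real.abs_cos_le_one (γ i*t))
        have c3 : |cos (γ i*t) - 1| ≤ 2 := by rw [abs_le]; constructor <;> linarith [c2.1, c2.2]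
        linarith
      have h8 := mul_le_mul_of_nonneg_left h7 (ha0 i)
      have h9 : 0 ≤ a i * (2*δ) := mul_nonneg (ha0 i) (by positivity)
      linarith
  · have h10 : S*(2*δ) ≤ ε/2 := by
      rw [hδ, mul_div_assoc', mul_div_assoc', div_le_div_iff₀ (by positivity) (by norm_num)]
      nlinarith
    linarith

end Kacz

namespace Kacz
open MeasureTheory Asymptotics

lemma primePi_eq_counting (x : ℝ) (hx : 0 ≤ x) : (primePi x : ℝ) = (Nat.primeCounting ⌊x⌋₊ : ℝ) := by
  rw [primePi_eq x hx, Finset.sum_boole]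
  congr 1
  rw [Nat.primeCounting, Nat.primeCounting', Nat.count_eq_card_filter_range]
  congr 1
  ext p
  simp only [Finset.mem_filter, Finset.mem_Icc, Finset.mem_range]
  constructor
  · rintro ⟨h1, h2⟩; exact ⟨by omega, h2⟩
  · rintro ⟨h1, h2⟩; exact ⟨⟨h2.one_lt.le, by omega⟩, h2⟩

lemma log_ne (t : ℝ) (ht : 2 ≤ t) : 0 < log t := log_pos (by linarith)

lemma uIcc_two (x t : ℝ) (hx : 2 ≤ x) (ht : t ∈ uIcc 2 x) : 2 ≤ t := by
  rw [uIcc_of_le hx] at ht; exact ht.1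

lemma Li_parts (x : ℝ) (hx : 2 ≤ x) :
    Li x = x/log x - 2/log 2 + ∫ t in (2:ℝ)..x, t/(t*log t^2) := by
  have hc : ∀ k : ℕ, ContinuousOn (fun t:ℝ => 1/log t^k) (uIcc 2 x) := by
    intro k t ht
    have h2 := uIcc_two x t hx ht
    have := log_ne t h2
    exact (continuousAt_const.div ((continuousAt_log (by linarith)).pow k)
      (by show log t^k ≠ 0; positivity)).continuousWithinAt
  have h1 : IntervalIntegrable (fun t:ℝ => 1/log t) volume 2 x := by
    have := (hc 1).intervalIntegrable (μ := volume); simpa using this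
  have h2 : IntervalIntegrable (fun t:ℝ => 1/log t^2) volume 2 x := (hc 2).intervalIntegrable
  have e : ∫ t in (2:ℝ)..x, t/(t*log t^2) = ∫ t in (2:ℝ)..x, 1/log t^2 := by
    apply intervalIntegral.integral_congr
    intro t ht
    have h2 := uIcc_two x t hx ht
    have := log_ne t h2
    simp only
    field_simp
  have h := intervalIntegral.integral_eq_sub_of_hasDerivAt (f := fun t => t/log t)
    (f' := fun t => 1/log t - 1/log t^2) (a := 2) (b := x)
    (by
      intro t ht
      have h2 := uIcc_two x t hx ht
      have := log_ne t h2
      refine ((hasDerivAt_id t).div (hasDerivAt_log (by linarith)) this.ne').congr_deriv ?_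
      simp only [id]
      field_simp)
    (h1.sub h2)
  rw [intervalIntegral.integral_sub h1 h2] at h
  rw [e]
  unfold Li
  linarith

lemma Isqrt : ∃ K, 0 ≤ K ∧ ∀ u, 4 ≤ u → ∫ t in (2:ℝ)..exp u, √t/(t*log t^2) ≤ K + exp (u/2)/u := by
  have h4 : (2:ℝ) ≤ exp 4 := by linarith [add_one_le_exp (4:ℝ)]
  have hc : ∀ x, 2 ≤ x → ContinuousOn (fun t:ℝ => √t/(t*log t^2)) (uIcc 2 x) := by
    intro x hx t ht
    have h2 := uIcc_two x t hx ht
    have := log_ne t h2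
    have : (0:ℝ) < t := by linarith
    exact (continuous_sqrt.continuousAt.div (continuousAt_id.mul ((continuousAt_log (by linarith)).pow 2))
      (by show t*log t^2 ≠ 0; positivity)).continuousWithinAt
  refine ⟨|∫ t in (2:ℝ)..exp 4, √t/(t*log t^2)|, abs_nonneg _, ?_⟩
  intro u hu
  have hu2 : exp 4 ≤ exp u := exp_le_exp.2 hu
  have i1 : IntervalIntegrable (fun t:ℝ => √t/(t*log t^2)) volume 2 (exp 4) := (hc _ h4).intervalIntegrable
  have i3 : IntervalIntegrable (fun t:ℝ => √t/(t*log t^2)) volume 2 (exp u) :=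
    (hc _ (h4.trans hu2)).intervalIntegrable
  have i2 := i1.symm.trans i3
  rw [← intervalIntegral.integral_add_adjacent_intervals i1 i2]
  apply add_le_add (le_abs_self _)
  have hlog : ∀ t ∈ Icc (exp 4) (exp u), 4 ≤ log t := fun t ht =>
    (le_log_iff_exp_le ((exp_pos 4).trans_le ht.1)).2 ht.1
  have hc2 : ContinuousOn (fun t:ℝ => (1/2*log t - 1) * (√t/(t*log t^2))) (uIcc (exp 4) (exp u)) := by
    intro t ht
    rw [uIcc_of_le hu2] at ht
    have := hlog t ht
    have ht0 := (exp_pos 4).trans_le ht.1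
    exact (ContinuousAt.mul ((continuousAt_const.mul (continuousAt_log ht0.ne')).sub continuousAt_const)
      (continuous_sqrt.continuousAt.div (continuousAt_id.mul ((continuousAt_log ht0.ne').pow 2))
      (by show t*log t^2 ≠ 0; positivity))).continuousWithinAt
  have h := intervalIntegral.integral_eq_sub_of_hasDerivAt (f := fun t => √t/log t)
    (f' := fun t => (1/2*log t - 1) * (√t/(t*log t^2))) (a := exp 4) (b := exp u)
    (by
      intro t ht
      rw [uIcc_of_le hu2] at ht
      have := hlog t ht
      have ht0 := (exp_pos 4).trans_le ht.1
      refine ((hasDerivAt_sqrt ht0.ne').div (hasDerivAt_log ht0.ne') (by positivity)).congr_deriv ?_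
      have hsq : 0 < √t := sqrt_pos.2 ht0
      have e : t = √t * √t := (mul_self_sqrt ht0.le).symm
      field_simp
      rw [pow_two, ← e]
      ring)
    hc2.intervalIntegrable
  have h5 : ∫ t in exp 4..exp u, √t/(t*log t^2) ≤ ∫ t in exp 4..exp u, (1/2*log t - 1) * (√t/(t*log t^2)) := by
    apply intervalIntegral.integral_mono_on hu2 i2 hc2.intervalIntegrable
    intro t ht
    have := hlog t ht
    have ht0 := (exp_pos 4).trans_le ht.1
    have h6 : 0 ≤ √t/(t*log t^2) := by positivity
    nlinarith
  have h7 : 0 ≤ √(exp 4)/log (exp 4) := by rw [log_exp]; positivity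
  have h8 : √(exp u)/log (exp u) = exp (u/2)/u := by rw [log_exp, ← exp_half]
  rw [h, h8] at h5
  linarith

end Kacz

namespace Kacz
open MeasureTheory Asymptotics

lemma psi_int (x : ℝ) (hx : 2 ≤ x) (k : ℕ) :
    IntervalIntegrable (fun t => Chebyshev.psi t / (t * log t^k)) volume 2 x := by
  have h1 : IntervalIntegrable Chebyshev.psi volume 2 x := Chebyshev.psi_mono.intervalIntegrable
  have hc : ContinuousOn (fun t:ℝ => 1/(t*log t^k)) (uIcc 2 x) := by
    intro t ht
    have h2 := uIcc_two x t hx ht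
    have := log_ne t h2
    have : (0:ℝ) < t := by linarith
    exact (continuousAt_const.div (continuousAt_id.mul ((continuousAt_log (by linarith)).pow k))
      (by show t*log t^k ≠ 0; positivity)).continuousWithinAt
  have := h1.mul_continuousOn hc
  refine this.congr (fun t _ => ?_)
  ring

lemma theta_int (x : ℝ) (hx : 2 ≤ x) (k : ℕ) :
    IntervalIntegrable (fun t => Chebyshev.theta t / (t * log t^k)) volume 2 x := by
  have h1 : IntervalIntegrable Chebyshev.theta volume 2 x := Chebyshev.theta_mono.intervalIntegrable
  have hc : ContinuousOn (fun t:ℝ => 1/(t*log t^k)) (uIcc 2 x) := by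
    intro t ht
    have h2 := uIcc_two x t hx ht
    have := log_ne t h2
    have : (0:ℝ) < t := by linarith
    exact (continuousAt_const.div (continuousAt_id.mul ((continuousAt_log (by linarith)).pow k))
      (by show t*log t^k ≠ 0; positivity)).continuousWithinAt
  have := h1.mul_continuousOn hc
  refine this.congr (fun t _ => ?_)
  ring

lemma id_int (f : ℝ → ℝ) (hf : Continuous f) (x : ℝ) (hx : 2 ≤ x) (k : ℕ) :
    IntervalIntegrable (fun t => f t / (t * log t^k)) volume 2 x := by
  have hc : ContinuousOn (fun t:ℝ => f t/(t*log t^k)) (uIcc 2 x) := by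
    intro t ht
    have h2 := uIcc_two x t hx ht
    have := log_ne t h2
    have : (0:ℝ) < t := by linarith
    exact (hf.continuousAt.div (continuousAt_id.mul ((continuousAt_log (by linarith)).pow k))
      (by show t*log t^k ≠ 0; positivity)).continuousWithinAt
  exact hc.intervalIntegrable

lemma psi_parts (C : ℝ) (hC : 0 ≤ C) (hP : ∀ u, 0 ≤ u → |Psi1 u| ≤ C * exp (u/2)) :
    ∃ K, 0 ≤ K ∧ ∀ u, 4 ≤ u →
      |∫ t in (2:ℝ)..exp u, (Chebyshev.psi t - t)/(t*log t^2)| ≤ K + K * (exp (u/2)/u) := by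
  obtain ⟨K0, hK0, hI⟩ := Isqrt
  set D := |Psi1 (log 2) / log 2^2| with hD
  refine ⟨D + C + 4*C*K0 + 4*C, by positivity, fun u hu => ?_⟩
  set x := exp u with hx
  have hx2 : 2 ≤ x := by rw [hx]; linarith [add_one_le_exp u]
  have hlx : log x = u := log_exp u
  have hsx : √x = exp (u/2) := by rw [hx, ← exp_half]
  have hcl : ∀ t ∈ uIcc 2 x, ContinuousAt log t := fun t ht =>
    continuousAt_log (by linarith [uIcc_two x t hx2 ht])
  have hfc : ContinuousOn (fun t:ℝ => 1/log t^2) (uIcc 2 x) := by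
    intro t ht
    have := log_ne t (uIcc_two x t hx2 ht)
    exact (continuousAt_const.div ((hcl t ht).pow 2) (by show log t^2 ≠ 0; positivity)).continuousWithinAt
  have hgc : ContinuousOn (fun t:ℝ => Psi1 (log t)) (uIcc 2 x) := fun t ht =>
    (ContinuousAt.comp (g := Psi1) Psi1_cont.continuousAt (hcl t ht)).continuousWithinAt
  have hu'i : IntervalIntegrable (fun t:ℝ => -2/(t*log t^3)) volume 2 x :=
    id_int (fun _ => -2) continuous_const x hx2 3
  have hv'i : IntervalIntegrable (fun t:ℝ => (Chebyshev.psi t - t)/t) volume 2 x := by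
    have := (psi_int x hx2 0).sub (id_int (fun t => t) continuous_id x hx2 0)
    refine this.congr (fun t _ => ?_)
    simp only [pow_zero, mul_one]; ring
  have hparts := intervalIntegral.integral_mul_deriv_eq_deriv_mul_of_hasDeriv_right
    (u := fun t:ℝ => 1/log t^2) (v := fun t:ℝ => Psi1 (log t)) (u' := fun t:ℝ => -2/(t*log t^3))
    (v' := fun t:ℝ => (Chebyshev.psi t - t)/t) (a := 2) (b := x) hfc hgc
    (by
      intro t ht
      rw [min_eq_left hx2] at ht
      have h2 : 2 ≤ t := ht.1.le
      have hl := log_ne t h2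
      have ht0 : 0 < t := by linarith
      refine (((hasDerivAt_const t (1:ℝ)).div ((hasDerivAt_log ht0.ne').pow 2)
        (by show log t^2 ≠ 0; positivity)).congr_deriv ?_).hasDerivWithinAt
      simp only [Pi.pow_apply]
      field_simp
      ring)
    (by
      intro t ht
      rw [min_eq_left hx2] at ht
      have ht0 : 0 < t := by linarith [ht.1]
      have h1 := (Psi1_rightderiv (log t)).scomp t (hasDerivAt_log ht0.ne').hasDerivWithinAt
        (s := Ioi t) (fun y hy => log_lt_log ht0 hy)
      refine h1.congr_deriv ?_
      unfold Ef
      rw [exp_log ht0, smul_eq_mul]; ring)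
    hu'i hv'i
  have e1 : ∫ t in (2:ℝ)..x, (Chebyshev.psi t - t)/(t*log t^2) =
      ∫ t in (2:ℝ)..x, 1/log t^2 * ((Chebyshev.psi t - t)/t) := by
    apply intervalIntegral.integral_congr
    intro t _
    simp only
    rw [div_mul_div_comm, one_mul, mul_comm t]
  rw [e1, hparts, hlx]
  have hX : 0 < exp (u/2) := exp_pos _
  have b1 : |1/u^2 * Psi1 u| ≤ C * (exp (u/2)/u) := by
    rw [abs_mul, abs_of_pos (by positivity : 0 < 1/u^2)]
    calc 1/u^2 * |Psi1 u| ≤ 1/u^2 * (C * exp (u/2)) := by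
          have := hP u (by linarith)
          gcongr
      _ = C * (exp (u/2)/u) * (1/u) := by field_simp
      _ ≤ C * (exp (u/2)/u) * 1 := by
          gcongr
          rw [div_le_one (by linarith)]; linarith
      _ = _ := mul_one _
  have b2 : |1/log 2^2 * Psi1 (log 2)| = D := by rw [hD]; congr 1; ring
  have b3 : |∫ t in (2:ℝ)..x, -2/(t*log t^3) * Psi1 (log t)| ≤ 4*C*(K0 + exp (u/2)/u) := by
    have h1 : |∫ t in (2:ℝ)..x, -2/(t*log t^3) * Psi1 (log t)| ≤ ∫ t in (2:ℝ)..x, 4*C*(√t/(t*log t^2)) := by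
      rw [← Real.norm_eq_abs]
      apply intervalIntegral.norm_integral_le_of_norm_le hx2
      · refine Eventually.of_forall fun t ht => ?_
        have h2 : 2 ≤ t := ht.1.le
        have hl := log_ne t h2
        have ht0 : 0 < t := by linarith
        have hl2 : 1/2 ≤ log t := by
          have := Real.log_two_gt_d9
          have := log_le_log (by norm_num) h2
          linarith
        have h3 := hP (log t) hl.le
        have h4 : exp (log t/2) = √t := by rw [exp_half, exp_log ht0]
        rw [h4] at h3
        rw [Real.norm_eq_abs, abs_mul, abs_div, abs_of_pos (by positivity : 0 < t*log t^3)]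
        rw [abs_neg, abs_two]
        calc 2/(t*log t^3) * |Psi1 (log t)| ≤ 2/(t*log t^3) * (C * √t) := by gcongr
          _ = 2*C*(√t/(t*log t^2)) * (1/log t) := by field_simp
          _ ≤ 2*C*(√t/(t*log t^2)) * 2 := by
            gcongr
            rw [div_le_iff₀ hl]; linarith
          _ = _ := by ring
      · exact (id_int _ continuous_sqrt x hx2 2).const_mul (4*C)
    rw [intervalIntegral.integral_const_mul] at h1
    refine h1.trans ?_
    have := hI u hu
    gcongr
  have hq : 0 ≤ exp (u/2)/u := by positivity
  have b12 := abs_sub (1/u^2 * Psi1 u - 1/log 2^2 * Psi1 (log 2)) (∫ t in (2:ℝ)..x, -2/(t*log t^3) * Psi1 (log t))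
  have b13 := abs_sub (1/u^2 * Psi1 u) (1/log 2^2 * Psi1 (log 2))
  have hD0 : 0 ≤ D := abs_nonneg _
  have c1 : 0 ≤ D * (exp (u/2)/u) := by positivity
  have c2 : 0 ≤ C*K0*(exp (u/2)/u) := by positivity
  nlinarith

set_option maxHeartbeats 800000 in
lemma pi_psi (C : ℝ) (hC : 0 ≤ C) (hP : ∀ u, 0 ≤ u → |Psi1 u| ≤ C * exp (u/2)) :
    ∃ K, 0 < K ∧ ∀ u, 4 ≤ u → |u * B u - Ef u| ≤ K * exp (u/2) := by
  obtain ⟨K1, hK1, h1⟩ := psi_parts C hC hP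
  obtain ⟨K0, hK0, hI⟩ := Isqrt
  obtain ⟨C0', hC0'⟩ := Chebyshev.psi_sub_theta_le_mul_sqrt
  set C0 := |C0'| with hC0d
  have hC0n : 0 ≤ C0 := abs_nonneg _
  have hC0 : ∀ x, |Chebyshev.psi x - Chebyshev.theta x| ≤ C0 * √x := by
    intro x
    rw [abs_of_nonneg (sub_nonneg.2 (Chebyshev.theta_le_psi x))]
    exact (hC0' x).trans (mul_le_mul_of_nonneg_right (le_abs_self _) (sqrt_nonneg _))
  refine ⟨C0 + 2*K1 + K1 + 2*C0*K0 + C0 + 4/log 2 + 1, by have := log2_pos; positivity, ?_⟩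
  intro u hu
  set x := exp u with hx
  have hx2 : 2 ≤ x := by rw [hx]; linarith [add_one_le_exp u]
  have hlx : log x = u := log_exp u
  have hsx : √x = exp (u/2) := by rw [hx, ← exp_half]
  have hu0 : 0 < u := by linarith
  have e1 := Chebyshev.primeCounting_eq_theta_div_log_add_integral hx2
  rw [← primePi_eq_counting x (by linarith)] at e1
  have e2 := Li_parts x hx2
  rw [hlx] at e1 e2
  set I1 := ∫ t in (2:ℝ)..x, Chebyshev.theta t/(t*log t^2) with hI1
  set I2 := ∫ t in (2:ℝ)..x, t/(t*log t^2) with hI2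
  set I3 := ∫ t in (2:ℝ)..x, (Chebyshev.psi t - Chebyshev.theta t)/(t*log t^2) with hI3
  have e3 : ∫ t in (2:ℝ)..x, (Chebyshev.psi t - t)/(t*log t^2) = I3 + I1 - I2 := by
    have j1 : IntervalIntegrable (fun t => (Chebyshev.psi t - Chebyshev.theta t)/(t*log t^2)) volume 2 x := by
      have := (psi_int x hx2 2).sub (theta_int x hx2 2)
      refine this.congr (fun t _ => ?_)
      ring
    have j2 := theta_int x hx2 2
    have j3 := id_int (fun t => t) continuous_id x hx2 2
    rw [hI3, hI1, hI2, ← intervalIntegral.integral_add j1 j2, ← intervalIntegral.integral_sub (j1.add j2) j3]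
    congr 1
    funext t
    ring
  have b0 := h1 u hu
  rw [← hx, e3] at b0
  have b3 : |I3| ≤ C0 * (K0 + exp (u/2)/u) := by
    have h2 : |I3| ≤ ∫ t in (2:ℝ)..x, C0*(√t/(t*log t^2)) := by
      rw [← Real.norm_eq_abs, hI3]
      apply intervalIntegral.norm_integral_le_of_norm_le hx2
      · refine Eventually.of_forall fun t ht => ?_
        have h2 : 2 ≤ t := ht.1.le
        have hl := log_ne t h2
        have ht0 : 0 < t := by linarith
        rw [Real.norm_eq_abs, abs_div, abs_of_pos (by positivity : 0 < t*log t^2), mul_div_assoc']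
        have := hC0 t
        gcongr
      · exact (id_int _ continuous_sqrt x hx2 2).const_mul C0
    rw [intervalIntegral.integral_const_mul] at h2
    refine h2.trans ?_
    have := hI u hu
    gcongr
  have b4 := hC0 x
  rw [hsx] at b4
  have hBe : u * B u - Ef u = -(Chebyshev.psi x - Chebyshev.theta x) + u * (I3 + I1 - I2) - u * I3 + 2*u/log 2 := by
    unfold B Ef
    rw [← hx, e1, e2]
    have := log2_pos
    field_simp
    ring
  rw [hBe]
  set X := exp (u/2) with hXd
  have huX : u ≤ 2*X := by have := add_one_le_exp (u/2); linarith
  have hl2 := log2_pos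
  have c1 : |u * (I3 + I1 - I2)| ≤ 2*K1*X + K1*X := by
    rw [abs_mul, abs_of_pos hu0]
    calc u * |I3 + I1 - I2| ≤ u * (K1 + K1*(X/u)) := by gcongr
      _ = u*K1 + K1*X := by field_simp
      _ ≤ _ := by nlinarith
  have c2 : |u * I3| ≤ 2*C0*K0*X + C0*X := by
    rw [abs_mul, abs_of_pos hu0]
    calc u * |I3| ≤ u * (C0*(K0 + X/u)) := by gcongr
      _ = u*(C0*K0) + C0*X := by field_simp
      _ ≤ 2*X*(C0*K0) + C0*X := by gcongr
      _ = _ := by ring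
  have c3 : |2*u/log 2| ≤ 4/log 2*X := by
    rw [abs_of_pos (by positivity), div_mul_eq_mul_div]
    exact div_le_div_of_nonneg_right (by linarith) hl2.le
  have hX0 : 0 < X := exp_pos _
  rw [abs_le] at b4 c1 c2 c3 ⊢
  have hex : (C0 + 2*K1 + K1 + 2*C0*K0 + C0 + 4/log 2 + 1)*X =
      C0*X + (2*K1*X + K1*X) + (2*C0*K0*X + C0*X) + 4/log 2*X + X := by ring
  rw [hex]
  obtain ⟨b41, b42⟩ := b4
  obtain ⟨c11, c12⟩ := c1
  obtain ⟨c21, c22⟩ := c2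
  obtain ⟨c31, c32⟩ := c3
  constructor <;> linarith

end Kacz

namespace Kacz
open MeasureTheory Asymptotics

lemma onesided (W : ℝ → ℝ) (C K η : ℝ) (hC : 0 < C) (hη : |η| = 1)
    (hE : ∀ u, 0 ≤ u → |Psi1 u + exp (u/2) * W u| ≤ C * (1+u))
    (hAP : ∀ ε : ℝ, 0 < ε → ∃ L, 0 < L ∧ ∀ U : ℝ, ∃ t, U ≤ t ∧ t ≤ U + L ∧ ∀ u, |W (u+t) - W u| ≤ ε)
    (hB : ∀ L U0 : ℝ, ∃ U, U0 ≤ U ∧ ∀ u, U < u → u < U + L → η * B u ≤ 0)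
    (hK : ∀ u, 4 ≤ u → |u * B u - Ef u| ≤ K * exp (u/2)) (a b : ℝ) (hab : a ≤ b) :
    η * (exp (a/2) * W a - exp (b/2) * W b) ≤ 2*K*(exp (b/2) - exp (a/2)) := by
  apply le_of_forall_pos_le_add
  intro δ hδ
  set P := exp (a/2) with hP
  set Q := exp (b/2) with hQ
  have hP0 : 0 < P := exp_pos _
  have hQ0 : 0 < Q := exp_pos _
  obtain ⟨L, hL, hL2⟩ := hAP (δ/2/(P+Q)) (by positivity)
  set M := C*(4+|a|+|b|) with hM
  have hM0 : 0 < M := by positivity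
  obtain ⟨U, hU, hU2⟩ := hB (L + (b-a) + 2) (4 + |a| + |b| + 16*M/δ)
  obtain ⟨t, ht1, ht2, ht3⟩ := hL2 (U - a + 1)
  have ha1 := le_abs_self a
  have ha2 := neg_abs_le a
  have hb1 := le_abs_self b
  have hb2 := neg_abs_le b
  have hMd : 0 < 16*M/δ := by positivity
  have ht4 : 16*M/δ ≤ t := by linarith [abs_nonneg b]
  have ht5 : 1 ≤ t := by linarith [abs_nonneg b, abs_nonneg a]
  set E := exp (t/2) with hEd
  have hE0 : 0 < E := exp_pos _
  have hEt : t^2/8 ≤ E := by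
    have := quadratic_le_exp_of_nonneg (x := t/2) (by linarith)
    nlinarith
  have herr : C*(1+(a+t)) + C*(1+(b+t)) ≤ δ/2*E := by
    have h1 : C*(1+(a+t)) + C*(1+(b+t)) ≤ M*t := by
      rw [hM, ← mul_add, mul_assoc]
      apply mul_le_mul_of_nonneg_left _ hC.le
      nlinarith [abs_nonneg a, abs_nonneg b]
    have h2 : 16*M ≤ t*δ := by rwa [div_le_iff₀ hδ] at ht4
    nlinarith
  have hPE : exp ((a+t)/2) = P*E := by rw [hP, hEd, ← exp_add]; congr 1; ring
  have hQE : exp ((b+t)/2) = Q*E := by rw [hQ, hEd, ← exp_add]; congr 1; ring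
  have hEf : ∀ u ∈ Icc (a+t) (b+t), η * Ef u ≤ K * exp (u/2) := by
    intro u hu
    have h1 : U < u := by linarith [hu.1]
    have h4 : 4 ≤ u := by linarith [abs_nonneg a, abs_nonneg b]
    have h2 := hU2 u h1 (by linarith [hu.2])
    have h3 := hK u h4
    have h5 : |η * (u * B u - Ef u)| ≤ K * exp (u/2) := by rw [abs_mul, hη, one_mul]; exact h3
    have h6 := (abs_le.1 h5).1
    have h7 : u * (η * B u) ≤ 0 := mul_nonpos_of_nonneg_of_nonpos (by linarith) h2
    nlinarith
  have hIntg : Psi1 (b+t) - Psi1 (a+t) = ∫ v in (a+t)..(b+t), Ef v := by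
    unfold Psi1
    exact intervalIntegral.integral_interval_sub_left (Ef_int _ _) (Ef_int _ _)
  have hci : IntervalIntegrable (fun u => K * exp (u/2)) volume (a+t) (b+t) :=
    (by fun_prop : Continuous (fun u => K * exp (u/2))).intervalIntegrable _ _
  have hexp : ∫ v in (a+t)..(b+t), K * exp (v/2) = 2*K*(Q*E - P*E) := by
    have : ∀ v ∈ uIcc (a+t) (b+t), HasDerivAt (fun v => 2*K*exp (v/2)) (K * exp (v/2)) v := by
      intro v _
      have h1 : HasDerivAt (fun v:ℝ => v/2) (1/2) v := (hasDerivAt_id v).div_const 2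
      refine ((h1.exp).const_mul (2*K)).congr_deriv ?_
      ring
    rw [intervalIntegral.integral_eq_sub_of_hasDerivAt this hci, hPE, hQE]
    ring
  have hmono : η * (Psi1 (b+t) - Psi1 (a+t)) ≤ 2*K*(Q*E - P*E) := by
    rw [hIntg, ← hexp, ← intervalIntegral.integral_const_mul]
    exact intervalIntegral.integral_mono_on (by linarith) ((Ef_int _ _).const_mul η) hci hEf
  have e1 := hE (a+t) (by linarith [abs_nonneg b])
  have e2 := hE (b+t) (by linarith [abs_nonneg b])
  rw [hPE] at e1
  rw [hQE] at e2
  have f1 : |η * (Psi1 (a+t) + P*E*W (a+t))| ≤ C*(1+(a+t)) := by rw [abs_mul, hη, one_mul]; exact e1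
  have f2 : |η * (Psi1 (b+t) + Q*E*W (b+t))| ≤ C*(1+(b+t)) := by rw [abs_mul, hη, one_mul]; exact e2
  have g1 : |η * (W (a+t) - W a)| ≤ δ/2/(P+Q) := by rw [abs_mul, hη, one_mul]; exact ht3 a
  have g2 : |η * (W (b+t) - W b)| ≤ δ/2/(P+Q) := by rw [abs_mul, hη, one_mul]; exact ht3 b
  have f1' := (abs_le.1 f1).2
  have f2' := (abs_le.1 f2).1
  have g1' := (abs_le.1 g1).1
  have g2' := (abs_le.1 g2).2
  have k1 : (η * (P*W (a+t) - Q*W (b+t)))*E ≤ (2*K*(Q-P) + δ/2)*E := by nlinarith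
  have k2 := le_of_mul_le_mul_right k1 hE0
  have k3 : P * (δ/2/(P+Q)) + Q * (δ/2/(P+Q)) = δ/2 := by field_simp
  have k4 := mul_le_mul_of_nonneg_left g1' hP0.le
  have k5 := mul_le_mul_of_nonneg_left g2' hQ0.le
  linarith

lemma wf_lower (g v : ℝ) :
    (1 - cos (g*v))/(1/4+g^2) ≤ wf g v - wf g 0 + 2*|v|/(1/4+g^2) := by
  have hq : 0 < 1/4+g^2 := by positivity
  have h1 : 1 - cos (g*v) ≤ |g| * |v| := by
    have h := Real.cos_two_mul (g*v/2)
    rw [show 2*(g*v/2) = g*v by ring] at h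
    have h2 := Real.sin_sq_add_cos_sq (g*v/2)
    have h3 : |sin (g*v/2)| ≤ |g*v/2| := abs_sin_le_abs
    have h4 := abs_sin_le_one (g*v/2)
    have h5 : |g*v/2| = |g| * |v|/2 := by rw [abs_div, abs_mul, abs_two]
    have h6 : sin (g*v/2)^2 = |sin (g*v/2)|^2 := (sq_abs _).symm
    nlinarith [abs_nonneg (sin (g*v/2))]
  have h2 : |g| ≤ 1/4+g^2 := by nlinarith [sq_nonneg (|g| - 1/2), sq_abs g]
  have h3 : -(g^2*|v|) ≤ g * sin (g*v) := by
    have h4 : |g * sin (g*v)| ≤ g^2*|v| := by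
      rw [abs_mul]
      have : |sin (g*v)| ≤ |g*v| := abs_sin_le_abs
      rw [abs_mul] at this
      calc |g| * |sin (g*v)| ≤ |g| * (|g| * |v|) := by gcongr
        _ = g^2*|v| := by rw [← sq_abs g]; ring
    exact (abs_le.1 h4).1
  have h5 : wf g v - wf g 0 + 2*|v|/(1/4+g^2) - (1 - cos (g*v))/(1/4+g^2)
      = (-(1/2)*(1 - cos (g*v)) + g*sin (g*v) + 2*|v| * (1/4+g^2))/(1/4+g^2)^2 := by
    unfold wf
    simp only [mul_zero, cos_zero, sin_zero]
    field_simp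
    ring
  have h6 : 0 ≤ (-(1/2)*(1 - cos (g*v)) + g*sin (g*v) + 2*|v| * (1/4+g^2))/(1/4+g^2)^2 := by
    apply div_nonneg _ (by positivity)
    have := mul_le_mul_of_nonneg_right h2 (abs_nonneg v)
    nlinarith [abs_nonneg v]
  linarith

lemma one_sub_cos_lap (x g : ℝ) (hx : 0 < x) :
    IntegrableOn (fun u => (1 - cos (g*u)) * exp (-x*u)) (Ioi 0) ∧
    ∫ u in Ioi (0:ℝ), (1 - cos (g*u)) * exp (-x*u) = 1/x - x/(x^2+g^2) := by
  have i1 : IntegrableOn (fun u:ℝ => exp (-x*u)) (Ioi 0) := exp_neg_integrableOn_Ioi 0 hx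
  have i2 : IntegrableOn (fun u:ℝ => cos (g*u) * exp (-x*u)) (Ioi 0) := by
    refine i1.mono' (by fun_prop) (Eventually.of_forall fun u => ?_)
    rw [norm_mul, Real.norm_eq_abs, Real.norm_eq_abs, abs_of_pos (exp_pos _)]
    exact mul_le_of_le_one_left (exp_pos _).le (abs_cos_le_one _)
  have e : (fun u:ℝ => (1 - cos (g*u)) * exp (-x*u)) = fun u => exp (-x*u) - cos (g*u) * exp (-x*u) := by
    funext u; ring
  rw [e]
  refine ⟨i1.sub i2, ?_⟩
  rw [integral_sub i1 i2, cosLap x g hx, integral_exp_Ioi x 0 hx]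
  simp

lemma no_onesided {ι : Type} [Countable ι] (γ n : ι → ℝ) (hn : ∀ i, 0 ≤ n i)
    (hH : ∀ x:ℝ, 0<x → HasSum (fun i => n i*(x/(x^2+γ i^2))) (xiL x))
    (hS : Summable fun i => n i/(1/4+γ i^2)) (σ K : ℝ) (hσ : |σ| = 1)
    (hW : ∀ u, 0 ≤ u → Wc γ n (σ*u) - Wc γ n 0 ≤ K*u) : False := by
  set S := ∑' i, n i/(1/4+γ i^2) with hSd
  have hfin : ∀ (T : Finset ι) (u : ℝ), 0 ≤ u →
      ∑ i ∈ T, n i/(1/4+γ i^2)*(1 - cos (γ i*u)) ≤ (K+2*S)*u := by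
    intro T u hu
    have s1 := (Wc_summable γ n hn hS (σ*u)).hasSum
    have s2 := (Wc_summable γ n hn hS 0).hasSum
    have s3 := hS.hasSum.mul_left (2*u)
    have s4 := (s1.sub s2).add s3
    have hterm : ∀ i, n i/(1/4+γ i^2)*(1 - cos (γ i*u)) ≤
        n i * wf (γ i) (σ*u) - n i * wf (γ i) 0 + 2*u*(n i/(1/4+γ i^2)) := by
      intro i
      have h := wf_lower (γ i) (σ*u)
      have hc : cos (γ i*(σ*u)) = cos (γ i*u) := by
        rcases (abs_eq (by norm_num : (0:ℝ) ≤ 1)).1 hσ with h | h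
        · rw [h, one_mul]
        · rw [h, show γ i * (-1*u) = -(γ i * u) by ring, cos_neg]
      rw [hc, abs_mul, hσ, one_mul, abs_of_nonneg hu] at h
      have := mul_le_mul_of_nonneg_left h (hn i)
      calc n i/(1/4+γ i^2)*(1 - cos (γ i*u)) = n i * ((1 - cos (γ i*u))/(1/4+γ i^2)) := by ring
        _ ≤ _ := this
        _ = _ := by ring
    have h0 : ∀ i, 0 ≤ n i/(1/4+γ i^2)*(1 - cos (γ i*u)) := by
      intro i
      have := cos_le_one (γ i*u)
      have := hn i
      exact mul_nonneg (by positivity) (by linarith)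
    calc _ ≤ ∑ i ∈ T, (n i * wf (γ i) (σ*u) - n i * wf (γ i) 0 + 2*u*(n i/(1/4+γ i^2))) :=
          Finset.sum_le_sum fun i _ => hterm i
      _ ≤ _ := sum_le_hasSum T (fun i _ => (h0 i).trans (hterm i)) s4
      _ ≤ _ := by
        have := hW u hu
        unfold Wc at this
        linarith
  obtain ⟨x, hx1, hx⟩ := xiL_unbounded (K + 2*S + S/4)
  have hx0 : 0 < x := by linarith
  have hle : xiL x ≤ K + 2*S + S/4 := by
    refine hasSum_le_of_sum_le (hH x hx0) fun T => ?_
    have hIntg := setIntegral_mono_on (μ := volume) (s := Ioi (0:ℝ))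
      (f := fun u => ∑ i ∈ T, n i/(1/4+γ i^2)*((1 - cos (γ i*u))*exp (-x*u)))
      (g := fun u => (K+2*S)*(u*exp (-x*u)))
      (integrable_finsetSum _ fun i _ => ((one_sub_cos_lap x (γ i) hx0).1).const_mul _)
      ((u_laplace x hx0).1.const_mul _) measurableSet_Ioi
      (fun u hu => by
        have := mul_le_mul_of_nonneg_right (hfin T u (le_of_lt hu)) (exp_pos (-x*u)).le
        rw [Finset.sum_mul] at this
        simpa only [mul_assoc] using this)
    rw [integral_finsetSum _ (fun i _ => ((one_sub_cos_lap x (γ i) hx0).1).const_mul _),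
      integral_const_mul, (u_laplace x hx0).2] at hIntg
    simp only [integral_const_mul, (one_sub_cos_lap x _ hx0).2] at hIntg
    have h2 : x^2 * ∑ i ∈ T, n i/(1/4+γ i^2)*(1/x - x/(x^2+γ i^2)) ≤ K + 2*S := by
      calc _ ≤ x^2 * ((K+2*S)*(1/x^2)) := by gcongr
        _ = _ := by field_simp
    rw [Finset.mul_sum] at h2
    have h3 : ∑ i ∈ T, n i/(1/4+γ i^2) ≤ S := hS.sum_le_tsum T fun i _ => by
      have := hn i; positivity
    have h4 : ∑ i ∈ T, n i*(x/(x^2+γ i^2)) ≤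
        ∑ i ∈ T, (x^2*(n i/(1/4+γ i^2)*(1/x - x/(x^2+γ i^2))) + 1/4*(n i/(1/4+γ i^2))) := by
      apply Finset.sum_le_sum
      intro i _
      have hq : 0 < 1/4+γ i^2 := by positivity
      have hxg : 0 < x^2+γ i^2 := by positivity
      have e : x^2*(n i/(1/4+γ i^2)*(1/x - x/(x^2+γ i^2))) + 1/4*(n i/(1/4+γ i^2)) - n i*(x/(x^2+γ i^2))
          = 1/4*(n i/(1/4+γ i^2))*(1 - x/(x^2+γ i^2)) := by
        field_simp
        ring
      have h5 : x/(x^2+γ i^2) ≤ 1 := by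
        rw [div_le_one hxg]; nlinarith [sq_nonneg (γ i)]
      have h6 : 0 ≤ 1/4*(n i/(1/4+γ i^2))*(1 - x/(x^2+γ i^2)) := by
        have := hn i
        exact mul_nonneg (by positivity) (by linarith)
      linarith
    rw [Finset.sum_add_distrib, ← Finset.mul_sum T _ (1/4)] at h4
    linarith
  linarith

lemma caseII (hRH : ∀ ρ:ℂ, riemannZeta₁ ρ = 0 → ρ.re ≤ 1/2) (η : ℝ) (hη : |η| = 1) :
    ∃ L U0 : ℝ, ∀ U, U0 ≤ U → ∃ u, U < u ∧ u < U + L ∧ 0 < η * B u := by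
  by_contra hcon
  push Not at hcon
  obtain ⟨ι, hι, γ, n, hn, hH⟩ := hadamard hRH
  have hS : Summable fun i => n i/(1/4+γ i^2) := by
    have := (hH (1/2) (by norm_num)).summable.mul_left 2
    refine this.congr fun i => ?_
    ring
  obtain ⟨C, hC, hE⟩ := explicit_formula γ n hn hH hS
  set S := ∑' i, n i/(1/4+γ i^2) with hSd
  have hS0 : 0 ≤ S := tsum_nonneg fun i => by have := hn i; positivity
  have hWb := Wc_bound γ n hn hS
  have hP : ∀ u, 0 ≤ u → |Psi1 u| ≤ (2*C+S) * exp (u/2) := by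
    intro u hu
    have h1 := hE u hu
    have h2 := add_one_le_exp (u/2)
    have h3 : |exp (u/2) * Wc γ n u| ≤ exp (u/2) * S := by
      rw [abs_mul, abs_of_pos (exp_pos _)]
      exact mul_le_mul_of_nonneg_left (hWb u) (exp_pos _).le
    rw [abs_le] at h1 h3 ⊢
    have h4 : C*(1+u) ≤ C*(2*exp (u/2)) := mul_le_mul_of_nonneg_left (by linarith) hC.le
    constructor <;> linarith [h1.1, h1.2, h3.1, h3.2]
  obtain ⟨K, hK0, hK⟩ := pi_psi (2*C+S) (by positivity) hP
  have hone := onesided (Wc γ n) C K η hC hη hE (almost_periodic γ n hn hS) hcon hK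
  refine no_onesided γ n hn hH hS (-η) ((2*K+S)/2) (by rw [abs_neg, hη]) ?_
  intro u hu
  have hX : 1 - u/2 ≤ exp (-u/2) := by have := add_one_le_exp (-u/2); linarith
  have hX1 : exp (-u/2) ≤ 1 := exp_le_one_iff.2 (by linarith)
  rcases (abs_eq (by norm_num : (0:ℝ) ≤ 1)).1 hη with h | h
  · rw [h] at hone ⊢
    have h1 := hone (-u) 0 (by linarith)
    rw [zero_div, exp_zero, one_mul, one_mul] at h1
    rw [show -1*u = -u by ring]
    have h2 := (abs_le.1 (hWb (-u))).2
    set X := exp (-u/2)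
    have h3 : (1-X)*Wc γ n (-u) ≤ (1-X)*S := mul_le_mul_of_nonneg_left h2 (by linarith)
    have h4 : (1-X)*(2*K+S) ≤ (u/2)*(2*K+S) := mul_le_mul_of_nonneg_right (by linarith) (by positivity)
    linarith
  · rw [h] at hone ⊢
    have h1 := hone 0 u hu
    rw [zero_div, exp_zero, one_mul] at h1
    rw [show - -1*u = u by ring]
    have h2 := (abs_le.1 (hWb 0)).1
    have h5 : exp (-u/2) * exp (u/2) = 1 := by rw [← exp_add, neg_div, neg_add_cancel, exp_zero]
    set X := exp (-u/2)
    have hX0 : 0 < X := exp_pos _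
    have h6 := mul_le_mul_of_nonneg_left h1 hX0.le
    have h7 : X * (-1 * (Wc γ n 0 - exp (u/2)*Wc γ n u)) = -X*Wc γ n 0 + Wc γ n u := by
      linear_combination Wc γ n u * h5
    have h8 : X * (2*K*(exp (u/2) - 1)) = 2*K*(1-X) := by linear_combination 2*K*h5
    rw [h7, h8] at h6
    have h3 : (1-X)*(-S) ≤ (1-X)*Wc γ n 0 := mul_le_mul_of_nonneg_left h2 (by linarith)
    have h4 : (1-X)*(2*K+S) ≤ (u/2)*(2*K+S) := mul_le_mul_of_nonneg_right (by linarith) (by positivity)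
    linarith

end Kacz

namespace Kacz
open MeasureTheory Asymptotics

lemma alt_of_windows (h : ∀ η : ℝ, |η| = 1 →
    ∃ L U0 : ℝ, ∀ U, U0 ≤ U → ∃ u, U < u ∧ u < U + L ∧ 0 < η * B u) :
    ∃ C₁ C₂ : ℝ, 0 < C₁ ∧ ∀ N : ℕ, Alt B (log 2) (C₁*N+C₂) N := by
  obtain ⟨L1, V1, h1⟩ := h 1 (by simp)
  obtain ⟨L2, V2, h2⟩ := h (-1) (by simp)
  set L := max L1 L2 ⊔ 1 with hL
  set V := max V1 V2 ⊔ log 2 with hV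
  have hL0 : 0 < L := lt_of_lt_of_le one_pos (le_max_right _ _)
  have hL1 : L1 ≤ L := (le_max_left _ _).trans (le_max_left _ _)
  have hL2 : L2 ≤ L := (le_max_right _ _).trans (le_max_left _ _)
  have hV1 : V1 ≤ V := (le_max_left _ _).trans (le_max_left _ _)
  have hV2 : V2 ≤ V := (le_max_right _ _).trans (le_max_left _ _)
  have hV3 : log 2 ≤ V := le_max_right _ _
  have hex : ∀ i : ℕ, ∃ u, V + i*L < u ∧ u < V + i*L + L ∧ 0 < (-1:ℝ)^i * B u := by
    intro i
    have hi : 0 ≤ (i:ℝ)*L := by positivity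
    rcases neg_one_pow_eq_or ℝ i with h | h
    · obtain ⟨u, a, b, c⟩ := h1 (V + i*L) (by linarith)
      exact ⟨u, a, by linarith, by rw [h]; exact c⟩
    · obtain ⟨u, a, b, c⟩ := h2 (V + i*L) (by linarith)
      exact ⟨u, a, by linarith, by rw [h]; exact c⟩
  choose x hx1 hx2 hx3 using hex
  refine ⟨L, V + L, hL0, fun N => ⟨x, ?_, ?_, ?_⟩⟩
  · intro i hi
    have h0 : 0 ≤ (i:ℝ)*L := by positivity
    have h1 : (i:ℝ)*L ≤ N*L := by
      have : (i:ℝ) ≤ N := by exact_mod_cast hi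
      gcongr
    constructor <;> linarith [hx1 i, hx2 i]
  · intro i _
    have a := hx2 i
    have b := hx1 (i+1)
    push_cast at b
    linarith
  · intro i _
    have a := mul_pos (hx3 i) (hx3 (i+1))
    have e : (-1:ℝ)^i * B (x i) * ((-1)^(i+1) * B (x (i+1))) = -(B (x i) * B (x (i+1))) := by
      have : ((-1:ℝ)^i)*((-1)^i) = 1 := by rw [← mul_pow]; simp
      rw [pow_succ]
      linear_combination (-(B (x i) * B (x (i+1)))) * this
    rw [e] at a
    linarith

lemma alt_all : ∃ C₁ C₂ : ℝ, 0 < C₁ ∧ ∀ N : ℕ, Alt B (log 2) (C₁*N+C₂) N := by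
  by_cases h : ∃ ρ : ℂ, riemannZeta₁ ρ = 0 ∧ 1/2 < ρ.re
  · obtain ⟨ρ, h1, h2⟩ := h
    exact caseI ρ h1 h2
  · push Not at h
    exact alt_of_windows (caseII h)

end Kacz

/-- (Kaczorowski) There exist `c₃ > 0` and `T₀` such that for every `T ≥ T₀` the function
`π(x) − Li(x)` has at least `⌊c₃·log T⌋` sign changes on `(2, T)`. -/
theorem kaczorowski_sign_changes :
    ∃ c₃ : ℝ, 0 < c₃ ∧ ∃ T₀ : ℝ, ∀ T : ℝ, T₀ ≤ T →
      ∃ x : ℕ → ℝ,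
        (∀ i ≤ ⌊c₃ * Real.log T⌋₊, 2 < x i ∧ x i < T) ∧
        (∀ i < ⌊c₃ * Real.log T⌋₊, x i < x (i + 1)) ∧
        (∀ i < ⌊c₃ * Real.log T⌋₊,
          ((primePi (x i) : ℝ) - Li (x i)) * ((primePi (x (i + 1)) : ℝ) - Li (x (i + 1))) < 0) := by
  exact Kacz.final_of_alt Kacz.alt_all
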